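/- Given an SMG G with Muller objectives and rational μ ∈ [0,1], one can construct in exponential time a first-order sentence ψ over the ordered field of real numbers (ℝ, +, ×, 0, 1, ≤) — built from the support sets SUPP^A₀ and SUPP^A_{Ω∖{0}}, the bottom strongly connected components of the support-restricted subarenas A^S, and the end components of the subarenas A^{S₋ᵢ}, via the formulas ψ^sys, ψ^env, ψ^z and ψ^r — such that ψ is true in (ℝ, +, ×, 0, 1, ≤) if and only if the answer to Stationary-Muller-NCRSP for (G, μ) is yes. -/

import Mathlib

/- Common infrastructure for formalizing statements about stochastic
   multiplayer non-zero-sum games (SMGs) and the non-cooperative rational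
   synthesis problem (NCRSP), following the paper's definitions. -/

open scoped ENNReal

namespace NCRSPPaper

/-! ### Game arenas -/

/-- A stochastic multiplayer game arena with players `Fin (k+1)` (player `0`
is the system) over vertex type `V`.  A vertex with `owner v = none` is a
nature vertex; its outgoing transition probabilities are given by `prob`.
Player-controlled vertices have their possible moves given by `edge`. -/
structure Arena (k : ℕ) (V : Type) where
  owner : V → Option (Fin (k + 1))
  edge : V → V → Bool
  prob : V → V → ℚ
  init : V

variable {k : ℕ} {V : Type}

/-- The set of successors of a vertex. -/
def Arena.next (A : Arena k V) (u : V) : Set V :=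
  {v | (A.owner u = none ∧ 0 < A.prob u v) ∨ (A.owner u ≠ none ∧ A.edge u v = true)}

/-- A terminal vertex: its only outgoing edge is the self loop. -/
def Arena.terminal (A : Arena k V) (v : V) : Prop := A.next v = {v}

/-- Well-formedness of an arena: every vertex has a successor and the
nature rows are probability distributions. -/
def Arena.WF [Fintype V] (A : Arena k V) : Prop :=
  (∀ u, (A.next u).Nonempty) ∧
  ∀ u, A.owner u = none → (∀ v, 0 ≤ A.prob u v) ∧ (∑ v, A.prob u v) = 1

/-! ### Plays -/

/-- A play is an infinite sequence of vertices. -/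
abbrev Play (V : Type) := ℕ → V

/-- `infSet π` is the set of vertices occurring infinitely often in `π`. -/
def infSet (π : Play V) : Set V := {v | ∀ m, ∃ l, m ≤ l ∧ π l = v}

/-! ### Strategies -/

/-- A (behavioral, possibly history-dependent, probabilistic) strategy:
given the history of vertices strictly preceding the current one and the
current vertex, it yields a probability distribution over vertices. -/
abbrev Strategy (V : Type) := List V → V → PMF V

/-- A strategy is valid for an arena if it only assigns positive
probability to successors of the current vertex. -/
def Strategy.Valid (A : Arena k V) (σ : Strategy V) : Prop :=
  ∀ hist u v, σ hist u v ≠ 0 → v ∈ A.next u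

/-- A stationary (memoryless) strategy depends only on the current vertex. -/
def Strategy.Stationary (σ : Strategy V) : Prop :=
  ∀ h h' u, σ h u = σ h' u

/-- A pure (deterministic) strategy assigns probability 1 to a single move. -/
def Strategy.Pure (σ : Strategy V) : Prop :=
  ∀ h u, ∃ v, σ h u v = 1

/-- A positional strategy is pure and stationary. -/
def Strategy.Positional (σ : Strategy V) : Prop :=
  Strategy.Stationary σ ∧ Strategy.Pure σ

/-- A finite-state strategy is realized by a Mealy machine with finitely
many memory states. -/
def Strategy.FiniteState (σ : Strategy V) : Prop :=
  ∃ (M : Type) (_ : Finite M) (m0 : M) (upd : M → V → M) (out : M → V → PMF V),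
    ∀ h u, σ h u = out (h.foldl upd m0) u

/-- A `t`-memory strategy only depends on the most recent `t` vertices of
the history (plus the current vertex). -/
def Strategy.TMemory (t : ℕ) (σ : Strategy V) : Prop :=
  ∀ h u, σ h u = σ (h.drop (h.length - t)) u

/-- A strategy profile assigns a strategy to every player. -/
abbrev Profile (k : ℕ) (V : Type) := Fin (k + 1) → Strategy V

def Profile.Valid (A : Arena k V) (σ : Profile k V) : Prop :=
  ∀ i, Strategy.Valid A (σ i)

/-! ### The induced probability of a set of plays -/

/-- One-step transition probability at vertex `u` with preceding history
`hist`, under strategy profile `σ`. -/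
noncomputable def Arena.stepProb (A : Arena k V) (σ : Profile k V)
    (hist : List V) (u v : V) : ℝ≥0∞ :=
  match A.owner u with
  | none => ENNReal.ofReal ((A.prob u v : ℚ) : ℝ)
  | some i => σ i hist u v

/-- Probability that, starting from current vertex `u` with preceding
history `hist`, the play continues with the given finite word. -/
noncomputable def extProb (A : Arena k V) (σ : Profile k V) :
    List V → V → List V → ℝ≥0∞
  | _, _, [] => 1
  | hist, u, v :: rest => A.stepProb σ hist u v * extProb A σ (hist ++ [u]) v rest

/-- Probability that a play starting at `s` begins with the finite word `w`. -/
noncomputable def wordProbFrom [DecidableEq V] (A : Arena k V) (σ : Profile k V)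
    (s : V) : List V → ℝ≥0∞
  | [] => 1
  | v :: rest => (if v = s then 1 else 0) * extProb A σ [] v rest

/-- The cylinder of plays extending a finite word. -/
def cyl (w : List V) : Set (Play V) :=
  {π | ∀ i (h : i < w.length), π i = w.get ⟨i, h⟩}

open scoped Classical in
/-- `PrFrom A σ s O` is the probability, under the strategy profile `σ`
(and nature's probabilities), that a play starting at `s` belongs to `O`.
It is defined as the Carathéodory outer measure generated by the natural
premeasure on cylinder sets. -/
noncomputable def PrFrom [DecidableEq V] (A : Arena k V) (σ : Profile k V)
    (s : V) : Set (Play V) → ℝ≥0∞ :=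
  fun O =>
    MeasureTheory.OuterMeasure.ofFunction
      (fun S => if S = ∅ then 0
                else ⨅ (w : List V) (_ : S ⊆ cyl w), wordProbFrom A σ s w)
      (by simp) O

/-- The payoff of player `i`: probability that the objective `O i` is met,
for the play started at the initial vertex. -/
noncomputable def Pay [DecidableEq V] (A : Arena k V)
    (O : Fin (k + 1) → Set (Play V)) (σ : Profile k V) (i : Fin (k + 1)) : ℝ≥0∞ :=
  PrFrom A σ A.init (O i)

/-! ### Equilibria and synthesis problems -/

/-- Nash equilibrium: no player has a profitable unilateral deviation. -/
def NE [DecidableEq V] (A : Arena k V) (O : Fin (k + 1) → Set (Play V))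
    (σ : Profile k V) : Prop :=
  ∀ i, ∀ τ : Strategy V, Strategy.Valid A τ →
    Pay A O (Function.update σ i τ) i ≤ Pay A O σ i

/-- 0-fixed Nash equilibrium: no environment player (`i ≠ 0`) has a
profitable unilateral deviation. -/
def ZeroNE [DecidableEq V] (A : Arena k V) (O : Fin (k + 1) → Set (Play V))
    (σ : Profile k V) : Prop :=
  ∀ i, i ≠ 0 → ∀ τ : Strategy V, Strategy.Valid A τ →
    Pay A O (Function.update σ i τ) i ≤ Pay A O σ i

/-- The (yes-instances of the) cooperative rational synthesis problem, with
all strategies restricted to class `C`: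
`∃ σ̄. NE(σ̄) ∧ Pay₀(σ̄) ≥ μ`. -/
def CRSPAnswer [DecidableEq V] (A : Arena k V) (O : Fin (k + 1) → Set (Play V))
    (C : Strategy V → Prop) (μ : ℚ) : Prop :=
  ∃ σ : Profile k V, Profile.Valid A σ ∧ (∀ i, C (σ i)) ∧ NE A O σ ∧
    ENNReal.ofReal (μ : ℝ) ≤ Pay A O σ 0

/-- The (yes-instances of the) non-cooperative rational synthesis problem,
with the system's strategy restricted to class `C0` and the environment
players' strategies restricted to class `Cenv`:
`∃ σ₀. ∀ σ̄₋₀. (0NE(σ̄) ⇒ Pay₀(σ̄) ≥ μ)`. -/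
def NCRSPAnswer [DecidableEq V] (A : Arena k V) (O : Fin (k + 1) → Set (Play V))
    (C0 Cenv : Strategy V → Prop) (μ : ℚ) : Prop :=
  ∃ σ0 : Strategy V, Strategy.Valid A σ0 ∧ C0 σ0 ∧
    ∀ σ : Profile k V, σ 0 = σ0 → Profile.Valid A σ →
      (∀ i, i ≠ 0 → Cenv (σ i)) →
      ZeroNE A O σ → ENNReal.ofReal (μ : ℝ) ≤ Pay A O σ 0

/-- The variant `NCRSP>` with strict payoff threshold. -/
def NCRSPgtAnswer [DecidableEq V] (A : Arena k V) (O : Fin (k + 1) → Set (Play V))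
    (C0 Cenv : Strategy V → Prop) (μ : ℚ) : Prop :=
  ∃ σ0 : Strategy V, Strategy.Valid A σ0 ∧ C0 σ0 ∧
    ∀ σ : Profile k V, σ 0 = σ0 → Profile.Valid A σ →
      (∀ i, i ≠ 0 → Cenv (σ i)) →
      ZeroNE A O σ → ENNReal.ofReal (μ : ℝ) < Pay A O σ 0

/-- The complement problem of `NCRSP>`:
`∀ σ₀. ∃ σ̄₋₀. (0NE(σ̄) ∧ Pay₀(σ̄) ≤ μ)`. -/
def CoNCRSPgtAnswer [DecidableEq V] (A : Arena k V) (O : Fin (k + 1) → Set (Play V))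
    (C0 Cenv : Strategy V → Prop) (μ : ℚ) : Prop :=
  ∀ σ0 : Strategy V, Strategy.Valid A σ0 → C0 σ0 →
    ∃ σ : Profile k V, σ 0 = σ0 ∧ Profile.Valid A σ ∧
      (∀ i, i ≠ 0 → Cenv (σ i)) ∧
      ZeroNE A O σ ∧ Pay A O σ 0 ≤ ENNReal.ofReal (μ : ℝ)

/-! ### Objectives -/

/-- Boolean formulas with variables drawn from `α`. -/
inductive BForm (α : Type) : Type
  | tru : BForm α
  | fls : BForm α
  | var : α → BForm α
  | not : BForm α → BForm α
  | and : BForm α → BForm α → BForm α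
  | or : BForm α → BForm α → BForm α

namespace BForm

def holds {α : Type} (θ : α → Prop) : BForm α → Prop
  | tru => True
  | fls => False
  | var a => θ a
  | not f => ¬ holds θ f
  | and f g => holds θ f ∧ holds θ g
  | or f g => holds θ f ∨ holds θ g

def map {α β : Type} (f : α → β) : BForm α → BForm β
  | tru => tru
  | fls => fls
  | var a => var (f a)
  | not g => not (map f g)
  | and g h => and (map f g) (map f h)
  | or g h => or (map f g) (map f h)

def subst {α β : Type} (f : α → BForm β) : BForm α → BForm β
  | tru => tru
  | fls => fls
  | var a => f a
  | not g => not (subst f g)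
  | and g h => and (subst f g) (subst f h)
  | or g h => or (subst f g) (subst f h)

def bigOr {α : Type} : List (BForm α) → BForm α
  | [] => fls
  | f :: fs => or f (bigOr fs)

/-- An (arbitrary but fixed) encoding of Boolean formulas over `ℕ` into `ℕ`. -/
def toNat : BForm ℕ → ℕ
  | tru => Nat.pair 0 0
  | fls => Nat.pair 1 0
  | var i => Nat.pair 2 i
  | not f => Nat.pair 3 (toNat f)
  | and f g => Nat.pair 4 (Nat.pair (toNat f) (toNat g))
  | or f g => Nat.pair 5 (Nat.pair (toNat f) (toNat g))

end BForm

/-- The Muller objective given by a Boolean formula over the vertices: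
the set of plays `π` such that `inf(π) ⊨ φ`. -/
def mullerObj (φ : BForm V) : Set (Play V) :=
  {π | BForm.holds (· ∈ infSet π) φ}

/-- Terminal-reachability objective for a set `F` of (terminal) vertices. -/
def trObjS (F : Set V) : Set (Play V) := {π | ∃ m, π m ∈ F}

/-- Terminal-reachability objective, Boolean-valued version. -/
def trObj (F : V → Bool) : Set (Play V) := trObjS {v | F v = true}

/-! ### End components -/

/-- `E` is an end component of the arena `A` regarded as an MDP of
player `i`: it is nonempty, strongly connected, every vertex of `E`
has a successor in `E`, and vertices not controlled by `i` have all
their successors in `E`. -/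
def IsEndComponent (A : Arena k V) (i : Fin (k + 1)) (E : Set V) : Prop :=
  E.Nonempty ∧
  (∀ u ∈ E, ∀ v ∈ E,
    Relation.ReflTransGen (fun a b => a ∈ E ∧ b ∈ E ∧ b ∈ A.next a) u v) ∧
  (∀ v ∈ E, (A.next v ∩ E).Nonempty) ∧
  (∀ v ∈ E, A.owner v ≠ some i → A.next v ⊆ E)

end NCRSPPaper

namespace NCRSPPaper

/-! ### A concrete machine model, resource-bounded classes, encodings -/

/-- A configuration of a machine with `s+1` states and tape alphabet
`Fin (a+3)` (symbol `0` is the blank, symbols `1`/`2` encode the input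
bits `false`/`true`), on a one-way infinite tape. -/
structure Cfg (s a : ℕ) where
  q : Fin (s + 1)
  tape : ℕ → Fin (a + 3)
  pos : ℕ

def blankSym (a : ℕ) : Fin (a + 3) := ⟨0, by omega⟩

def bitSym (a : ℕ) (b : Bool) : Fin (a + 3) :=
  if b then ⟨2, by omega⟩ else ⟨1, by omega⟩

def initCfg (s a : ℕ) (q0 : Fin (s + 1)) (x : List Bool) : Cfg s a :=
  ⟨q0, fun i => if h : i < x.length then bitSym a (x.get ⟨i, h⟩) else blankSym a, 0⟩

/-- The tape holds the output `y` (as bits, followed by a blank). -/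
def readsOff {a : ℕ} (tape : ℕ → Fin (a + 3)) (y : List Bool) : Prop :=
  (∀ i : Fin y.length, tape (i : ℕ) = bitSym a (y.get i)) ∧
  tape y.length = blankSym a

/-- A deterministic Turing machine (one-way infinite single tape). -/
structure TM where
  states : ℕ
  symbols : ℕ
  start : Fin (states + 1)
  accept : Fin (states + 1)
  step : Fin (states + 1) → Fin (symbols + 3) →
    Option (Fin (states + 1) × Fin (symbols + 3) × Bool)

namespace TM

def stepCfg (M : TM) (c : Cfg M.states M.symbols) : Option (Cfg M.states M.symbols) :=
  match M.step c.q (c.tape c.pos) with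
  | none => none
  | some (q', a, mv) =>
      some ⟨q', Function.update c.tape c.pos a, if mv then c.pos + 1 else c.pos - 1⟩

def run (M : TM) (x : List Bool) : ℕ → Option (Cfg M.states M.symbols)
  | 0 => some (initCfg M.states M.symbols M.start x)
  | t + 1 => (M.run x t).bind M.stepCfg

def Halted (M : TM) (c : Cfg M.states M.symbols) : Prop := M.stepCfg c = none

/-- `M` decides the language `L` (with no resource bound): on every input it
halts, and it halts in the accepting state iff the input is in `L`. -/
def Decides (M : TM) (L : Set (List Bool)) : Prop :=
  ∀ x, ∃ t c, M.run x t = some c ∧ M.Halted c ∧ (x ∈ L ↔ c.q = M.accept)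

/-- `M` decides `L` within time `T` (as a function of the input length). -/
def DecidesInTime (M : TM) (L : Set (List Bool)) (T : ℕ → ℕ) : Prop :=
  ∀ x, ∃ t ≤ T x.length, ∃ c, M.run x t = some c ∧ M.Halted c ∧
    (x ∈ L ↔ c.q = M.accept)

/-- `M` decides `L` within space `S`: it halts with the correct verdict and
never moves its head beyond cell `S(|x|)`. -/
def DecidesInSpace (M : TM) (L : Set (List Bool)) (S : ℕ → ℕ) : Prop :=
  ∀ x, (∃ t c, M.run x t = some c ∧ M.Halted c ∧ (x ∈ L ↔ c.q = M.accept)) ∧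
    ∀ t c, M.run x t = some c → c.pos < S x.length

/-- `M` computes, on the encoded inputs `g x`, the encoded outputs `h x`,
within time `T`. -/
def ComputesOn {I : Type} (M : TM) (g h : I → List Bool) (T : ℕ → ℕ) : Prop :=
  ∀ x, ∃ t ≤ T (g x).length, ∃ c, M.run (g x) t = some c ∧ M.Halted c ∧
    readsOff c.tape (h x)

/-- `M` computes the function `f` on all inputs within time `T`. -/
def ComputesInTime (M : TM) (f : List Bool → List Bool) (T : ℕ → ℕ) : Prop :=
  M.ComputesOn id f T

end TM

/-- A nondeterministic Turing machine. -/
structure NTM where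
  states : ℕ
  symbols : ℕ
  start : Fin (states + 1)
  accept : Fin (states + 1)
  step : Fin (states + 1) → Fin (symbols + 3) →
    Finset (Fin (states + 1) × Fin (symbols + 3) × Bool)

namespace NTM

def stepRel (M : NTM) (c c' : Cfg M.states M.symbols) : Prop :=
  ∃ r ∈ M.step c.q (c.tape c.pos),
    c' = ⟨r.1, Function.update c.tape c.pos r.2.1,
          if r.2.2 then c.pos + 1 else c.pos - 1⟩

/-- `M` has an accepting run on `x` staying within space `S`. -/
def AcceptsInSpace (M : NTM) (x : List Bool) (S : ℕ) : Prop :=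
  ∃ (t : ℕ) (cs : ℕ → Cfg M.states M.symbols),
    cs 0 = initCfg M.states M.symbols M.start x ∧
    (∀ i < t, M.stepRel (cs i) (cs (i + 1))) ∧
    (cs t).q = M.accept ∧
    ∀ i ≤ t, (cs i).pos < S

/-- The nondeterministic machine `M` decides `L` within space `S`. -/
def DecidesInSpace (M : NTM) (L : Set (List Bool)) (S : ℕ → ℕ) : Prop :=
  ∀ x, x ∈ L ↔ M.AcceptsInSpace x (S x.length)

end NTM

/-! #### Complexity classes -/

def In2EXPTIME (L : Set (List Bool)) : Prop :=
  ∃ (M : TM) (c : ℕ), M.DecidesInTime L (fun n => 2 ^ 2 ^ (n ^ c + c))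

def In3EXPTIME (L : Set (List Bool)) : Prop :=
  ∃ (M : TM) (c : ℕ), M.DecidesInTime L (fun n => 2 ^ 2 ^ 2 ^ (n ^ c + c))

def InPSPACE (L : Set (List Bool)) : Prop :=
  ∃ (M : TM) (c : ℕ), M.DecidesInSpace L (fun n => n ^ c + c)

def InEXPSPACE (L : Set (List Bool)) : Prop :=
  ∃ (M : TM) (c : ℕ), M.DecidesInSpace L (fun n => 2 ^ (n ^ c + c))

def InNEXPSPACE (L : Set (List Bool)) : Prop :=
  ∃ (M : NTM) (c : ℕ), M.DecidesInSpace L (fun n => 2 ^ (n ^ c + c))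

/-- A language is undecidable if no machine decides it. -/
def Undecidable (L : Set (List Bool)) : Prop := ¬ ∃ M : TM, M.Decides L

def PolytimeComputable (f : List Bool → List Bool) : Prop :=
  ∃ (M : TM) (c : ℕ), M.ComputesInTime f (fun n => n ^ c + c)

def PolytimeReducible (L L' : Set (List Bool)) : Prop :=
  ∃ f, PolytimeComputable f ∧ ∀ x, x ∈ L ↔ f x ∈ L'

def PSPACEHard (L' : Set (List Bool)) : Prop :=
  ∀ L, InPSPACE L → PolytimeReducible L L'

/-- The language of (the encodings of) the yes-instances of a decision
problem `P` on instances of type `I`, for an encoding `enc`. -/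
def langOf {I : Type} (enc : I → List Bool) (P : I → Prop) : Set (List Bool) :=
  {w | ∃ x, enc x = w ∧ P x}

/-! #### Encoding of game instances -/

/-- A concrete encoding of an arena over `Fin n` as a natural number. -/
def encodeArena {k n : ℕ} (A : Arena k (Fin n)) : ℕ :=
  Encodable.encode
    ( k, n,
      List.ofFn (fun v : Fin n => (A.owner v).map Fin.val),
      List.ofFn (fun v : Fin n => List.ofFn (fun w : Fin n => A.edge v w)),
      List.ofFn (fun v : Fin n => List.ofFn (fun w : Fin n => A.prob v w)),
      (A.init : ℕ) )

/-- An instance of NCRSP with Muller objectives: an SMG over vertices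
`Fin n` with players `Fin (k+1)`, Muller objectives given by Boolean
formulas, and a threshold `μ ∈ [0,1]`. -/
structure MullerInstance where
  k : ℕ
  n : ℕ
  A : Arena k (Fin n)
  obj : Fin (k + 1) → BForm (Fin n)
  μ : ℚ
  wf : A.WF
  hμ0 : 0 ≤ μ
  hμ1 : μ ≤ 1

def encodeMullerInstance (I : MullerInstance) : List Bool :=
  Nat.bits (Encodable.encode
    ( encodeArena I.A,
      List.ofFn (fun i => (BForm.map Fin.val (I.obj i)).toNat),
      Encodable.encode I.μ ))

/-- An instance of NCRSP with terminal-reachability objectives. -/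
structure TRInstance where
  k : ℕ
  n : ℕ
  A : Arena k (Fin n)
  F : Fin (k + 1) → Fin n → Bool
  μ : ℚ
  wf : A.WF
  hterm : ∀ i v, F i v = true → A.terminal v
  hμ0 : 0 ≤ μ
  hμ1 : μ ≤ 1

def encodeTRInstance (I : TRInstance) : List Bool :=
  Nat.bits (Encodable.encode
    ( encodeArena I.A,
      List.ofFn (fun i => List.ofFn (fun v => I.F i v)),
      Encodable.encode I.μ ))

/-- An instance of `t`-memory NCRSP with Muller objectives. -/
structure MullerTInstance where
  k : ℕ
  n : ℕ
  A : Arena k (Fin n)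
  obj : Fin (k + 1) → BForm (Fin n)
  t : ℕ
  μ : ℚ
  wf : A.WF
  hμ0 : 0 ≤ μ
  hμ1 : μ ≤ 1

def encodeMullerTInstance (I : MullerTInstance) : List Bool :=
  Nat.bits (Encodable.encode
    ( encodeArena I.A,
      List.ofFn (fun i => (BForm.map Fin.val (I.obj i)).toNat),
      I.t,
      Encodable.encode I.μ ))

/-- An instance of `t`-memory NCRSP on a non-stochastic game (NSMG,
no nature vertices) with terminal-reachability objectives. -/
structure TRTInstance where
  k : ℕ
  n : ℕ
  A : Arena k (Fin n)
  F : Fin (k + 1) → Fin n → Bool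
  t : ℕ
  μ : ℚ
  wf : A.WF
  nonature : ∀ v, A.owner v ≠ none
  hterm : ∀ i v, F i v = true → A.terminal v
  hμ0 : 0 ≤ μ
  hμ1 : μ ≤ 1

def encodeTRTInstance (I : TRTInstance) : List Bool :=
  Nat.bits (Encodable.encode
    ( encodeArena I.A,
      List.ofFn (fun i => List.ofFn (fun v => I.F i v)),
      I.t,
      Encodable.encode I.μ ))

end NCRSPPaper

namespace NCRSPPaper

/-! ### First-order logic over the ordered field of real numbers -/

/-- Terms over the signature `(+, ×, 0, 1)`, with de Bruijn variables. -/
inductive RTerm : Type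
  | var : ℕ → RTerm
  | zero : RTerm
  | one : RTerm
  | add : RTerm → RTerm → RTerm
  | mul : RTerm → RTerm → RTerm

namespace RTerm

noncomputable def eval (ρ : ℕ → ℝ) : RTerm → ℝ
  | var i => ρ i
  | zero => 0
  | one => 1
  | add s t => eval ρ s + eval ρ t
  | mul s t => eval ρ s * eval ρ t

def toNat : RTerm → ℕ
  | var i => Nat.pair 0 i
  | zero => Nat.pair 1 0
  | one => Nat.pair 2 0
  | add s t => Nat.pair 3 (Nat.pair (toNat s) (toNat t))
  | mul s t => Nat.pair 4 (Nat.pair (toNat s) (toNat t))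

end RTerm

/-- First-order formulas over the signature `(+, ×, 0, 1, ≤)`, with de
Bruijn variables. -/
inductive RForm : Type
  | le : RTerm → RTerm → RForm
  | not : RForm → RForm
  | and : RForm → RForm → RForm
  | or : RForm → RForm → RForm
  | ex : RForm → RForm
  | all : RForm → RForm

namespace RForm

/-- Satisfaction in the structure `(ℝ, +, ×, 0, 1, ≤)`. -/
def holds : (ℕ → ℝ) → RForm → Prop
  | ρ, le s t => RTerm.eval ρ s ≤ RTerm.eval ρ t
  | ρ, not f => ¬ holds ρ f
  | ρ, and f g => holds ρ f ∧ holds ρ g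
  | ρ, or f g => holds ρ f ∨ holds ρ g
  | ρ, ex f => ∃ x : ℝ, holds (fun i => match i with | 0 => x | j + 1 => ρ j) f
  | ρ, all f => ∀ x : ℝ, holds (fun i => match i with | 0 => x | j + 1 => ρ j) f

/-- Validity (truth in `(ℝ, +, ×, 0, 1, ≤)` under every assignment;
for sentences this is just truth). -/
def valid (f : RForm) : Prop := ∀ ρ, holds ρ f

/-- Quantifier-free formulas. -/
def QFree : RForm → Prop
  | le _ _ => True
  | not f => QFree f
  | and f g => QFree f ∧ QFree g
  | or f g => QFree f ∧ QFree g
  | ex _ => False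
  | all _ => False

/-- Existential formulas: a block of existential quantifiers applied to a
quantifier-free formula (prenex form with only existential quantifiers). -/
inductive IsExistential : RForm → Prop
  | qf {f : RForm} : QFree f → IsExistential f
  | ex {f : RForm} : IsExistential f → IsExistential (RForm.ex f)

def toNat : RForm → ℕ
  | le s t => Nat.pair 0 (Nat.pair s.toNat t.toNat)
  | not f => Nat.pair 1 (toNat f)
  | and f g => Nat.pair 2 (Nat.pair (toNat f) (toNat g))
  | or f g => Nat.pair 3 (Nat.pair (toNat f) (toNat g))
  | ex f => Nat.pair 4 (toNat f)
  | all f => Nat.pair 5 (toNat f)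

end RForm

def encodeRForm (f : RForm) : List Bool := Nat.bits f.toNat

/-! ### Quantified Boolean formulas -/

/-- Truth of a prenex QBF: `qs` is the (outermost-first) list of
quantifiers (`true` = `∀`, `false` = `∃`); the quantifier at the head of a
suffix of length `j+1` binds variable `j`. -/
def qbfHolds (φ : BForm ℕ) : List Bool → (ℕ → Bool) → Prop
  | [], ρ => BForm.holds (fun i => ρ i = true) φ
  | q :: qs, ρ =>
      if q then ∀ b : Bool, qbfHolds φ qs (Function.update ρ qs.length b)
      else ∃ b : Bool, qbfHolds φ qs (Function.update ρ qs.length b)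

/-- Variables of a Boolean formula are `< m`. -/
def BForm.varsLT (m : ℕ) : BForm ℕ → Prop
  | BForm.tru => True
  | BForm.fls => True
  | BForm.var i => i < m
  | BForm.not f => f.varsLT m
  | BForm.and f g => f.varsLT m ∧ g.varsLT m
  | BForm.or f g => f.varsLT m ∧ g.varsLT m

/-- A prenex quantified Boolean formula with `quants.length` variables. -/
structure QBFInst where
  quants : List Bool
  matrix : BForm ℕ
  wf : matrix.varsLT quants.length

def QBFInst.IsTrue (Q : QBFInst) : Prop :=
  qbfHolds Q.matrix Q.quants (fun _ => false)

def encodeQBFInst (Q : QBFInst) : List Bool :=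
  Nat.bits (Encodable.encode (Q.quants, Q.matrix.toNat))

end NCRSPPaper

namespace NCRSPPaper

/-- The yes-instances of Stationary-Muller-NCRSP. -/
def MullerInstance.AnswerStationary (I : MullerInstance) : Prop :=
  NCRSPAnswer I.A (fun i => mullerObj (I.obj i))
    Strategy.Stationary Strategy.Stationary I.μ

/-! ### The probability of sets of plays -/

section Probability

set_option linter.unusedSectionVars false

variable {k : ℕ} {V : Type} [Fintype V] [DecidableEq V]

/-- The first `t` vertices of a play. -/
def pre (π : Play V) (t : ℕ) : List V := (List.range t).map π

lemma pre_succ (π : Play V) (t : ℕ) : pre π (t + 1) = pre π t ++ [π t] := by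
  simp [pre, List.range_succ]

lemma pre_succ' (π : Play V) (t : ℕ) :
    pre π (t + 1) = π 0 :: pre (fun i => π (i + 1)) t := by
  simp [pre, List.range_succ_eq_map]

lemma pre_length (π : Play V) (t : ℕ) : (pre π t).length = t := by simp [pre]

lemma pre_congr {π π' : Play V} {t : ℕ} (h : ∀ i < t, π i = π' i) : pre π t = pre π' t := by
  simp only [pre]
  apply List.map_congr_left
  intro a ha
  exact h a (List.mem_range.1 ha)

lemma pre_update (π : Play V) (t : ℕ) (v : V) {j : ℕ} (hj : j ≤ t) :
    pre (Function.update π t v) j = pre π j :=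
  pre_congr fun i hi => by rw [Function.update_of_ne (by omega)]

lemma mem_cyl_pre {π π' : Play V} {t : ℕ} : π ∈ cyl (pre π' t) ↔ ∀ i < t, π i = π' i := by
  simp [cyl, pre]

variable (A : Arena k V) (σ : Profile k V) (s : V)

lemma extProb_pre_succ (t : ℕ) : ∀ (h : List V) (π : Play V),
    extProb A σ h (π 0) (pre (fun i => π (i + 1)) (t + 1)) =
      extProb A σ h (π 0) (pre (fun i => π (i + 1)) t) *
        A.stepProb σ (h ++ pre π t) (π t) (π (t + 1)) := by
  induction t with
  | zero => intro h π; simp [pre, extProb]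
  | succ t ih =>
    intro h π
    rw [pre_succ' (fun i => π (i + 1)) (t + 1), pre_succ' (fun i => π (i + 1)) t]
    simp only [extProb]
    rw [ih (h ++ [π 0]) (fun i => π (i + 1)), pre_succ' π t]
    simp [mul_assoc]

/-- The probability of the first `t + 1` vertices of a play. -/
noncomputable def prefixProb (π : Play V) (t : ℕ) : ℝ≥0∞ := wordProbFrom A σ s (pre π (t + 1))

lemma prefixProb_zero (π : Play V) : prefixProb A σ s π 0 = if π 0 = s then 1 else 0 := by
  simp [prefixProb, pre, wordProbFrom, extProb]

lemma prefixProb_succ (π : Play V) (t : ℕ) :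
    prefixProb A σ s π (t + 1) =
      prefixProb A σ s π t * A.stepProb σ (pre π t) (π t) (π (t + 1)) := by
  simp only [prefixProb]
  rw [pre_succ' π (t + 1), pre_succ' π t]
  simp only [wordProbFrom]
  rw [extProb_pre_succ, List.nil_append, mul_assoc]

lemma PrFrom_mono {S T : Set (Play V)} (h : S ⊆ T) : PrFrom A σ s S ≤ PrFrom A σ s T := by
  unfold PrFrom
  exact MeasureTheory.measure_mono h

lemma PrFrom_union (S T : Set (Play V)) :
    PrFrom A σ s (S ∪ T) ≤ PrFrom A σ s S + PrFrom A σ s T := by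
  unfold PrFrom
  exact MeasureTheory.measure_union_le S T

lemma PrFrom_iUnion_le {ι : Type} [Countable ι] (S : ι → Set (Play V)) :
    PrFrom A σ s (⋃ i, S i) ≤ ∑' i, PrFrom A σ s (S i) := by
  unfold PrFrom
  exact MeasureTheory.measure_iUnion_le S

lemma PrFrom_iUnion_null {ι : Type} [Countable ι] {S : ι → Set (Play V)}
    (h : ∀ i, PrFrom A σ s (S i) = 0) : PrFrom A σ s (⋃ i, S i) = 0 := by
  have := PrFrom_iUnion_le A σ s S
  simpa [h] using this

lemma PrFrom_le_word {S : Set (Play V)} {w : List V} (h : S ⊆ cyl w) :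
    PrFrom A σ s S ≤ wordProbFrom A σ s w := by
  unfold PrFrom
  refine (MeasureTheory.OuterMeasure.ofFunction_le S).trans ?_
  split_ifs
  · exact zero_le
  · exact iInf₂_le w h

lemma PrFrom_empty : PrFrom A σ s ∅ = 0 := by
  unfold PrFrom
  exact MeasureTheory.measure_empty

/-- A process depending only on the vertices visited up to each time. -/
def Adapted (F : ℕ → Play V → ℝ≥0∞) : Prop :=
  ∀ t π π', (∀ i ≤ t, π i = π' i) → F t π = F t π'

/-- A process that does not increase in expectation. -/
def Supermart (F : ℕ → Play V → ℝ≥0∞) : Prop :=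
  ∀ t π, ∑ v, A.stepProb σ (pre π t) (π t) v * F (t + 1) (Function.update π (t + 1) v) ≤ F t π

variable {A σ s}

/-- The probability that the process first reaches `1` after exactly `j` more steps. -/
noncomputable def firstPass (A : Arena k V) (σ : Profile k V) (F : ℕ → Play V → ℝ≥0∞) :
    ℕ → ℕ → Play V → ℝ≥0∞
  | 0, t, π => if 1 ≤ F t π then 1 else 0
  | j + 1, t, π => if 1 ≤ F t π then 0 else
      ∑ v, A.stepProb σ (pre π t) (π t) v *
        firstPass A σ F j (t + 1) (Function.update π (t + 1) v)

lemma sum_firstPass_le {F : ℕ → Play V → ℝ≥0∞} (hF : Supermart A σ F) (J : ℕ) :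
    ∀ t π, ∑ j ∈ Finset.range J, firstPass A σ F j t π ≤ F t π := by
  induction J with
  | zero => simp
  | succ J ih =>
    intro t π
    rw [Finset.sum_range_succ']
    by_cases h : 1 ≤ F t π
    · simp [firstPass, h]
    · simp only [firstPass, h, if_false, add_zero]
      rw [Finset.sum_comm]
      refine le_trans (Finset.sum_le_sum fun v _ => ?_) (hF t π)
      rw [← Finset.mul_sum]
      gcongr
      exact ih _ _

lemma PrFrom_firstPass_le {F : ℕ → Play V → ℝ≥0∞} (had : Adapted F) (j : ℕ) : ∀ t π0,
    PrFrom A σ s {π | (∀ i ≤ t, π i = π0 i) ∧ 1 ≤ F (t + j) π ∧ ∀ i < j, ¬ 1 ≤ F (t + i) π} ≤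
      prefixProb A σ s π0 t * firstPass A σ F j t π0 := by
  induction j with
  | zero =>
    intro t π0
    by_cases h : 1 ≤ F t π0
    · simp only [firstPass, h, if_true, mul_one]
      apply PrFrom_le_word
      intro π hπ
      rw [mem_cyl_pre]
      intro i hi
      exact hπ.1 i (by omega)
    · have : {π | (∀ i ≤ t, π i = π0 i) ∧ 1 ≤ F (t + 0) π ∧ ∀ i < 0, ¬ 1 ≤ F (t + i) π} = ∅ := by
        ext π
        simp only [Set.mem_ofPred_eq, Set.mem_empty_iff_false, iff_false]
        rintro ⟨h1, h2, -⟩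
        rw [add_zero, had t π π0 h1] at h2
        exact h h2
      rw [this, PrFrom_empty]
      exact zero_le
  | succ j ih =>
    intro t π0
    by_cases h : 1 ≤ F t π0
    · have : {π | (∀ i ≤ t, π i = π0 i) ∧ 1 ≤ F (t + (j + 1)) π ∧
          ∀ i < j + 1, ¬ 1 ≤ F (t + i) π} = ∅ := by
        ext π
        simp only [Set.mem_ofPred_eq, Set.mem_empty_iff_false, iff_false]
        rintro ⟨h1, -, h3⟩
        apply h3 0 (by omega)
        rw [add_zero, had t π π0 h1]
        exact h
      rw [this, PrFrom_empty]
      exact zero_le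
    · simp only [firstPass, h, if_false]
      refine le_trans (PrFrom_mono A σ s (T := ⋃ v, {π | (∀ i ≤ t + 1,
        π i = Function.update π0 (t + 1) v i) ∧ 1 ≤ F (t + 1 + j) π ∧
        ∀ i < j, ¬ 1 ≤ F (t + 1 + i) π}) ?_) ?_
      · rintro π ⟨h1, h2, h3⟩
        simp only [Set.mem_iUnion]
        refine ⟨π (t + 1), ?_, ?_, ?_⟩
        · intro i hi
          rcases Nat.lt_or_ge i (t + 1) with hi' | hi'
          · rw [Function.update_of_ne (by omega)]
            exact h1 i (by omega)
          · obtain rfl : i = t + 1 := by omega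
            simp
        · rwa [show t + 1 + j = t + (j + 1) by omega]
        · intro i hi
          rw [show t + 1 + i = t + (i + 1) by omega]
          exact h3 _ (by omega)
      · refine (PrFrom_iUnion_le A σ s _).trans ?_
        rw [tsum_fintype, Finset.mul_sum]
        apply Finset.sum_le_sum
        intro v _
        refine (ih (t + 1) _).trans (le_of_eq ?_)
        rw [prefixProb_succ]
        have h0 : prefixProb A σ s (Function.update π0 (t + 1) v) t = prefixProb A σ s π0 t := by
          unfold prefixProb
          rw [pre_update _ _ _ le_rfl]
        rw [h0, pre_update _ _ _ (by omega), Function.update_self,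
          Function.update_of_ne (by omega), mul_assoc]

lemma PrFrom_start_ne : PrFrom A σ s {π | π 0 ≠ s} = 0 := by
  have : {π : Play V | π 0 ≠ s} ⊆ ⋃ v : {v : V // v ≠ s}, cyl [v.1] := by
    intro π hπ
    simp only [Set.mem_iUnion]
    exact ⟨⟨π 0, hπ⟩, by simp [cyl]⟩
  refine le_antisymm ((PrFrom_mono A σ s this).trans ?_) zero_le
  rw [PrFrom_iUnion_null]
  rintro ⟨v, hv⟩
  refine le_antisymm ((PrFrom_le_word A σ s subset_rfl).trans ?_) zero_le
  simp [wordProbFrom, hv]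

/-- Ville's maximal inequality. -/
lemma PrFrom_ville {F : ℕ → Play V → ℝ≥0∞} (had : Adapted F) (hF : Supermart A σ F) :
    PrFrom A σ s {π | ∃ t, 1 ≤ F t π} ≤ F 0 (fun _ => s) := by
  have hsub : {π | ∃ t, 1 ≤ F t π} ⊆ {π : Play V | π 0 ≠ s} ∪ ⋃ j, {π | (∀ i ≤ 0, π i = s) ∧
      1 ≤ F (0 + j) π ∧ ∀ i < j, ¬ 1 ≤ F (0 + i) π} := by
    classical
    intro π hπ
    by_cases h0 : π 0 = s
    · right
      simp only [Set.mem_iUnion]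
      refine ⟨Nat.find hπ, ?_, ?_, ?_⟩
      · intro i hi
        obtain rfl : i = 0 := by omega
        exact h0
      · simpa using Nat.find_spec hπ
      · intro i hi
        simpa using Nat.find_min hπ hi
    · left; exact h0
  refine (PrFrom_mono A σ s hsub).trans ((PrFrom_union A σ s _ _).trans ?_)
  rw [PrFrom_start_ne, zero_add]
  refine (PrFrom_iUnion_le A σ s _).trans ?_
  apply ENNReal.tsum_le_of_sum_range_le
  intro J
  refine le_trans (Finset.sum_le_sum fun j _ => ?_) (sum_firstPass_le hF J 0 fun _ => s)
  refine (PrFrom_firstPass_le had j 0 fun _ => s).trans ?_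
  rw [prefixProb_zero]
  simp

lemma exists_play_lt_one (hst : ∀ h u, ∑ v, A.stepProb σ h u v = 1)
    {F : ℕ → Play V → ℝ≥0∞} (had : Adapted F) (hF : Supermart A σ F)
    (h0 : F 0 (fun _ => s) < 1) : ∃ π : Play V, π 0 = s ∧ ∀ t, F t π < 1 := by
  have : Nonempty V := ⟨s⟩
  have hstep : ∀ t π, F t π < 1 → ∃ v, F (t + 1) (Function.update π (t + 1) v) < 1 := by
    intro t π hlt
    by_contra! hcon
    have := (hF t π).trans_lt hlt
    refine absurd this (not_lt.2 ?_)
    rw [← hst (pre π t) (π t)]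
    refine Finset.sum_le_sum fun v _ => ?_
    conv_lhs => rw [← mul_one (A.stepProb σ (pre π t) (π t) v)]
    gcongr
    exact hcon v
  let X := fun t => {π : Play V // π 0 = s ∧ F t π < 1}
  choose! nv hnv using hstep
  let seq : ∀ t, X t := fun t => Nat.rec (motive := X) ⟨fun _ => s, rfl, h0⟩
    (fun t x => ⟨Function.update x.1 (t + 1) (nv t x.1),
      by rw [Function.update_of_ne (by omega)]; exact x.2.1, hnv t x.1 x.2.2⟩) t
  have hagree : ∀ t d i, i ≤ t → (seq (t + d)).1 i = (seq t).1 i := by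
    intro t d
    induction d with
    | zero => intro i _; rfl
    | succ d ih =>
      intro i hi
      rw [← ih i hi]
      change Function.update (seq (t + d)).1 (t + d + 1) _ i = _
      rw [Function.update_of_ne (by omega)]
  refine ⟨fun t => (seq t).1 t, (seq 0).2.1, fun t => ?_⟩
  rw [had t _ (seq t).1]
  · exact (seq t).2.2
  · intro i hi
    have := hagree i (t - i) i le_rfl
    rw [Nat.add_sub_cancel' hi] at this
    exact this.symm

open scoped Classical in
/-- The conditional probability of a word given the first `t + 1` vertices of a play. -/
noncomputable def wordMart (A : Arena k V) (σ : Profile k V) (w : List V) (t : ℕ) (π : Play V) :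
    ℝ≥0∞ :=
  if ∀ i (h : i < w.length), i ≤ t → π i = w[i] then
    extProb A σ (pre π t) (π t) (w.drop (t + 1)) else 0

lemma wordMart_adapted (w : List V) : Adapted (wordMart A σ w) := by
  intro t π π' h
  unfold wordMart
  rw [pre_congr (fun i hi => h i hi.le), h t le_rfl]
  congr 1
  apply propext
  refine forall_congr' fun i => forall_congr' fun hi => forall_congr' fun hit => ?_
  rw [h i hit]

lemma wordMart_supermart (hst : ∀ h u, ∑ v, A.stepProb σ h u v = 1) (w : List V) :
    Supermart A σ (wordMart A σ w) := by
  classical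
  intro t π
  by_cases hc : ∀ i (h : i < w.length), i ≤ t → π i = w[i]
  · have hR : wordMart A σ w t π = extProb A σ (pre π t) (π t) (w.drop (t + 1)) := if_pos hc
    rcases Nat.lt_or_ge (t + 1) w.length with hw | hw
    · rw [hR, List.drop_eq_getElem_cons hw]
      simp only [extProb]
      rw [Finset.sum_eq_single w[t + 1]]
      · gcongr
        unfold wordMart
        split_ifs
        · rw [pre_update _ _ _ le_rfl, pre_succ, Function.update_self]
        · exact zero_le
      · intro v _ hv
        have : wordMart A σ w (t + 1) (Function.update π (t + 1) v) = 0 := by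
          apply if_neg
          intro hh
          apply hv
          simpa using hh (t + 1) hw le_rfl
        rw [this, mul_zero]
      · simp
    · rw [hR, List.drop_eq_nil_of_le hw]
      simp only [extProb]
      rw [← hst (pre π t) (π t)]
      refine Finset.sum_le_sum fun v _ => ?_
      conv_rhs => rw [← mul_one (A.stepProb σ (pre π t) (π t) v)]
      gcongr
      unfold wordMart
      split_ifs
      · rw [List.drop_eq_nil_of_le (by omega)]
        simp [extProb]
      · exact zero_le
  · have : ∀ v, wordMart A σ w (t + 1) (Function.update π (t + 1) v) = 0 := by
      intro v
      apply if_neg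
      intro hh
      apply hc
      intro i hi hit
      have := hh i hi (by omega)
      rwa [Function.update_of_ne (by omega)] at this
    simp [this]

lemma wordMart_zero (w : List V) :
    wordMart A σ w 0 (fun _ => s) ≤ wordProbFrom A σ s w := by
  unfold wordMart
  split_ifs with h
  · cases w with
    | nil => simp [wordProbFrom, extProb]
    | cons v r =>
      have : s = v := h 0 (by simp) le_rfl
      subst this
      simp [wordProbFrom, pre]
  · exact zero_le

lemma wordMart_of_mem {w : List V} {π : Play V} (h : π ∈ cyl w) :
    wordMart A σ w w.length π = 1 := by
  unfold wordMart
  rw [if_pos, List.drop_eq_nil_of_le (by omega)]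
  · simp [extProb]
  · intro i hi _
    exact h i hi

/-- The whole space of plays has full probability. -/
lemma one_le_PrFrom_univ (hst : ∀ h u, ∑ v, A.stepProb σ h u v = 1) :
    1 ≤ PrFrom A σ s Set.univ := by
  classical
  unfold PrFrom
  rw [MeasureTheory.OuterMeasure.ofFunction_apply]
  refine le_iInf₂ fun S hS => ?_
  by_contra! hlt
  obtain ⟨ε, hε0, hε⟩ : ∃ ε : ℝ≥0∞, 0 < ε ∧
      (∑' n, (if S n = ∅ then 0 else ⨅ (w : List V) (_ : S n ⊆ cyl w),
        wordProbFrom A σ s w)) + ε < 1 := by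
    obtain ⟨c, hc1, hc2⟩ := exists_between hlt
    refine ⟨c - ∑' n, (if S n = ∅ then 0 else ⨅ (w : List V) (_ : S n ⊆ cyl w),
        wordProbFrom A σ s w), tsub_pos_of_lt hc1, ?_⟩
    rwa [add_tsub_cancel_of_le hc1.le]
  obtain ⟨ε', hε'0, hε'⟩ := ENNReal.exists_pos_sum_of_countable' hε0.ne' ℕ
  have hg : ∀ n, ∃ g : ℕ → Play V → ℝ≥0∞, Adapted g ∧ Supermart A σ g ∧
      g 0 (fun _ => s) ≤ (if S n = ∅ then 0 else ⨅ (w : List V) (_ : S n ⊆ cyl w),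
        wordProbFrom A σ s w) + ε' n ∧ ∀ π ∈ S n, ∃ t, 1 ≤ g t π := by
    intro n
    by_cases hn : S n = ∅
    · exact ⟨fun _ _ => 0, fun _ _ _ _ => rfl, fun _ _ => by simp, zero_le,
        by simp [hn]⟩
    · rw [if_neg hn]
      have hlt' : (⨅ (w : List V) (_ : S n ⊆ cyl w), wordProbFrom A σ s w) <
          (⨅ (w : List V) (_ : S n ⊆ cyl w), wordProbFrom A σ s w) + ε' n := by
        apply ENNReal.lt_add_right _ (hε'0 n).ne'
        intro htop
        have := ENNReal.le_tsum (f := fun n => (if S n = ∅ then 0 else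
          ⨅ (w : List V) (_ : S n ⊆ cyl w), wordProbFrom A σ s w)) n
        simp only [if_neg hn, htop, top_le_iff] at this
        rw [this] at hlt
        exact absurd hlt (by simp)
      obtain ⟨w, hw⟩ := iInf_lt_iff.1 hlt'
      obtain ⟨hsub, hw⟩ := iInf_lt_iff.1 hw
      exact ⟨wordMart A σ w, wordMart_adapted w, wordMart_supermart hst w,
        (wordMart_zero w).trans hw.le, fun π hπ => ⟨w.length, (wordMart_of_mem (hsub hπ)).ge⟩⟩
  choose g hga hgs hg0 hg1 using hg
  obtain ⟨π, hπ0, hπ⟩ := exists_play_lt_one (s := s) hst (F := fun t π => ∑' n, g n t π)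
    (fun t π π' h => by simp only [hga _ t π π' h])
    (fun t π => by
      simp_rw [← ENNReal.tsum_mul_left]
      rw [← Summable.tsum_finsetSum (fun _ _ => ENNReal.summable)]
      exact ENNReal.tsum_le_tsum fun n => hgs n t π)
    (by
      refine lt_of_le_of_lt (ENNReal.tsum_le_tsum hg0) ?_
      rw [ENNReal.tsum_add]
      refine lt_of_le_of_lt ?_ hε
      gcongr)
  obtain ⟨n, hn⟩ := Set.mem_iUnion.1 (hS (Set.mem_univ π))
  obtain ⟨t, ht⟩ := hg1 n π hn
  exact absurd (hπ t) (not_lt.2 (ht.trans (ENNReal.le_tsum n)))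

lemma one_le_PrFrom_add_compl (hst : ∀ h u, ∑ v, A.stepProb σ h u v = 1) (O : Set (Play V)) :
    1 ≤ PrFrom A σ s O + PrFrom A σ s Oᶜ := by
  refine (one_le_PrFrom_univ (s := s) hst).trans ?_
  rw [← Set.union_compl_self O]
  exact PrFrom_union A σ s _ _

/-- Almost surely, every transition taken has positive probability. -/
lemma PrFrom_prefixProb_eq_zero : PrFrom A σ s {π | ∃ t, prefixProb A σ s π t = 0} = 0 := by
  have : {π | ∃ t, prefixProb A σ s π t = 0} ⊆
      ⋃ w : {w : List V // wordProbFrom A σ s w = 0}, cyl w.1 := by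
    rintro π ⟨t, ht⟩
    exact Set.mem_iUnion.2 ⟨⟨_, ht⟩, mem_cyl_pre.2 fun _ _ => rfl⟩
  refine le_antisymm ((PrFrom_mono A σ s this).trans ?_) zero_le
  rw [PrFrom_iUnion_null]
  rintro ⟨w, hw⟩
  exact le_antisymm ((PrFrom_le_word A σ s subset_rfl).trans hw.le) zero_le

open Filter in
/-- Almost surely, a transition with frequently large probability is taken infinitely often. -/
lemma PrFrom_frequently_null (hst : ∀ h u, ∑ v, A.stepProb σ h u v = 1) (v w : V) (p : ℝ≥0∞)
    (hp0 : 0 < p) (hp1 : p < 1) :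
    PrFrom A σ s {π | (∃ᶠ t in atTop, π t = v ∧ p ≤ A.stepProb σ (pre π t) v w) ∧
      ¬ ∃ᶠ t in atTop, π t = v ∧ π (t + 1) = w} = 0 := by
  classical
  have hsub : {π : Play V | (∃ᶠ t in atTop, π t = v ∧ p ≤ A.stepProb σ (pre π t) v w) ∧
      ¬ ∃ᶠ t in atTop, π t = v ∧ π (t + 1) = w} ⊆ ⋃ T : ℕ,
      {π | (∃ᶠ t in atTop, π t = v ∧ p ≤ A.stepProb σ (pre π t) v w) ∧
        ∀ t ≥ T, ¬ (π t = v ∧ π (t + 1) = w)} := by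
    rintro π ⟨h1, h2⟩
    rw [not_frequently, eventually_atTop] at h2
    obtain ⟨T, hT⟩ := h2
    exact Set.mem_iUnion.2 ⟨T, h1, hT⟩
  refine le_antisymm ((PrFrom_mono A σ s hsub).trans ?_) zero_le
  rw [PrFrom_iUnion_null]
  intro T
  set q : ℝ≥0∞ := (1 - p)⁻¹ with hq
  have hp1' : 1 - p ≠ 0 := (tsub_pos_of_lt hp1).ne'
  have hq1 : 1 < q := by
    rw [hq, ENNReal.one_lt_inv]
    exact ENNReal.sub_lt_self ENNReal.one_ne_top one_ne_zero hp0.ne'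
  let g : ℕ → Play V → ℝ≥0∞ := fun i π =>
    if T ≤ i ∧ π i = v ∧ p ≤ A.stepProb σ (pre π i) v w then
      (if π (i + 1) = w then 0 else q) else 1
  have hgad : ∀ i (π π' : Play V), (∀ j ≤ i + 1, π j = π' j) → g i π = g i π' := by
    intro i π π' h
    simp only [g]
    rw [pre_congr (fun j hj => h j (by omega)), h i (by omega), h (i + 1) le_rfl]
  have hle : ∀ ε : ℝ≥0∞, 0 < ε → PrFrom A σ s
      {π | (∃ᶠ t in atTop, π t = v ∧ p ≤ A.stepProb σ (pre π t) v w) ∧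
        ∀ t ≥ T, ¬ (π t = v ∧ π (t + 1) = w)} ≤ ε := by
    intro ε hε
    have had : Adapted (fun t π => ε * ∏ i ∈ Finset.range t, g i π) := by
      intro t π π' h
      simp only
      congr 1
      refine Finset.prod_congr rfl fun i hi => hgad i π π' fun j hj => h j ?_
      have := Finset.mem_range.1 hi
      omega
    have hsm : Supermart A σ (fun t π => ε * ∏ i ∈ Finset.range t, g i π) := by
      intro t π
      have h1 : ∀ x, ∏ i ∈ Finset.range t, g i (Function.update π (t + 1) x) =
          ∏ i ∈ Finset.range t, g i π := fun x => Finset.prod_congr rfl fun i hi =>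
        hgad i _ _ fun j hj => by
          have := Finset.mem_range.1 hi
          rw [Function.update_of_ne (by omega)]
      simp only [Finset.prod_range_succ, h1]
      have h2 : ∑ x, A.stepProb σ (pre π t) (π t) x * g t (Function.update π (t + 1) x) ≤ 1 := by
        by_cases hc : T ≤ t ∧ π t = v ∧ p ≤ A.stepProb σ (pre π t) v w
        · have h3 : ∀ x, g t (Function.update π (t + 1) x) = if x = w then 0 else q := by
            intro x
            simp only [g]
            rw [pre_update _ _ _ (by omega), Function.update_of_ne (by omega), if_pos hc,
              Function.update_self]
          simp only [h3]
          rw [← Finset.add_sum_erase _ _ (Finset.mem_univ w)]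
          simp only [if_true, mul_zero, zero_add]
          have h4 : ∀ x ∈ Finset.univ.erase w, A.stepProb σ (pre π t) (π t) x *
              (if x = w then 0 else q) = A.stepProb σ (pre π t) (π t) x * q := by
            intro x hx
            rw [if_neg (Finset.ne_of_mem_erase hx)]
          rw [Finset.sum_congr rfl h4, ← Finset.sum_mul]
          have h5 : ∑ x ∈ Finset.univ.erase w, A.stepProb σ (pre π t) (π t) x ≤ 1 - p := by
            apply ENNReal.le_sub_of_add_le_right (hp1.trans ENNReal.one_lt_top).ne
            rw [← hst (pre π t) (π t), ← Finset.add_sum_erase _ _ (Finset.mem_univ w), add_comm]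
            gcongr
            rw [hc.2.1]
            exact hc.2.2
          calc _ ≤ (1 - p) * (1 - p)⁻¹ := by gcongr
            _ = 1 := ENNReal.mul_inv_cancel hp1' (by simp)
        · have h3 : ∀ x, g t (Function.update π (t + 1) x) = 1 := by
            intro x
            simp only [g]
            rw [pre_update _ _ _ (by omega), Function.update_of_ne (by omega), if_neg hc]
          simp [h3, hst]
      calc _ = ε * (∏ i ∈ Finset.range t, g i π) *
            ∑ x, A.stepProb σ (pre π t) (π t) x * g t (Function.update π (t + 1) x) := by
            rw [Finset.mul_sum]
            exact Finset.sum_congr rfl fun x _ => by ring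
        _ ≤ ε * (∏ i ∈ Finset.range t, g i π) * 1 := by gcongr
        _ = _ := mul_one _
    have hv := PrFrom_ville (s := s) had hsm
    simp only [Finset.range_zero, Finset.prod_empty, mul_one] at hv
    refine le_trans (PrFrom_mono A σ s ?_) hv
    rintro π ⟨hinf, hno⟩
    have hg1 : ∀ i, 1 ≤ g i π := by
      intro i
      simp only [g]
      split_ifs with h1 h2
      · exact absurd ⟨h1.2.1, h2⟩ (hno i h1.1)
      · exact hq1.le
      · exact le_rfl
    have hmono : Monotone fun t => ∏ i ∈ Finset.range t, g i π := by
      apply monotone_nat_of_le_succ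
      intro t
      rw [Finset.prod_range_succ]
      exact le_mul_of_one_le_right' (hg1 t)
    have hgrow : ∀ K : ℕ, ∃ t, q ^ K ≤ ∏ i ∈ Finset.range t, g i π := by
      intro K
      induction K with
      | zero => exact ⟨0, by simp⟩
      | succ K ih =>
        obtain ⟨t, ht⟩ := ih
        obtain ⟨l, hl, hl1, hl2⟩ := frequently_atTop.1 hinf (max t T)
        refine ⟨l + 1, ?_⟩
        rw [Finset.prod_range_succ, pow_succ]
        have : g l π = q := by
          simp only [g]
          rw [if_pos ⟨(le_max_right _ _).trans hl, hl1, hl2⟩, if_neg]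
          exact fun h => hno l ((le_max_right _ _).trans hl) ⟨hl1, h⟩
        rw [this]
        gcongr
        exact ht.trans (hmono ((le_max_left _ _).trans hl))
    obtain ⟨K, hK⟩ : ∃ K : ℕ, ε⁻¹ ≤ q ^ K := by
      have htop : ε⁻¹ < ⊤ := by simpa using hε
      have := (ENNReal.tendsto_pow_atTop_nhds_top_iff.2 hq1).eventually (lt_mem_nhds htop)
      exact this.exists.imp fun _ h => h.le
    obtain ⟨t, ht⟩ := hgrow K
    refine ⟨t, ?_⟩
    rcases eq_or_ne ε ⊤ with rfl | hεt
    · have h6 : ∏ i ∈ Finset.range t, g i π ≠ 0 := by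
        refine (lt_of_lt_of_le ?_ (hmono (Nat.zero_le t))).ne'
        simp
      simp [ENNReal.top_mul h6]
    · calc (1 : ℝ≥0∞) = ε * ε⁻¹ := (ENNReal.mul_inv_cancel hε.ne' hεt).symm
        _ ≤ _ := by gcongr; exact hK.trans ht
  exact le_antisymm (le_of_forall_pos_le_add fun ε hε => by rw [zero_add]; exact hle ε hε) zero_le

end Probability

section MDP

set_option linter.unusedSectionVars false

variable {k : ℕ} {V : Type} [Fintype V] [DecidableEq V]

open Filter

lemma infSet_eq_frequently (π : Play V) : infSet π = {v | ∃ᶠ t in atTop, π t = v} := by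
  ext v
  simp [infSet, frequently_atTop]

lemma infSet_nonempty (π : Play V) : (infSet π).Nonempty := by
  rw [infSet_eq_frequently]
  by_contra h
  rw [Set.not_nonempty_iff_eq_empty, Set.eq_empty_iff_forall_notMem] at h
  have h' : ∀ v, ∀ᶠ t in atTop, π t ≠ v := fun v => not_frequently.1 (h v)
  obtain ⟨t, ht⟩ := (eventually_all.2 h').exists
  exact ht _ rfl

lemma eventually_mem_infSet (π : Play V) : ∀ᶠ t in atTop, π t ∈ infSet π := by
  have h' : ∀ v, ∀ᶠ t in atTop, v ∉ infSet π → π t ≠ v := by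
    intro v
    by_cases hv : v ∈ infSet π
    · simp [hv]
    · simp only [hv, not_false_eq_true, true_imp_iff]
      rw [infSet_eq_frequently] at hv
      exact not_frequently.1 hv
  filter_upwards [eventually_all.2 h'] with t ht
  by_contra hcon
  exact ht _ hcon rfl

/-- Almost all plays take only possible transitions, and take every transition that frequently
has large probability. -/
lemma exists_null_unfair {A : Arena k V} {σ : Profile k V} (s : V)
    (hst : ∀ h u, ∑ v, A.stepProb σ h u v = 1) :
    ∃ B, PrFrom A σ s B = 0 ∧ ∀ π ∉ B,
      (∀ t, A.stepProb σ (pre π t) (π t) (π (t + 1)) ≠ 0) ∧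
      ∀ v w (x : ℝ≥0∞), 0 < x → (∃ᶠ t in atTop, π t = v ∧ x ≤ A.stepProb σ (pre π t) v w) →
        ∃ᶠ t in atTop, π t = v ∧ π (t + 1) = w := by
  refine ⟨{π | ∃ t, prefixProb A σ s π t = 0} ∪ ⋃ i : V × V × ℕ,
    {π | (∃ᶠ t in atTop, π t = i.1 ∧
      ((i.2.2 + 2 : ℕ) : ℝ≥0∞)⁻¹ ≤ A.stepProb σ (pre π t) i.1 i.2.1) ∧
      ¬ ∃ᶠ t in atTop, π t = i.1 ∧ π (t + 1) = i.2.1}, ?_, ?_⟩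
  · refine le_antisymm ((PrFrom_union A σ s _ _).trans ?_) zero_le
    rw [PrFrom_prefixProb_eq_zero, PrFrom_iUnion_null, add_zero]
    rintro ⟨v, w, m⟩
    apply PrFrom_frequently_null hst
    · simp
    · rw [ENNReal.inv_lt_one]
      exact_mod_cast (by omega : 1 < m + 2)
  · intro π hπ
    simp only [Set.mem_union, Set.mem_ofPred_eq, Set.mem_iUnion, not_or, not_exists] at hπ
    refine ⟨fun t ht => hπ.1 (t + 1) (by rw [prefixProb_succ, ht, mul_zero]), ?_⟩
    intro v w x hx hf
    obtain ⟨m, hm⟩ := ENNReal.exists_inv_nat_lt hx.ne'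
    by_contra hcon
    refine hπ.2 (v, w, m) ⟨hf.mono ?_, hcon⟩
    rintro t ⟨h1, h2⟩
    refine ⟨h1, le_trans ?_ (hm.le.trans h2)⟩
    rw [ENNReal.inv_le_inv]
    exact_mod_cast (by omega : m ≤ m + 2)

/-- The possible steps of a Markov decision process with controlled vertices `C`, edges `ed`
at controlled vertices and transition probabilities `P` elsewhere. -/
def MStep (C : V → Prop) (ed : V → V → Prop) (P : V → V → ℝ) (a b : V) : Prop :=
  (C a ∧ ed a b) ∨ (¬ C a ∧ 0 < P a b)

/-- End components of a Markov decision process. -/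
def IsEC (C : V → Prop) (ed : V → V → Prop) (P : V → V → ℝ) (E : Set V) : Prop :=
  (∃ a, a ∈ E) ∧
  (∀ T : Set V, (∃ a, a ∈ T ∧ a ∈ E) →
    (∀ a b, a ∈ T → a ∈ E → b ∈ E → MStep C ed P a b → b ∈ T) → ∀ a, a ∈ E → a ∈ T) ∧
  (∀ v w, v ∈ E → ¬ C v → 0 < P v w → w ∈ E) ∧
  (∀ v, v ∈ E → C v → ∃ w, w ∈ E ∧ ed v w)

/-- A certificate that the objective `G` is met with probability at most `r`, whatever the
controller does. -/
def Cert (C : V → Prop) (ed : V → V → Prop) (P : V → V → ℝ) (G : Set V → Prop)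
    (r : V → ℝ) : Prop :=
  (∀ u, 0 ≤ r u) ∧ (∀ u, ¬ C u → ∑ v, P u v * r v ≤ r u) ∧
  (∀ u v, C u → ed u v → r v ≤ r u) ∧
  ∀ E : Set V, IsEC C ed P E → G E → ∀ u, u ∈ E → 1 ≤ r u

lemma isEC_infSet {C : V → Prop} {ed : V → V → Prop} {P : V → V → ℝ} {π : Play V}
    (hstep : ∀ t, MStep C ed P (π t) (π (t + 1)))
    (hfair : ∀ v w, ¬ C v → 0 < P v w → (∃ᶠ t in atTop, π t = v) →
      ∃ᶠ t in atTop, π t = v ∧ π (t + 1) = w) : IsEC C ed P (infSet π) := by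
  have hsucc : ∀ w, (∃ᶠ t in atTop, π (t + 1) = w) → w ∈ infSet π := by
    intro w hw m
    obtain ⟨l, hl, hlw⟩ := frequently_atTop.1 hw m
    exact ⟨l + 1, by omega, hlw⟩
  obtain ⟨t0, ht0⟩ := eventually_atTop.1 (eventually_mem_infSet π)
  refine ⟨infSet_nonempty π, ?_, ?_, ?_⟩
  · rintro T ⟨a, haT, haE⟩ hT b hb
    obtain ⟨t1, ht1, rfl⟩ := haE t0
    have hstay : ∀ d, π (t1 + d) ∈ T := by
      intro d
      induction d with
      | zero => exact haT
      | succ d ih => exact hT _ _ ih (ht0 _ (by omega)) (ht0 _ (by omega)) (hstep (t1 + d))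
    obtain ⟨l, hl, rfl⟩ := hb t1
    have := hstay (l - t1)
    rwa [Nat.add_sub_cancel' hl] at this
  · intro v w hv hC hP
    rw [infSet_eq_frequently] at hv
    exact hsucc w ((hfair v w hC hP hv).mono fun t h => h.2)
  · intro v hv hC
    obtain ⟨l, hl, rfl⟩ := hv t0
    rcases hstep l with h | h
    · exact ⟨_, ht0 _ (by omega), h.2⟩
    · exact absurd hC h.1

/-- A certificate bounds the probability of the objective. -/
lemma PrFrom_le_of_cert {A : Arena k V} {σ : Profile k V} {s : V}
    (hst : ∀ h u, ∑ v, A.stepProb σ h u v = 1)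
    {C : V → Prop} {ed : V → V → Prop} {P : V → V → ℝ} {G : Set V → Prop} {r : V → ℝ}
    (hP0 : ∀ u v, 0 ≤ P u v)
    (hP : ∀ h u v, ¬ C u → A.stepProb σ h u v = ENNReal.ofReal (P u v))
    (hC : ∀ h u v, C u → A.stepProb σ h u v ≠ 0 → ed u v)
    (hr : Cert C ed P G r) :
    PrFrom A σ s {π | G (infSet π)} ≤ ENNReal.ofReal (r s) := by
  obtain ⟨B, hB0, hB⟩ := exists_null_unfair s hst
  obtain ⟨hr0, hr1, hr2, hr3⟩ := hr
  have had : Adapted (fun t (π : Play V) => ENNReal.ofReal (r (π t))) := by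
    intro t π π' h
    simp only [h t le_rfl]
  have hsm : Supermart A σ (fun t (π : Play V) => ENNReal.ofReal (r (π t))) := by
    intro t π
    simp only [Function.update_self]
    by_cases hc : C (π t)
    · calc _ ≤ ∑ v, A.stepProb σ (pre π t) (π t) v * ENNReal.ofReal (r (π t)) := by
            refine Finset.sum_le_sum fun v _ => ?_
            by_cases h0 : A.stepProb σ (pre π t) (π t) v = 0
            · simp [h0]
            · gcongr
              exact hr2 _ _ hc (hC _ _ _ hc h0)
        _ = _ := by rw [← Finset.sum_mul, hst, one_mul]
    · calc _ = ∑ v, ENNReal.ofReal (P (π t) v * r v) := by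
            refine Finset.sum_congr rfl fun v _ => ?_
            rw [hP _ _ _ hc, ENNReal.ofReal_mul (hP0 _ _)]
        _ = ENNReal.ofReal (∑ v, P (π t) v * r v) := by
            rw [ENNReal.ofReal_sum_of_nonneg fun v _ => mul_nonneg (hP0 _ _) (hr0 _)]
        _ ≤ _ := ENNReal.ofReal_le_ofReal (hr1 _ hc)
  refine le_trans (PrFrom_mono A σ s (T := B ∪ {π | ∃ t, 1 ≤ ENNReal.ofReal (r (π t))}) ?_)
    ((PrFrom_union A σ s _ _).trans ?_)
  · intro π hπ
    by_cases hb : π ∈ B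
    · exact Or.inl hb
    · right
      obtain ⟨h1, h2⟩ := hB π hb
      have hE : IsEC C ed P (infSet π) := by
        apply isEC_infSet
        · intro t
          by_cases hc : C (π t)
          · exact Or.inl ⟨hc, hC _ _ _ hc (h1 t)⟩
          · refine Or.inr ⟨hc, ?_⟩
            have := h1 t
            rw [hP _ _ _ hc] at this
            simpa using this
        · intro v w hc hp hf
          refine h2 v w (ENNReal.ofReal (P v w)) (by simpa using hp) (hf.mono ?_)
          rintro t ht
          exact ⟨ht, (hP _ _ _ hc).ge⟩
      obtain ⟨v, hv⟩ := infSet_nonempty π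
      obtain ⟨l, -, hl⟩ := hv 0
      refine ⟨l, ?_⟩
      rw [hl]
      simpa using hr3 _ hE hπ v hv
  · rw [hB0, zero_add]
    exact PrFrom_ville (s := s) had hsm

open scoped Classical in
/-- The optimal probability of reaching `U` within a bounded number of steps. -/
noncomputable def reachProb (C : V → Prop) (ed : V → V → Prop) (P : V → V → ℝ) (U : Set V) :
    ℕ → V → ℝ
  | 0, u => if u ∈ U then 1 else 0
  | m + 1, u => if u ∈ U then 1 else
      if C u then ⨆ v : {v // ed u v}, reachProb C ed P U m v
      else ∑ v, P u v * reachProb C ed P U m v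

section Reach

variable {C : V → Prop} {ed : V → V → Prop} {P : V → V → ℝ} {U : Set V}

lemma reachProb_of_mem {u : V} (hu : u ∈ U) (m : ℕ) : reachProb C ed P U m u = 1 := by
  cases m <;> simp [reachProb, hu]

lemma reachProb_mem_Icc (hP0 : ∀ u v, 0 ≤ P u v) (hP1 : ∀ u, ∑ v, P u v = 1)
    (hed : ∀ u, C u → ∃ v, ed u v) (m : ℕ) : ∀ u, 0 ≤ reachProb C ed P U m u ∧ reachProb C ed P U m
      u ≤ 1 := by
  induction m with
  | zero => intro u; simp only [reachProb]; split_ifs <;> norm_num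
  | succ m ih =>
    intro u
    simp only [reachProb]
    split_ifs with h1 h2
    · norm_num
    · obtain ⟨v, hv⟩ := hed u h2
      have : Nonempty {v // ed u v} := ⟨⟨v, hv⟩⟩
      exact ⟨Real.iSup_nonneg fun v => (ih v).1, ciSup_le fun v => (ih v).2⟩
    · refine ⟨Finset.sum_nonneg fun v _ => mul_nonneg (hP0 _ _) (ih v).1, ?_⟩
      rw [← hP1 u]
      exact Finset.sum_le_sum fun v _ => mul_le_of_le_one_right (hP0 _ _) (ih v).2

lemma reachProb_mono_succ (hP0 : ∀ u v, 0 ≤ P u v) (hP1 : ∀ u, ∑ v, P u v = 1)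
    (hed : ∀ u, C u → ∃ v, ed u v) (m : ℕ) :
    ∀ u, reachProb C ed P U m u ≤ reachProb C ed P U (m + 1) u := by
  induction m with
  | zero =>
    intro u
    by_cases hu : u ∈ U
    · rw [reachProb_of_mem hu, reachProb_of_mem hu]
    · have := (reachProb_mem_Icc hP0 hP1 hed (U := U) 1 u).1
      simpa [reachProb, hu] using this
  | succ m ih =>
    intro u
    by_cases hu : u ∈ U
    · rw [reachProb_of_mem hu, reachProb_of_mem hu]
    · rw [reachProb, reachProb, if_neg hu, if_neg hu]
      split_ifs with h2
      · exact ciSup_mono (Set.finite_range _).bddAbove fun v => ih v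
      · exact Finset.sum_le_sum fun v _ => mul_le_mul_of_nonneg_left (ih v) (hP0 _ _)

lemma tendsto_reachProb (hP0 : ∀ u v, 0 ≤ P u v) (hP1 : ∀ u, ∑ v, P u v = 1)
    (hed : ∀ u, C u → ∃ v, ed u v) (u : V) :
    Tendsto (fun m => reachProb C ed P U m u) atTop (nhds (⨆ m, reachProb C ed P U m u)) :=
  tendsto_atTop_ciSup (monotone_nat_of_le_succ fun m => reachProb_mono_succ hP0 hP1 hed m u)
    ⟨1, by rintro _ ⟨m, rfl⟩; exact (reachProb_mem_Icc hP0 hP1 hed m u).2⟩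

lemma reachProb_le_iSup (hP0 : ∀ u v, 0 ≤ P u v) (hP1 : ∀ u, ∑ v, P u v = 1)
    (hed : ∀ u, C u → ∃ v, ed u v) (m : ℕ) (u : V) :
    reachProb C ed P U m u ≤ ⨆ m, reachProb C ed P U m u :=
  le_ciSup (f := fun m => reachProb C ed P U m u)
    ⟨1, by rintro _ ⟨m, rfl⟩; exact (reachProb_mem_Icc hP0 hP1 hed m u).2⟩ m

lemma exists_reachProb_succ (hed : ∀ u, C u → ∃ v, ed u v) {u : V} (hu : u ∉ U) (hC : C u) (m : ℕ) :
    ∃ v, ed u v ∧ reachProb C ed P U (m + 1) u = reachProb C ed P U m v := by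
  obtain ⟨v, hv⟩ := hed u hC
  have : Nonempty {v // ed u v} := ⟨⟨v, hv⟩⟩
  obtain ⟨b, hb⟩ := exists_eq_ciSup_of_finite (f := fun v : {v // ed u v} => reachProb C ed P U m v)
  exact ⟨b, b.2, by rw [reachProb, if_neg hu, if_pos hC]; exact hb.symm⟩

lemma cert_iSup_reachProb (hP0 : ∀ u v, 0 ≤ P u v) (hP1 : ∀ u, ∑ v, P u v = 1)
    (hed : ∀ u, C u → ∃ v, ed u v) (G : Set V → Prop)
    (hU : ∀ E, IsEC C ed P E → G E → ∀ u, u ∈ E → u ∈ U) :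
    Cert C ed P G (fun u => ⨆ m, reachProb C ed P U m u) := by
  refine ⟨fun u => ?_, fun u hu => ?_, fun u v hC huv => ?_, fun E hE hG u hu => ?_⟩
  · exact Real.iSup_nonneg fun m => (reachProb_mem_Icc hP0 hP1 hed m u).1
  · refine le_of_tendsto' (tendsto_finsetSum _ fun v _ =>
      (tendsto_reachProb hP0 hP1 hed v).const_mul (P u v)) fun m => ?_
    refine le_trans ?_ (reachProb_le_iSup hP0 hP1 hed (m + 1) u)
    by_cases huU : u ∈ U
    · rw [reachProb_of_mem huU, ← hP1 u]
      exact Finset.sum_le_sum fun v _ => mul_le_of_le_one_right (hP0 _ _)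
        (reachProb_mem_Icc hP0 hP1 hed m v).2
    · rw [reachProb, if_neg huU, if_neg hu]
  · refine ciSup_le fun m => le_trans ?_ (reachProb_le_iSup hP0 hP1 hed (m + 1) u)
    by_cases huU : u ∈ U
    · rw [reachProb_of_mem huU]
      exact (reachProb_mem_Icc hP0 hP1 hed m v).2
    · rw [reachProb, if_neg huU, if_pos hC]
      exact le_ciSup (f := fun v : {v // ed u v} => reachProb C ed P U m v)
        (Set.finite_range _).bddAbove ⟨v, huv⟩
  · refine le_trans ?_ (reachProb_le_iSup hP0 hP1 hed 0 u)
    rw [reachProb_of_mem (hU E hE hG u hu)]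

open scoped Classical in
/-- From every position the controller can play so that the objective fails with probability
at most the complement of the bounded reachability value. -/
lemma exists_strategy_reachProb (hP0 : ∀ u v, 0 ≤ P u v) (hP1 : ∀ u, ∑ v, P u v = 1)
    (hed : ∀ u, C u → ∃ v, ed u v) {G : Set V → Prop} (m : ℕ)
    (hU : ∀ u, u ∈ U → ∃ E, IsEC C ed P E ∧ G E ∧ u ∈ E) :
    ∃ S : List V → V → Set V, (∀ h u, C u → (S h u).Nonempty ∧ ∀ v ∈ S h u, ed u v) ∧
      ∀ (A : Arena k V) (σ : Profile k V) (s : V),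
        (∀ h u, ∑ v, A.stepProb σ h u v = 1) →
        (∀ h u v, ¬ C u → A.stepProb σ h u v = ENNReal.ofReal (P u v)) →
        (∀ h u v, C u → A.stepProb σ h u v =
          if v ∈ S h u then ((S h u).toFinset.card : ℝ≥0∞)⁻¹ else 0) →
        PrFrom A σ s {π | ¬ G (infSet π)} ≤ ENNReal.ofReal (1 - reachProb C ed P U m s) := by
  choose! Ec hEc hGc hmc using hU
  have hbest : ∀ u, ∃ f : ℕ → V, C u → (∀ j, ed u (f j)) ∧
      (u ∉ U → ∀ j, reachProb C ed P U (j + 1) u = reachProb C ed P U j (f j)) := by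
    intro u
    by_cases hC : C u
    · by_cases hu : u ∈ U
      · obtain ⟨v, hv⟩ := hed u hC
        exact ⟨fun _ => v, fun _ => ⟨fun _ => hv, fun h => absurd hu h⟩⟩
      · choose f hf1 hf2 using exists_reachProb_succ hed hu hC
        exact ⟨f, fun _ => ⟨hf1, fun _ => hf2⟩⟩
    · exact ⟨fun _ => u, fun h => absurd h hC⟩
  choose best hbest using hbest
  let S : List V → V → Set V := fun h u =>
    match (h ++ [u]).find? (fun x => decide (x ∈ U)) with
    | none => {best u (m - h.length - 1)}
    | some x => if (∃ v, v ∈ Ec x ∧ ed u v) then {v | v ∈ Ec x ∧ ed u v} else {v | ed u v}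
  refine ⟨S, ?_, ?_⟩
  · intro h u hC
    simp only [S]
    split
    · exact ⟨⟨_, rfl⟩, by rintro v rfl; exact (hbest u hC).1 _⟩
    · split_ifs with h1
      · exact ⟨h1, fun v hv => hv.2⟩
      · exact ⟨hed u hC, fun v hv => hv⟩
  intro A σ s hst hP hS
  obtain ⟨B, hB0, hB⟩ := exists_null_unfair s hst
  let F : ℕ → Play V → ℝ≥0∞ := fun t π =>
    if ∃ j ≤ t, π j ∈ U then 0 else ENNReal.ofReal (1 - reachProb C ed P U (m - t) (π t))
  have had : Adapted F := by
    intro t π π' h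
    simp only [F]
    rw [h t le_rfl]
    congr 1
    apply propext
    refine exists_congr fun j => and_congr_right fun hj => ?_
    rw [h j hj]
  have hfind : ∀ (π : Play V) (t : ℕ), (∀ j ≤ t, π j ∉ U) →
      (pre π t ++ [π t]).find? (fun x => decide (x ∈ U)) = none := by
    intro π t h
    rw [← pre_succ, List.find?_eq_none]
    intro x hx
    simp only [pre, List.mem_map, List.mem_range] at hx
    obtain ⟨i, hi, rfl⟩ := hx
    simpa using h i (by omega)
  have hsm : Supermart A σ F := by
    intro t π
    by_cases hhit : ∃ j ≤ t, π j ∈ U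
    · have h0 : ∀ v, F (t + 1) (Function.update π (t + 1) v) = 0 := by
        intro v
        obtain ⟨j, hj, hjU⟩ := hhit
        exact if_pos ⟨j, by omega, by rwa [Function.update_of_ne (by omega)]⟩
      simp [h0]
    · have hF : F t π = ENNReal.ofReal (1 - reachProb C ed P U (m - t) (π t)) := if_neg hhit
      push Not at hhit
      have hle : ∀ v, F (t + 1) (Function.update π (t + 1) v) ≤
          ENNReal.ofReal (1 - reachProb C ed P U (m - (t + 1)) v) := by
        intro v
        simp only [F, Function.update_self]
        split_ifs
        · exact zero_le
        · exact le_rfl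
      rw [hF]
      refine (Finset.sum_le_sum fun v _ => mul_le_mul_right (hle v) _).trans ?_
      rcases Nat.lt_or_ge t m with htm | htm
      · obtain ⟨j, hj⟩ : ∃ j, m - t = j + 1 := ⟨m - t - 1, by omega⟩
        have hj' : m - (t + 1) = j := by omega
        rw [hj, hj']
        by_cases hC : C (π t)
        · have hSv : S (pre π t) (π t) = {best (π t) j} := by
            simp only [S]
            rw [hfind π t hhit]
            simp only [pre_length]
            rw [show m - t - 1 = j by omega]
          simp only [hS _ _ _ hC, hSv]
          rw [(hbest _ hC).2 (hhit t le_rfl) j]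
          simp
        · rw [reachProb, if_neg (hhit t le_rfl), if_neg hC]
          apply le_of_eq
          calc _ = ∑ v, ENNReal.ofReal (P (π t) v * (1 - reachProb C ed P U j v)) := by
                refine Finset.sum_congr rfl fun v _ => ?_
                rw [hP _ _ _ hC, ENNReal.ofReal_mul (hP0 _ _)]
            _ = ENNReal.ofReal (∑ v, P (π t) v * (1 - reachProb C ed P U j v)) := by
                rw [ENNReal.ofReal_sum_of_nonneg fun v _ => mul_nonneg (hP0 _ _)
                  (sub_nonneg.2 (reachProb_mem_Icc hP0 hP1 hed j v).2)]
            _ = _ := by simp only [mul_sub, mul_one, Finset.sum_sub_distrib, hP1]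
      · rw [show m - t = 0 by omega, reachProb, if_neg (hhit t le_rfl), sub_zero,
          ENNReal.ofReal_one, ← hst (pre π t) (π t)]
        refine Finset.sum_le_sum fun v _ => mul_le_of_le_one_right' ?_
        rw [← ENNReal.ofReal_one]
        apply ENNReal.ofReal_le_ofReal
        linarith [(reachProb_mem_Icc hP0 hP1 hed (U := U) (m - (t + 1)) v).1]
  have hF0 : F 0 (fun _ => s) ≤ ENNReal.ofReal (1 - reachProb C ed P U m s) := by
    simp only [F]
    split_ifs
    · exact zero_le
    · exact le_rfl
  refine le_trans ?_ hF0
  refine le_trans (PrFrom_mono A σ s (T := B ∪ {π | ∃ t, 1 ≤ F t π}) ?_)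
    ((PrFrom_union A σ s _ _).trans ?_)
  · intro π hπ
    by_contra hcon
    rw [Set.mem_union, not_or] at hcon
    obtain ⟨hb, hV⟩ := hcon
    obtain ⟨h1, h2⟩ := hB π hb
    apply hπ
    have hhit : ∃ t, π t ∈ U := by
      by_contra! hno
      refine hV ⟨m, ?_⟩
      simp [F, hno, reachProb]
    set t0 := Nat.find hhit with ht0
    have hx : π t0 ∈ U := Nat.find_spec hhit
    have hmin : ∀ j < t0, π j ∉ U := fun j hj => Nat.find_min hhit hj
    set E := Ec (π t0) with hE
    have hEC := hEc _ hx
    have hfind' : ∀ d, (pre π (t0 + d) ++ [π (t0 + d)]).find? (fun x => decide (x ∈ U)) =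
        some (π t0) := by
      intro d
      induction d with
      | zero =>
        rw [List.find?_append, List.find?_eq_none.2]
        · simp [hx]
        · intro y hy
          simp only [pre, List.mem_map, List.mem_range] at hy
          obtain ⟨i, hi, rfl⟩ := hy
          simpa using hmin i hi
      | succ d ih =>
        rw [← add_assoc, pre_succ, List.find?_append, ih]
        simp
    have hSd : ∀ d, π (t0 + d) ∈ E → C (π (t0 + d)) →
        S (pre π (t0 + d)) (π (t0 + d)) = {v | v ∈ E ∧ ed (π (t0 + d)) v} := by
      intro d hd hC
      simp only [S]
      rw [hfind' d]
      exact if_pos (hEC.2.2.2 _ hd hC)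
    have hstay : ∀ d, π (t0 + d) ∈ E := by
      intro d
      induction d with
      | zero => exact hmc _ hx
      | succ d ih =>
        have hpos := h1 (t0 + d)
        by_cases hC : C (π (t0 + d))
        · rw [hS _ _ _ hC, hSd d ih hC] at hpos
          by_contra hn
          apply hpos
          rw [if_neg]
          exact fun hh => hn hh.1
        · rw [hP _ _ _ hC] at hpos
          exact hEC.2.2.1 _ (π (t0 + d + 1)) ih hC (by simpa using hpos)
    have hsubE : ∀ v, v ∈ infSet π → v ∈ E := by
      intro v hv
      obtain ⟨l, hl, rfl⟩ := hv t0
      have := hstay (l - t0)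
      rwa [Nat.add_sub_cancel' hl] at this
    have hclosed : ∀ v w, v ∈ infSet π → v ∈ E → w ∈ E → MStep C ed P v w → w ∈ infSet π := by
      intro v w hv _ hw hvw
      have hf : ∃ x : ℝ≥0∞, 0 < x ∧
          ∃ᶠ t in atTop, π t = v ∧ x ≤ A.stepProb σ (pre π t) v w := by
        have hv' := hv
        rw [infSet_eq_frequently] at hv'
        rcases hvw with ⟨hC, hed'⟩ | ⟨hC, hPp⟩
        · refine ⟨((Fintype.card V : ℕ) : ℝ≥0∞)⁻¹, by simp, ?_⟩
          refine (hv'.and_eventually (eventually_ge_atTop t0)).mono ?_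
          rintro t ⟨rfl, ht⟩
          refine ⟨rfl, ?_⟩
          obtain ⟨d, rfl⟩ := Nat.exists_eq_add_of_le ht
          rw [hS _ _ _ hC, hSd d (hstay d) hC, if_pos ⟨hw, hed'⟩, ENNReal.inv_le_inv]
          exact_mod_cast Finset.card_le_univ _
        · refine ⟨ENNReal.ofReal (P v w), by simpa using hPp, hv'.mono ?_⟩
          rintro t ht
          exact ⟨ht, (hP _ _ _ hC).ge⟩
      obtain ⟨x, hx0, hxf⟩ := hf
      intro M
      obtain ⟨l, hl, hlw⟩ := frequently_atTop.1 (h2 v w x hx0 hxf) M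
      exact ⟨l + 1, by omega, hlw.2⟩
    obtain ⟨v0, hv0⟩ := infSet_nonempty π
    have heq : infSet π = E := by
      ext v
      refine ⟨hsubE v, fun hv => ?_⟩
      exact hEC.2.1 (infSet π) ⟨v0, hv0, hsubE _ hv0⟩ (fun a b => hclosed a b) v hv
    rw [heq]
    exact hGc _ hx
  · rw [hB0, zero_add]
    exact PrFrom_ville (s := s) had hsm

end Reach

end MDP

section Answer

set_option linter.unusedSectionVars false

variable {k : ℕ} {V : Type} [Fintype V] [DecidableEq V]

/-- `P` is the transition matrix of a valid stationary strategy profile. -/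
def IsTransMatrix (A : Arena k V) (P : V → V → ℝ) : Prop :=
  (∀ u v, 0 ≤ P u v) ∧ (∀ u, ∑ v, P u v = 1) ∧
  (∀ u, A.owner u = none → ∀ v, P u v = (A.prob u v : ℝ)) ∧
  ∀ u v, A.owner u ≠ none → 0 < P u v → A.edge u v = true

/-- Certificates for the Markov decision process of player `i`. -/
abbrev PlayerCert (A : Arena k V) (i : Fin (k + 1)) (φ : BForm V) (P : V → V → ℝ)
    (r : V → ℝ) : Prop :=
  Cert (fun u => A.owner u = some i) (fun u v => A.edge u v = true) P
    (fun E => BForm.holds (· ∈ E) φ) r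

/-- Certificates for the failure of an objective in a Markov chain. -/
abbrev ChainCert (A : Arena k V) (φ : BForm V) (P : V → V → ℝ) (r : V → ℝ) : Prop :=
  Cert (fun _ => False) (fun u v => A.edge u v = true) P
    (fun E => ¬ BForm.holds (· ∈ E) φ) r

/-- The answer of the stationary rational synthesis problem, in terms of transition matrices
and certificates. -/
def MatrixAnswer (A : Arena k V) (φ : Fin (k + 1) → BForm V) (μ : ℝ) : Prop :=
  ∃ x, IsTransMatrix A x ∧ ∀ P, IsTransMatrix A P →
    (∀ u, A.owner u = some 0 → ∀ v, P u v = x u v) →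
    (∀ i, i ≠ 0 → ∃ r r', PlayerCert A i (φ i) P r ∧ ChainCert A (φ i) P r' ∧
      r A.init + r' A.init ≤ 1) →
    ∃ r, ChainCert A (φ 0) P r ∧ r A.init + μ ≤ 1

lemma sum_stepProb {A : Arena k V} (hA : A.WF) (σ : Profile k V) (h : List V) (u : V) :
    ∑ v, A.stepProb σ h u v = 1 := by
  unfold Arena.stepProb
  cases hu : A.owner u with
  | none =>
    obtain ⟨h0, h1⟩ := hA.2 u hu
    simp only
    rw [← ENNReal.ofReal_sum_of_nonneg fun v _ => by exact_mod_cast h0 v, ← Rat.cast_sum, h1]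
    simp
  | some i =>
    simp only
    rw [← tsum_fintype (L := .unconditional V)]
    exact PMF.tsum_coe _

lemma stepProb_owner {A : Arena k V} {σ : Profile k V} {h : List V} {u : V} {i : Fin (k + 1)}
    (hu : A.owner u = some i) (v : V) : A.stepProb σ h u v = σ i h u v := by
  simp [Arena.stepProb, hu]

lemma ofReal_le_of_add {a b : ℝ} {x y : ℝ≥0∞} (hxy : 1 ≤ x + y) (hy : y ≤ ENNReal.ofReal b)
    (hab : b + a ≤ 1) (hb : 0 ≤ b) : ENNReal.ofReal a ≤ x := by
  rcases le_total 0 a with ha | ha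
  · have h1 : 1 ≤ x + ENNReal.ofReal b := hxy.trans (by gcongr)
    have h2 : ENNReal.ofReal a + ENNReal.ofReal b ≤ 1 := by
      rw [← ENNReal.ofReal_add ha hb, ← ENNReal.ofReal_one]
      exact ENNReal.ofReal_le_ofReal (by linarith)
    exact (ENNReal.add_le_add_iff_right ENNReal.ofReal_ne_top).1 (h2.trans h1)
  · rw [ENNReal.ofReal_of_nonpos ha]
    exact zero_le

/-- The union of the end components satisfying `G`. -/
def goodStates (C : V → Prop) (ed : V → V → Prop) (P : V → V → ℝ) (G : Set V → Prop) : Set V :=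
  {u | ∃ E, IsEC C ed P E ∧ G E ∧ u ∈ E}

lemma exists_player_cert {A : Arena k V} (hA : A.WF) {σ : Profile k V} (hσ : σ.Valid A)
    {P : V → V → ℝ} (hP : IsTransMatrix A P)
    (hσP : ∀ h u v, A.stepProb σ h u v = ENNReal.ofReal (P u v)) (i : Fin (k + 1)) (φ : BForm V) :
    ∃ (r : V → ℝ) (q : ℕ → ℝ), PlayerCert A i φ P r ∧
      Filter.Tendsto q Filter.atTop (nhds (r A.init)) ∧
      ∀ m, 0 ≤ q m ∧ q m ≤ 1 ∧ ∃ τ, Strategy.Valid A τ ∧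
        PrFrom A (Function.update σ i τ) A.init (mullerObj φ)ᶜ ≤ ENNReal.ofReal (1 - q m) := by
  classical
  set C : V → Prop := fun u => A.owner u = some i
  set ed : V → V → Prop := fun u v => A.edge u v = true
  set G : Set V → Prop := fun E => BForm.holds (· ∈ E) φ
  have hed : ∀ u, C u → ∃ v, ed u v := by
    intro u hu
    obtain ⟨v, hv⟩ := hA.1 u
    rcases hv with hv | hv
    · simp only [C] at hu
      simp [hu] at hv
    · exact ⟨v, hv.2⟩
  refine ⟨_, _, cert_iSup_reachProb hP.1 hP.2.1 hed G (U := goodStates C ed P G)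
    fun E h1 h2 u h3 => ⟨E, h1, h2, h3⟩, tendsto_reachProb hP.1 hP.2.1 hed A.init, fun m =>
    ⟨(reachProb_mem_Icc hP.1 hP.2.1 hed m _).1, (reachProb_mem_Icc hP.1 hP.2.1 hed m _).2, ?_⟩⟩
  obtain ⟨S, hS1, hS2⟩ := exists_strategy_reachProb hP.1 hP.2.1 hed m
    (U := goodStates C ed P G) (G := G) fun u hu => hu
  let τ : Strategy V := fun h u => if hC : C u then
    PMF.uniformOfFinset (S h u).toFinset (by simpa using (hS1 h u hC).1) else σ i h u
  have hτC : ∀ h u v, C u → τ h u v =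
      if v ∈ S h u then ((S h u).toFinset.card : ℝ≥0∞)⁻¹ else 0 := by
    intro h u v hC
    simp only [τ, dif_pos hC, PMF.uniformOfFinset_apply, Set.mem_toFinset]
  refine ⟨τ, ?_, ?_⟩
  · intro h u v huv
    by_cases hC : C u
    · rw [hτC h u v hC] at huv
      have hv : v ∈ S h u := by
        by_contra hn
        exact huv (if_neg hn)
      refine Or.inr ⟨?_, (hS1 h u hC).2 v hv⟩
      simp only [C] at hC
      simp [hC]
    · apply hσ i h u v
      simpa only [τ, dif_neg hC] using huv
  · refine hS2 A _ A.init (sum_stepProb hA _) ?_ ?_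
    · intro h u v hC
      rw [← hσP h u v]
      unfold Arena.stepProb
      cases hu : A.owner u with
      | none => rfl
      | some j =>
        have : j ≠ i := by
          rintro rfl
          exact hC hu
        simp [Function.update_of_ne this]
    · intro h u v hC
      rw [stepProb_owner hC, Function.update_self]
      exact hτC h u v hC

lemma exists_chain_cert {A : Arena k V} (hA : A.WF) {σ : Profile k V}
    {P : V → V → ℝ} (hP : IsTransMatrix A P)
    (hσP : ∀ h u v, A.stepProb σ h u v = ENNReal.ofReal (P u v)) (φ : BForm V) :
    ∃ (r : V → ℝ) (q : ℕ → ℝ), ChainCert A φ P r ∧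
      Filter.Tendsto q Filter.atTop (nhds (r A.init)) ∧
      ∀ m, 0 ≤ q m ∧ q m ≤ 1 ∧
        PrFrom A σ A.init (mullerObj φ) ≤ ENNReal.ofReal (1 - q m) := by
  classical
  set C : V → Prop := fun _ => False
  set ed : V → V → Prop := fun u v => A.edge u v = true
  set G : Set V → Prop := fun E => ¬ BForm.holds (· ∈ E) φ
  have hed : ∀ u, C u → ∃ v, ed u v := fun u hu => hu.elim
  refine ⟨_, _, cert_iSup_reachProb hP.1 hP.2.1 hed G (U := goodStates C ed P G)
    fun E h1 h2 u h3 => ⟨E, h1, h2, h3⟩, tendsto_reachProb hP.1 hP.2.1 hed A.init, fun m =>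
    ⟨(reachProb_mem_Icc hP.1 hP.2.1 hed m _).1, (reachProb_mem_Icc hP.1 hP.2.1 hed m _).2, ?_⟩⟩
  obtain ⟨S, -, hS2⟩ := exists_strategy_reachProb hP.1 hP.2.1 hed m
    (U := goodStates C ed P G) (G := G) fun u hu => hu
  refine le_trans (PrFrom_mono A σ A.init ?_) (hS2 A σ A.init (sum_stepProb hA _)
    (fun h u v _ => hσP h u v) fun h u v hC => hC.elim)
  intro π hπ
  exact not_not_intro hπ

lemma PrFrom_le_of_playerCert {A : Arena k V} (hA : A.WF) {σ : Profile k V}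
    {P : V → V → ℝ} (hP : IsTransMatrix A P)
    (hσP : ∀ h u v, A.stepProb σ h u v = ENNReal.ofReal (P u v)) {i : Fin (k + 1)} {φ : BForm V}
    {r : V → ℝ} (hr : PlayerCert A i φ P r) {τ : Strategy V} (hτ : τ.Valid A) :
    PrFrom A (Function.update σ i τ) A.init (mullerObj φ) ≤ ENNReal.ofReal (r A.init) := by
  refine PrFrom_le_of_cert (sum_stepProb hA _) hP.1 ?_ ?_ hr
  · intro h u v hC
    rw [← hσP h u v]
    unfold Arena.stepProb
    cases hu : A.owner u with
    | none => rfl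
    | some j =>
      have : j ≠ i := by
        rintro rfl
        exact hC hu
      simp [Function.update_of_ne this]
  · intro h u v hC huv
    rw [stepProb_owner hC, Function.update_self] at huv
    rcases hτ h u v huv with hv | hv
    · simp [hC] at hv
    · exact hv.2

lemma PrFrom_compl_le_of_chainCert {A : Arena k V} (hA : A.WF) {σ : Profile k V}
    {P : V → V → ℝ} (hP : IsTransMatrix A P)
    (hσP : ∀ h u v, A.stepProb σ h u v = ENNReal.ofReal (P u v)) {φ : BForm V}
    {r : V → ℝ} (hr : ChainCert A φ P r) :
    PrFrom A σ A.init (mullerObj φ)ᶜ ≤ ENNReal.ofReal (r A.init) := by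
  have := PrFrom_le_of_cert (s := A.init) (sum_stepProb hA _) hP.1
    (fun h u v _ => hσP h u v) (fun _ _ _ h => h.elim) hr
  exact this

lemma le_PrFrom_iff {A : Arena k V} (hA : A.WF) {σ : Profile k V}
    {P : V → V → ℝ} (hP : IsTransMatrix A P)
    (hσP : ∀ h u v, A.stepProb σ h u v = ENNReal.ofReal (P u v)) (φ : BForm V) (a : ℝ) :
    ENNReal.ofReal a ≤ PrFrom A σ A.init (mullerObj φ) ↔
      ∃ r, ChainCert A φ P r ∧ r A.init + a ≤ 1 := by
  constructor
  · intro h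
    obtain ⟨r, q, hr, hq, hm⟩ := exists_chain_cert hA hP hσP φ
    refine ⟨r, hr, ?_⟩
    refine le_of_tendsto' (hq.add_const a) fun m => ?_
    obtain ⟨h0, h1, h2⟩ := hm m
    have := (ENNReal.ofReal_le_ofReal_iff (by linarith)).1 (h.trans h2)
    linarith
  · rintro ⟨r, hr, hra⟩
    exact ofReal_le_of_add (one_le_PrFrom_add_compl (sum_stepProb hA σ) _)
      (PrFrom_compl_le_of_chainCert hA hP hσP hr) hra (hr.1 _)

lemma zeroNE_iff {A : Arena k V} (hA : A.WF) {σ : Profile k V} (hσ : σ.Valid A)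
    {P : V → V → ℝ} (hP : IsTransMatrix A P)
    (hσP : ∀ h u v, A.stepProb σ h u v = ENNReal.ofReal (P u v)) (φ : Fin (k + 1) → BForm V) :
    ZeroNE A (fun i => mullerObj (φ i)) σ ↔
      ∀ i, i ≠ 0 → ∃ r r', PlayerCert A i (φ i) P r ∧ ChainCert A (φ i) P r' ∧
        r A.init + r' A.init ≤ 1 := by
  refine forall_congr' fun i => imp_congr_right fun _ => ?_
  simp only [Pay]
  constructor
  · intro h
    obtain ⟨r, q, hr, hq, hm⟩ := exists_player_cert hA hσ hP hσP i (φ i)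
    obtain ⟨r', q', hr', hq', hm'⟩ := exists_chain_cert hA hP hσP (φ i)
    refine ⟨r, r', hr, hr', le_of_tendsto' (hq.add hq') fun m => ?_⟩
    obtain ⟨h0, h1, τ, hτ, h2⟩ := hm m
    obtain ⟨h0', h1', h2'⟩ := hm' m
    have h3 := ofReal_le_of_add (a := q m)
      (one_le_PrFrom_add_compl (s := A.init) (sum_stepProb hA _) (mullerObj (φ i))) h2
      (by linarith) (by linarith)
    have := (ENNReal.ofReal_le_ofReal_iff (by linarith)).1 ((h3.trans (h τ hτ)).trans h2')
    linarith
  · rintro ⟨r, r', hr, hr', hrr⟩ τ hτ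
    exact (PrFrom_le_of_playerCert hA hP hσP hr hτ).trans
      ((le_PrFrom_iff hA hP hσP (φ i) _).2 ⟨r', hr', by linarith⟩)

/-- The transition matrix of a stationary profile. -/
noncomputable def profileMatrix (A : Arena k V) (σ : Profile k V) (u v : V) : ℝ :=
  (A.stepProb σ [] u v).toReal

lemma stepProb_ne_top {A : Arena k V} {σ : Profile k V} (h : List V) (u v : V) :
    A.stepProb σ h u v ≠ ⊤ := by
  unfold Arena.stepProb
  cases A.owner u with
  | none => exact ENNReal.ofReal_ne_top
  | some i => exact PMF.apply_ne_top _ _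

lemma isTransMatrix_profileMatrix {A : Arena k V} (hA : A.WF) {σ : Profile k V}
    (hσ : σ.Valid A) : IsTransMatrix A (profileMatrix A σ) := by
  refine ⟨fun u v => ENNReal.toReal_nonneg, fun u => ?_, fun u hu v => ?_, fun u v hu h => ?_⟩
  · unfold profileMatrix
    rw [← ENNReal.toReal_sum fun v _ => stepProb_ne_top _ _ _, sum_stepProb hA,
      ENNReal.toReal_one]
  · have := (hA.2 u hu).1 v
    simp only [profileMatrix, Arena.stepProb, hu]
    rw [ENNReal.toReal_ofReal (by exact_mod_cast this)]
  · obtain ⟨i, hi⟩ := Option.ne_none_iff_exists'.1 hu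
    rw [profileMatrix, stepProb_owner hi] at h
    rcases hσ i [] u v (by rintro h0; simp [h0] at h) with hv | hv
    · exact absurd hv.1 hu
    · exact hv.2

lemma stepProb_eq_profileMatrix {A : Arena k V} {σ : Profile k V}
    (hσ : ∀ i, (σ i).Stationary) (h : List V) (u v : V) :
    A.stepProb σ h u v = ENNReal.ofReal (profileMatrix A σ u v) := by
  rw [profileMatrix, ENNReal.ofReal_toReal (stepProb_ne_top _ _ _)]
  unfold Arena.stepProb
  cases A.owner u with
  | none => rfl
  | some i => simp only; rw [hσ i h [] u]

/-- The stationary strategy given by a transition matrix. -/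
noncomputable def matrixStrategy {A : Arena k V} {P : V → V → ℝ} (hP : IsTransMatrix A P) :
    Strategy V := fun _ u => PMF.ofFintype (fun v => ENNReal.ofReal (P u v)) (by
      rw [← ENNReal.ofReal_sum_of_nonneg fun v _ => hP.1 u v, hP.2.1, ENNReal.ofReal_one])

lemma matrixStrategy_apply {A : Arena k V} {P : V → V → ℝ} (hP : IsTransMatrix A P)
    (h : List V) (u v : V) : matrixStrategy hP h u v = ENNReal.ofReal (P u v) := rfl

lemma matrixStrategy_valid {A : Arena k V} {P : V → V → ℝ} (hP : IsTransMatrix A P) :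
    (matrixStrategy hP).Valid A := by
  intro h u v huv
  rw [matrixStrategy_apply] at huv
  have hpos : 0 < P u v := by simpa using huv
  by_cases hu : A.owner u = none
  · refine Or.inl ⟨hu, ?_⟩
    rw [hP.2.2.1 u hu v] at hpos
    exact_mod_cast hpos
  · exact Or.inr ⟨hu, hP.2.2.2 u v hu hpos⟩

lemma ncrspAnswer_iff_matrixAnswer {A : Arena k V} (hA : A.WF) (φ : Fin (k + 1) → BForm V)
    (μ : ℚ) :
    NCRSPAnswer A (fun i => mullerObj (φ i)) Strategy.Stationary Strategy.Stationary μ ↔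
      MatrixAnswer A φ μ := by
  constructor
  · rintro ⟨σ0, hv, hs, h⟩
    refine ⟨profileMatrix A fun _ => σ0, isTransMatrix_profileMatrix hA fun _ => hv, ?_⟩
    intro P hP hP0 hNE
    set σ : Profile k V := Function.update (fun _ => matrixStrategy hP) 0 σ0 with hσdef
    have hσv : σ.Valid A := by
      intro i
      rcases eq_or_ne i 0 with rfl | hi
      · simpa [hσdef] using hv
      · simpa [hσdef, Function.update_of_ne hi] using matrixStrategy_valid hP
    have hσs : ∀ i, (σ i).Stationary := by
      intro i
      rcases eq_or_ne i 0 with rfl | hi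
      · simpa [hσdef] using hs
      · rw [hσdef, Function.update_of_ne hi]
        exact fun _ _ _ => rfl
    have hσP : ∀ h u v, A.stepProb σ h u v = ENNReal.ofReal (P u v) := by
      intro h u v
      rcases hu : A.owner u with _ | i
      · rw [hP.2.2.1 u hu v]
        simp [Arena.stepProb, hu]
      · rcases eq_or_ne i 0 with rfl | hi
        · rw [stepProb_owner hu, hP0 u hu v, profileMatrix, stepProb_owner hu,
            ENNReal.ofReal_toReal (PMF.apply_ne_top _ _), hs [] h u]
          simp [hσdef]
        · rw [stepProb_owner hu, hσdef, Function.update_of_ne hi, matrixStrategy_apply]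
    rw [← le_PrFrom_iff hA hP hσP]
    exact h σ (by simp [hσdef]) hσv (fun i _ => hσs i) ((zeroNE_iff hA hσv hP hσP φ).2 hNE)
  · rintro ⟨x, hx, h⟩
    refine ⟨matrixStrategy hx, matrixStrategy_valid hx, fun _ _ _ => rfl, ?_⟩
    intro σ hσ0 hσv hσs hNE
    have hσs' : ∀ i, (σ i).Stationary := by
      intro i
      rcases eq_or_ne i 0 with rfl | hi
      · rw [hσ0]
        exact fun _ _ _ => rfl
      · exact hσs i hi
    have hP := isTransMatrix_profileMatrix hA hσv
    have hσP := stepProb_eq_profileMatrix (A := A) hσs'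
    refine (le_PrFrom_iff hA hP hσP (φ 0) _).2 (h _ hP ?_ ((zeroNE_iff hA hσv hP hσP φ).1 hNE))
    intro u hu v
    rw [profileMatrix, stepProb_owner hu, hσ0, matrixStrategy_apply,
      ENNReal.toReal_ofReal (hx.1 u v)]

end Answer

/-! ### Uniform families of formulas -/

/-- Schemata for first-order formulas whose variables stand for arrays of real numbers.  In terms,
a variable denotes the entry `0` of the array, and `sel a b c` states that the entry of `a` with
index `b` equals `c`. -/
inductive Sch : Type
  | le : RTerm → RTerm → Sch
  | not : Sch → Sch
  | and : Sch → Sch → Sch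
  | sel : ℕ → ℕ → ℕ → Sch
  | ex : Sch → Sch

/-- Arrays of real numbers. -/
abbrev Arr := ℕ → ℝ

/-- Extension of an assignment of arrays. -/
def consArr (a : Arr) (ρ : ℕ → Arr) : ℕ → Arr
  | 0 => a
  | j + 1 => ρ j

namespace RTerm

/-- Variables are multiplied by `L`. -/
def scale (L : ℕ) : RTerm → RTerm
  | var j => var (j * L)
  | zero => zero
  | one => one
  | add s t => add (scale L s) (scale L t)
  | mul s t => mul (scale L s) (scale L t)

/-- Renaming of variables. -/
def rename (ξ : ℕ → ℕ) : RTerm → RTerm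
  | var j => var (ξ j)
  | zero => zero
  | one => one
  | add s t => add (rename ξ s) (rename ξ t)
  | mul s t => mul (rename ξ s) (rename ξ t)

/-- The unary numeral of `i`. -/
def unary : ℕ → RTerm
  | 0 => zero
  | i + 1 => add (unary i) one

lemma eval_scale {L : ℕ} {r : ℕ → ℝ} {ρ : ℕ → ℝ} (h : ∀ j, r (j * L) = ρ j) (t : RTerm) :
    (t.scale L).eval r = t.eval ρ := by
  induction t <;> simp_all [scale, eval]

lemma eval_rename (ξ : ℕ → ℕ) (ρ : ℕ → ℝ) (t : RTerm) :
    (t.rename ξ).eval ρ = t.eval (ρ ∘ ξ) := by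
  induction t <;> simp_all [rename, eval]

lemma eval_unary (ρ : ℕ → ℝ) (i : ℕ) : (unary i).eval ρ = i := by
  induction i <;> simp_all [unary, eval]

end RTerm

namespace RForm

/-- Equality of terms. -/
def eq (s t : RTerm) : RForm := and (le s t) (le t s)

lemma holds_eq (ρ : ℕ → ℝ) (s t : RTerm) : (eq s t).holds ρ ↔ s.eval ρ = t.eval ρ := by
  simp only [eq, holds]
  exact le_antisymm_iff.symm

/-- The formula stating that `c` is the entry of index `b < i` of an array. -/
def select (L a b c : ℕ) : ℕ → RForm
  | 0 => le RTerm.one RTerm.zero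
  | i + 1 => or (select L a b c i) (and (eq (RTerm.var (b * L)) (RTerm.unary i))
      (eq (RTerm.var (c * L)) (RTerm.var (a * L + i))))

lemma holds_select (ρ : ℕ → ℝ) (L a b c i : ℕ) : (select L a b c i).holds ρ ↔
    ∃ j < i, ρ (b * L) = j ∧ ρ (c * L) = ρ (a * L + j) := by
  induction i with
  | zero => simp [select, holds, RTerm.eval]
  | succ i ih =>
    simp only [select, holds, ih, holds_eq, RTerm.eval, RTerm.eval_unary]
    constructor
    · rintro (⟨j, hj, h⟩ | h)
      · exact ⟨j, by omega, h⟩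
      · exact ⟨i, by omega, h⟩
    · rintro ⟨j, hj, h⟩
      rcases Nat.lt_succ_iff_lt_or_eq.1 hj with h' | rfl
      · exact Or.inl ⟨j, h', h⟩
      · exact Or.inr h

/-- A block of existential quantifiers. -/
def exBlock : ℕ → RForm → RForm
  | 0, f => f
  | L + 1, f => ex (exBlock L f)

lemma holds_exBlock (f : RForm) (L : ℕ) : ∀ ρ : ℕ → ℝ, (exBlock L f).holds ρ ↔
    ∃ a : Arr, f.holds (fun i => if i < L then a i else ρ (i - L)) := by
  induction L with
  | zero => intro ρ; simp [exBlock]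
  | succ L ih =>
    intro ρ
    simp only [exBlock, holds, ih]
    constructor
    · rintro ⟨x, a, h⟩
      refine ⟨fun i => if i < L then a i else x, ?_⟩
      convert h using 2 with i
      rcases lt_trichotomy i L with hi | rfl | hi
      · simp [hi, Nat.lt_succ_of_lt hi]
      · simp
      · rw [if_neg (by omega), if_neg (by omega)]
        obtain ⟨d, rfl⟩ := Nat.exists_eq_add_of_lt hi
        simp [show L + d + 1 - L = d + 1 by omega, show L + d + 1 - (L + 1) = d by omega]
    · rintro ⟨a, h⟩
      refine ⟨a L, a, ?_⟩
      convert h using 2 with i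
      rcases lt_trichotomy i L with hi | rfl | hi
      · simp [hi, Nat.lt_succ_of_lt hi]
      · simp
      · rw [if_neg (by omega), if_neg (by omega)]
        obtain ⟨d, rfl⟩ := Nat.exists_eq_add_of_lt hi
        simp [show L + d + 1 - L = d + 1 by omega, show L + d + 1 - (L + 1) = d by omega]

end RForm

namespace Sch

/-- Satisfaction of a schema for arrays of length `L`. -/
def sat (L : ℕ) : (ℕ → Arr) → Sch → Prop
  | ρ, le s t => s.eval (fun j => ρ j 0) ≤ t.eval (fun j => ρ j 0)
  | ρ, not φ => ¬ sat L ρ φ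
  | ρ, and φ ψ => sat L ρ φ ∧ sat L ρ ψ
  | ρ, sel a b c => ∃ i < L, ρ b 0 = (i : ℝ) ∧ ρ c 0 = ρ a i
  | ρ, ex φ => ∃ a, sat L (consArr a ρ) φ

/-- The first-order formula given by a schema. -/
def compile (L : ℕ) : Sch → RForm
  | le s t => RForm.le (s.scale L) (t.scale L)
  | not φ => RForm.not (compile L φ)
  | and φ ψ => RForm.and (compile L φ) (compile L ψ)
  | sel a b c => RForm.select L a b c L
  | ex φ => RForm.exBlock L (compile L φ)

lemma holds_compile {L : ℕ} (hL : 0 < L) (φ : Sch) : ∀ (r : ℕ → ℝ) (ρ : ℕ → Arr),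
    (∀ j, ∀ i < L, r (j * L + i) = ρ j i) → ((φ.compile L).holds r ↔ φ.sat L ρ) := by
  induction φ with
  | le s t =>
    intro r ρ h
    have h' : ∀ j, r (j * L) = ρ j 0 := fun j => by simpa using h j 0 hL
    simp only [compile, RForm.holds, sat, RTerm.eval_scale h']
  | not φ ih => intro r ρ h; simp only [compile, RForm.holds, sat, ih r ρ h]
  | and φ ψ ih1 ih2 => intro r ρ h; simp only [compile, RForm.holds, sat, ih1 r ρ h, ih2 r ρ h]
  | sel a b c =>
    intro r ρ h
    have h' : ∀ j, r (j * L) = ρ j 0 := fun j => by simpa using h j 0 hL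
    simp only [compile, RForm.holds_select, sat, h']
    refine exists_congr fun j => and_congr_right fun hj => ?_
    rw [h a j hj]
  | ex φ ih =>
    intro r ρ h
    simp only [compile, RForm.holds_exBlock, sat]
    refine exists_congr fun a => ih _ _ ?_
    intro j i hi
    cases j with
    | zero => simp [consArr, hi]
    | succ j =>
      rw [if_neg (by rw [Nat.succ_mul]; omega), Nat.succ_mul,
        show j * L + L + i - L = j * L + i by omega]
      exact h j i hi

/-- Lifting of a renaming under a quantifier. -/
def liftRen (ξ : ℕ → ℕ) : ℕ → ℕ
  | 0 => 0
  | j + 1 => ξ j + 1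

/-- Renaming of variables. -/
def rename : (ℕ → ℕ) → Sch → Sch
  | ξ, le s t => le (s.rename ξ) (t.rename ξ)
  | ξ, not φ => not (rename ξ φ)
  | ξ, and φ ψ => and (rename ξ φ) (rename ξ ψ)
  | ξ, sel a b c => sel (ξ a) (ξ b) (ξ c)
  | ξ, ex φ => ex (rename (liftRen ξ) φ)

lemma sat_rename (L : ℕ) (φ : Sch) : ∀ (ξ : ℕ → ℕ) (ρ : ℕ → Arr),
    (φ.rename ξ).sat L ρ ↔ φ.sat L (ρ ∘ ξ) := by
  induction φ with
  | le s t => intro ξ ρ; simp only [rename, sat, RTerm.eval_rename]; rfl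
  | not φ ih => intro ξ ρ; simp only [rename, sat, ih]
  | and φ ψ ih1 ih2 => intro ξ ρ; simp only [rename, sat, ih1, ih2]
  | sel a b c => intro ξ ρ; simp only [rename, sat, Function.comp]
  | ex φ ih =>
    intro ξ ρ
    simp only [rename, sat, ih]
    refine exists_congr fun a => ?_
    have : consArr a ρ ∘ liftRen ξ = consArr a (ρ ∘ ξ) := by
      funext j
      cases j <;> rfl
    rw [this]

end Sch

/-! ### Definable predicates -/

/-- Types of data that can be represented by assignments of arrays. -/
class Ctx (γ : Type) where
  Rep : ℕ → γ → (ℕ → Arr) → Prop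

instance : Ctx ℕ := ⟨fun _ n ρ => ρ 0 0 = n⟩
instance : Ctx ℝ := ⟨fun _ x ρ => ρ 0 0 = x⟩
instance : Ctx Arr := ⟨fun L a ρ => ∀ i < L, ρ 0 i = a i⟩
instance {γ δ : Type} [Ctx γ] [Ctx δ] : Ctx (γ × δ) :=
  ⟨fun L p ρ => Ctx.Rep L p.1 (fun j => ρ (2 * j + 1)) ∧ Ctx.Rep L p.2 (fun j => ρ (2 * j))⟩

section Definability

variable {γ δ ε : Type} [Ctx γ] [Ctx δ] [Ctx ε]

/-- Maps that only rearrange data. -/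
@[fun_prop]
def CtxMap (g : γ → δ) : Prop :=
  ∃ ξ : ℕ → ℕ, ∀ L x ρ, Ctx.Rep L x ρ → Ctx.Rep L (g x) (ρ ∘ ξ)

@[fun_prop]
lemma CtxMap.id : CtxMap (fun x : γ => x) := ⟨fun j => j, fun _ _ _ h => h⟩

@[fun_prop]
lemma CtxMap.comp {f : δ → ε} {g : γ → δ} (hf : CtxMap f) (hg : CtxMap g) :
    CtxMap (fun x => f (g x)) := by
  obtain ⟨ξ, hξ⟩ := hf
  obtain ⟨ζ, hζ⟩ := hg
  exact ⟨ζ ∘ ξ, fun L x ρ h => hξ L _ _ (hζ L x ρ h)⟩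

@[fun_prop]
lemma CtxMap.prodMk {f : γ → δ} {g : γ → ε} (hf : CtxMap f) (hg : CtxMap g) :
    CtxMap (fun x => (f x, g x)) := by
  obtain ⟨ξ, hξ⟩ := hf
  obtain ⟨ζ, hζ⟩ := hg
  refine ⟨fun j => if j % 2 = 1 then ξ (j / 2) else ζ (j / 2), fun L x ρ h => ⟨?_, ?_⟩⟩
  · convert hξ L x ρ h using 1
    funext j
    simp [Function.comp, Nat.add_mod, show (2 * j + 1) / 2 = j by omega]
  · convert hζ L x ρ h using 1
    funext j
    simp [Function.comp]

@[fun_prop]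
lemma CtxMap.fst : CtxMap (fun p : γ × δ => p.1) := ⟨fun j => 2 * j + 1, fun _ _ _ h => h.1⟩

@[fun_prop]
lemma CtxMap.snd : CtxMap (fun p : γ × δ => p.2) := ⟨fun j => 2 * j, fun _ _ _ h => h.2⟩


/-- Predicates that are uniformly definable by a schema. -/
def DefPred (P : ℕ → γ → Prop) : Prop :=
  ∃ φ : Sch, ∀ L, 0 < L → ∀ x ρ, Ctx.Rep L x ρ → (φ.sat L ρ ↔ P L x)

/-- Real-valued functions with a definable graph. -/
def DefFun (f : ℕ → γ → ℝ) : Prop := DefPred (fun L (p : γ × ℝ) => p.2 = f L p.1)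

lemma DefPred.comp {P : ℕ → δ → Prop} (hP : DefPred P) {g : γ → δ} (hg : CtxMap g) :
    DefPred (fun L x => P L (g x)) := by
  obtain ⟨φ, hφ⟩ := hP
  obtain ⟨ξ, hξ⟩ := hg
  exact ⟨φ.rename ξ, fun L hL x ρ h => by rw [Sch.sat_rename, hφ L hL _ _ (hξ L x ρ h)]⟩

lemma DefFun.comp {f : ℕ → δ → ℝ} (hf : DefFun f) {g : γ → δ} (hg : CtxMap g) :
    DefFun (fun L x => f L (g x)) := by
  have := DefPred.comp hf (g := fun p : γ × ℝ => (g p.1, p.2)) (by fun_prop)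
  exact this

lemma DefPred.congr {P Q : ℕ → γ → Prop} (hP : DefPred P) (h : ∀ L, 0 < L → ∀ x, P L x ↔ Q L x) :
    DefPred Q := by
  obtain ⟨φ, hφ⟩ := hP
  exact ⟨φ, fun L hL x ρ hr => (hφ L hL x ρ hr).trans (h L hL x)⟩

lemma DefPred.not {P : ℕ → γ → Prop} (hP : DefPred P) : DefPred (fun L x => ¬ P L x) := by
  obtain ⟨φ, hφ⟩ := hP
  exact ⟨Sch.not φ, fun L hL x ρ h => by simp only [Sch.sat, hφ L hL x ρ h]⟩

lemma DefPred.and {P Q : ℕ → γ → Prop} (hP : DefPred P) (hQ : DefPred Q) :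
    DefPred (fun L x => P L x ∧ Q L x) := by
  obtain ⟨φ, hφ⟩ := hP
  obtain ⟨ψ, hψ⟩ := hQ
  exact ⟨Sch.and φ ψ, fun L hL x ρ h => by simp only [Sch.sat, hφ L hL x ρ h, hψ L hL x ρ h]⟩

lemma DefPred.or {P Q : ℕ → γ → Prop} (hP : DefPred P) (hQ : DefPred Q) :
    DefPred (fun L x => P L x ∨ Q L x) :=
  (hP.not.and hQ.not).not.congr fun L _ x => by tauto

lemma DefPred.imp {P Q : ℕ → γ → Prop} (hP : DefPred P) (hQ : DefPred Q) :
    DefPred (fun L x => P L x → Q L x) :=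
  (hP.and hQ.not).not.congr fun L _ x => by tauto

/-- The renaming that makes room for a new variable. -/
def pushRen (j : ℕ) : ℕ := if j % 2 = 1 then j / 2 + 1 else 0

lemma rep_push {L : ℕ} {x : γ} {ρ : ℕ → Arr} (h : Ctx.Rep L x ρ) (a : Arr) :
    Ctx.Rep L x (fun j => (consArr a ρ ∘ pushRen) (2 * j + 1)) := by
  convert h using 1
  funext j
  simp [Function.comp, pushRen, Nat.add_mod, consArr, show (2 * j + 1) / 2 = j by omega]

lemma push_zero (ρ : ℕ → Arr) (a : Arr) : (consArr a ρ ∘ pushRen) (2 * 0) = a := by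
  simp [pushRen, consArr]

lemma DefPred.exReal {P : ℕ → γ → ℝ → Prop} (hP : DefPred (fun L (p : γ × ℝ) => P L p.1 p.2)) :
    DefPred (fun L x => ∃ r, P L x r) := by
  obtain ⟨φ, hφ⟩ := hP
  refine ⟨Sch.ex (φ.rename pushRen), fun L hL x ρ h => ?_⟩
  simp only [Sch.sat, Sch.sat_rename]
  constructor
  · rintro ⟨a, ha⟩
    refine ⟨a 0, (hφ L hL (x, a 0) _ ⟨rep_push h a, ?_⟩).1 ha⟩
    change (consArr a ρ ∘ pushRen) (2 * 0) 0 = a 0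
    rw [push_zero]
  · rintro ⟨r, hr⟩
    refine ⟨fun _ => r, (hφ L hL (x, r) _ ⟨rep_push h _, ?_⟩).2 hr⟩
    change (consArr (fun _ => r) ρ ∘ pushRen) (2 * 0) 0 = r
    rw [push_zero]

lemma DefPred.exArr {P : ℕ → γ → Arr → Prop} (hP : DefPred (fun L (p : γ × Arr) => P L p.1 p.2)) :
    DefPred (fun L x => ∃ a, P L x a) := by
  obtain ⟨φ, hφ⟩ := hP
  refine ⟨Sch.ex (φ.rename pushRen), fun L hL x ρ h => ?_⟩
  simp only [Sch.sat, Sch.sat_rename]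
  refine exists_congr fun a => hφ L hL (x, a) _ ⟨rep_push h a, ?_⟩
  intro i _
  change (consArr a ρ ∘ pushRen) (2 * 0) i = a i
  rw [push_zero]

lemma DefPred.allArr {P : ℕ → γ → Arr → Prop} (hP : DefPred (fun L (p : γ × Arr) => P L p.1 p.2)) :
    DefPred (fun L x => ∀ a, P L x a) :=
  (DefPred.exArr (P := fun L x r => ¬ P L x r) hP.not).not.congr fun L _ x => by
    push Not; rfl

lemma defPred_real_le : DefPred (fun _ (p : ℝ × ℝ) => p.1 ≤ p.2) :=
  ⟨Sch.le (RTerm.var 1) (RTerm.var 0), fun L _ p ρ h => by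
    have h1 : ρ 1 0 = p.1 := h.1
    have h2 : ρ 0 0 = p.2 := h.2
    simp only [Sch.sat, RTerm.eval, h1, h2]⟩

lemma DefFun.var : DefFun (fun _ (x : ℝ) => x) :=
  ((defPred_real_le.comp (g := fun p : ℝ × ℝ => (p.1, p.2)) (by fun_prop)).and
    (defPred_real_le.comp (g := fun p : ℝ × ℝ => (p.2, p.1)) (by fun_prop))).congr
    fun L _ p => by simp only; rw [← le_antisymm_iff]; exact eq_comm

lemma DefFun.real {f : γ → ℝ} (hf : CtxMap f) : DefFun (fun _ x => f x) := DefFun.var.comp hf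

lemma DefFun.nat {f : γ → ℕ} (hf : CtxMap f) : DefFun (fun _ x => (f x : ℝ)) := by
  have h : DefFun (fun _ (n : ℕ) => (n : ℝ)) :=
    ⟨Sch.and (Sch.le (RTerm.var 0) (RTerm.var 1)) (Sch.le (RTerm.var 1) (RTerm.var 0)),
      fun L _ p ρ h => by
        have h1 : ρ 1 0 = (p.1 : ℝ) := h.1
        have h2 : ρ 0 0 = p.2 := h.2
        simp only [Sch.sat, RTerm.eval, h1, h2]
        exact le_antisymm_iff.symm⟩
  exact h.comp hf

/-- A predicate applied to the value of a definable function. -/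
lemma DefPred.subst {P : ℕ → γ → ℝ → Prop} (hP : DefPred (fun L (p : γ × ℝ) => P L p.1 p.2))
    {f : ℕ → γ → ℝ} (hf : DefFun f) : DefPred (fun L x => P L x (f L x)) :=
  (DefPred.exReal (P := fun L x r => r = f L x ∧ P L x r) (hf.and hP)).congr
    fun L _ x => by simp

lemma DefPred.le {f g : ℕ → γ → ℝ} (hf : DefFun f) (hg : DefFun g) :
    DefPred (fun L x => f L x ≤ g L x) := by
  have h1 : DefPred (fun L (p : γ × ℝ) => f L p.1 ≤ p.2) :=
    DefPred.subst (P := fun L (p : γ × ℝ) r => r ≤ p.2)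
      (defPred_real_le.comp (g := fun p : (γ × ℝ) × ℝ => (p.2, p.1.2)) (by fun_prop))
      (hf.comp (g := fun p : γ × ℝ => p.1) (by fun_prop))
  exact DefPred.subst (P := fun L x r => f L x ≤ r) h1 hg

lemma DefPred.lt {f g : ℕ → γ → ℝ} (hf : DefFun f) (hg : DefFun g) :
    DefPred (fun L x => f L x < g L x) :=
  (DefPred.le hg hf).not.congr fun _ _ _ => not_le

lemma DefPred.eq {f g : ℕ → γ → ℝ} (hf : DefFun f) (hg : DefFun g) :
    DefPred (fun L x => f L x = g L x) :=
  ((DefPred.le hf hg).and (DefPred.le hg hf)).congr fun _ _ _ => le_antisymm_iff.symm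

lemma DefPred.natLt {f g : ℕ → γ → ℕ} (hf : DefFun (fun L x => (f L x : ℝ)))
    (hg : DefFun (fun L x => (g L x : ℝ))) : DefPred (fun L x => f L x < g L x) :=
  (DefPred.lt hf hg).congr fun _ _ _ => Nat.cast_lt

lemma DefPred.natEq {f g : ℕ → γ → ℕ} (hf : DefFun (fun L x => (f L x : ℝ)))
    (hg : DefFun (fun L x => (g L x : ℝ))) : DefPred (fun L x => f L x = g L x) :=
  (DefPred.eq hf hg).congr fun _ _ _ => Nat.cast_inj

lemma DefFun.congr {f g : ℕ → γ → ℝ} (hf : DefFun f) (h : ∀ L, 0 < L → ∀ x, f L x = g L x) :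
    DefFun g :=
  DefPred.congr hf fun L hL p => by rw [h L hL p.1]

/-- Function application to definable arguments. -/
lemma DefFun.subst {F : ℝ → ℝ → ℝ} (hF : DefPred (fun _ (p : (ℝ × ℝ) × ℝ) => p.2 = F p.1.1 p.1.2))
    {f g : ℕ → γ → ℝ} (hf : DefFun f) (hg : DefFun g) : DefFun (fun L x => F (f L x) (g L x)) := by
  have h1 : DefPred (fun L (p : (γ × ℝ) × ℝ) => p.1.2 = F (f L p.1.1) p.2) :=
    DefPred.subst (P := fun L (p : (γ × ℝ) × ℝ) r => p.1.2 = F r p.2)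
      (hF.comp (g := fun p : ((γ × ℝ) × ℝ) × ℝ => ((p.2, p.1.2), p.1.1.2)) (by fun_prop))
      (hf.comp (g := fun p : (γ × ℝ) × ℝ => p.1.1) (by fun_prop))
  exact DefPred.subst (P := fun L (p : γ × ℝ) r => p.2 = F (f L p.1) r) h1
    (hg.comp (g := fun p : γ × ℝ => p.1) (by fun_prop))

lemma DefFun.add {f g : ℕ → γ → ℝ} (hf : DefFun f) (hg : DefFun g) :
    DefFun (fun L x => f L x + g L x) := by
  refine DefFun.subst (F := fun a b => a + b) ⟨Sch.and
    (Sch.le (RTerm.var 0) (RTerm.add (RTerm.var 3) (RTerm.var 1)))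
    (Sch.le (RTerm.add (RTerm.var 3) (RTerm.var 1)) (RTerm.var 0)), fun L _ p ρ h => ?_⟩ hf hg
  have h1 : ρ 3 0 = p.1.1 := h.1.1
  have h2 : ρ 1 0 = p.1.2 := h.1.2
  have h3 : ρ 0 0 = p.2 := h.2
  simp only [Sch.sat, RTerm.eval, h1, h2, h3]
  exact le_antisymm_iff.symm

lemma DefFun.mul {f g : ℕ → γ → ℝ} (hf : DefFun f) (hg : DefFun g) :
    DefFun (fun L x => f L x * g L x) := by
  refine DefFun.subst (F := fun a b => a * b) ⟨Sch.and
    (Sch.le (RTerm.var 0) (RTerm.mul (RTerm.var 3) (RTerm.var 1)))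
    (Sch.le (RTerm.mul (RTerm.var 3) (RTerm.var 1)) (RTerm.var 0)), fun L _ p ρ h => ?_⟩ hf hg
  have h1 : ρ 3 0 = p.1.1 := h.1.1
  have h2 : ρ 1 0 = p.1.2 := h.1.2
  have h3 : ρ 0 0 = p.2 := h.2
  simp only [Sch.sat, RTerm.eval, h1, h2, h3]
  exact le_antisymm_iff.symm

lemma DefFun.zero : DefFun (fun _ (_ : γ) => (0 : ℝ)) :=
  ⟨Sch.and (Sch.le (RTerm.var 0) RTerm.zero) (Sch.le RTerm.zero (RTerm.var 0)),
    fun L _ p ρ h => by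
      have h2 : ρ 0 0 = p.2 := h.2
      simp only [Sch.sat, RTerm.eval, h2]
      exact le_antisymm_iff.symm⟩

lemma DefFun.one : DefFun (fun _ (_ : γ) => (1 : ℝ)) :=
  ⟨Sch.and (Sch.le (RTerm.var 0) RTerm.one) (Sch.le RTerm.one (RTerm.var 0)),
    fun L _ p ρ h => by
      have h2 : ρ 0 0 = p.2 := h.2
      simp only [Sch.sat, RTerm.eval, h2]
      exact le_antisymm_iff.symm⟩

lemma DefFun.natConst (m : ℕ) : DefFun (fun _ (_ : γ) => (m : ℝ)) := by
  induction m with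
  | zero => exact DefFun.zero.congr fun _ _ _ => by simp
  | succ m ih => exact (ih.add DefFun.one).congr fun _ _ _ => by simp

/-- Natural-number-valued functions with a definable graph. -/
def DefNat (f : ℕ → γ → ℕ) : Prop := DefFun (fun L x => (f L x : ℝ))

lemma DefNat.var {f : γ → ℕ} (hf : CtxMap f) : DefNat (fun _ x => f x) := DefFun.nat hf

lemma DefNat.const (m : ℕ) : DefNat (fun _ (_ : γ) => m) := DefFun.natConst m

lemma DefNat.add {f g : ℕ → γ → ℕ} (hf : DefNat f) (hg : DefNat g) :
    DefNat (fun L x => f L x + g L x) :=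
  (DefFun.add hf hg).congr fun _ _ _ => by push_cast; rfl

lemma DefNat.mul {f g : ℕ → γ → ℕ} (hf : DefNat f) (hg : DefNat g) :
    DefNat (fun L x => f L x * g L x) :=
  (DefFun.mul hf hg).congr fun _ _ _ => by push_cast; rfl

lemma DefNat.comp {f : ℕ → δ → ℕ} (hf : DefNat f) {g : γ → δ} (hg : CtxMap g) :
    DefNat (fun L x => f L (g x)) := DefFun.comp (f := fun L x => (f L x : ℝ)) hf hg

lemma DefNat.pair {f g : ℕ → γ → ℕ} (hf : DefNat f) (hg : DefNat g) :
    DefNat (fun L x => Nat.pair (f L x) (g L x)) := by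
  have hf' : DefNat (fun L (p : γ × ℝ) => f L p.1) := hf.comp (by fun_prop)
  have hg' : DefNat (fun L (p : γ × ℝ) => g L p.1) := hg.comp (by fun_prop)
  have hv : DefFun (fun _ (p : γ × ℝ) => p.2) := DefFun.real (by fun_prop)
  refine (((DefPred.natLt hf' hg').and (DefPred.eq hv ((hg'.mul hg').add hf'))).or
    ((DefPred.natLt hf' hg').not.and
      (DefPred.eq hv (((hf'.mul hf').add hf').add hg')))).congr fun L _ p => ?_
  by_cases h : f L p.1 < g L p.1 <;> simp [Nat.pair, h]

/-- Bounded access to the entries of an array. -/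
noncomputable def acc (L : ℕ) (a : Arr) (i : ℕ) : ℝ := if i < L then a i else 0

lemma acc_of_lt {L i : ℕ} (h : i < L) (a : Arr) : acc L a i = a i := if_pos h

lemma DefFun.acc {a : γ → Arr} (ha : CtxMap a) {i : ℕ → γ → ℕ} (hi : DefNat i) :
    DefFun (fun L x => acc L (a x) (i L x)) := by
  have h0 : DefPred (fun L (q : (Arr × ℝ) × ℝ) => ∃ j < L, q.1.2 = (j : ℝ) ∧ q.2 = q.1.1 j) :=
    ⟨Sch.sel 3 1 0, fun L _ q ρ h => by
      have h1 : ρ 1 0 = q.1.2 := h.1.2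
      have h2 : ρ 0 0 = q.2 := h.2
      have h3 : ∀ j < L, ρ 3 j = q.1.1 j := h.1.1
      simp only [Sch.sat, h1, h2]
      refine exists_congr fun j => and_congr_right fun hj => ?_
      rw [h3 j hj]⟩
  have h1 : DefPred (fun L (p : γ × ℝ) => ∃ j < L, (i L p.1 : ℝ) = (j : ℝ) ∧ p.2 = a p.1 j) :=
    DefPred.subst (P := fun L (p : γ × ℝ) r => ∃ j < L, r = (j : ℝ) ∧ p.2 = a p.1 j)
      (h0.comp (g := fun p : (γ × ℝ) × ℝ => ((a p.1.1, p.2), p.1.2)) (by fun_prop))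
      (DefFun.comp (f := fun L x => (i L x : ℝ)) hi (g := fun p : γ × ℝ => p.1) (by fun_prop))
  have h2 : DefPred (fun L (p : γ × ℝ) => ∃ y, ∃ j < L, (i L p.1 : ℝ) = (j : ℝ) ∧ y = a p.1 j) :=
    DefPred.exReal (P := fun L (p : γ × ℝ) y => ∃ j < L, (i L p.1 : ℝ) = (j : ℝ) ∧ y = a p.1 j)
      (h1.comp (g := fun p : (γ × ℝ) × ℝ => (p.1.1, p.2)) (by fun_prop))
  refine (h1.or (h2.not.and (DefPred.eq (DefFun.real (f := fun p : γ × ℝ => p.2) (by fun_prop))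
    DefFun.zero))).congr fun L _ p => ?_
  by_cases h : i L p.1 < L
  · simp [NCRSPPaper.acc, h]
  · have : ∀ j, j < L → i L p.1 ≠ j := fun j hj e => h (e ▸ hj)
    simp [NCRSPPaper.acc, h]

/-- Quantification over natural numbers from a definable set. -/
lemma DefPred.exNatOf {D : ℕ → ℕ → Prop} (hD : DefPred (fun L (r : ℝ) => ∃ m : ℕ, D L m ∧ r = m))
    {P : ℕ → γ → ℕ → Prop} (hP : DefPred (fun L (p : γ × ℕ) => P L p.1 p.2)) :
    DefPred (fun L x => ∃ m, D L m ∧ P L x m) := by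
  obtain ⟨φ, hφ⟩ := hP
  obtain ⟨χ, hχ⟩ := hD.comp (g := fun p : γ × ℝ => p.2) (by fun_prop)
  have h : DefPred (fun L (p : γ × ℝ) => ∃ m : ℕ, D L m ∧ p.2 = m ∧ P L p.1 m) := by
    refine ⟨Sch.and χ φ, fun L hL p ρ h => ?_⟩
    simp only [Sch.sat, hχ L hL p ρ h]
    have hm : ∀ m : ℕ, p.2 = m → Ctx.Rep L (p.1, m) ρ :=
      fun m e => ⟨h.1, show ρ 0 0 = m by rw [← e]; exact h.2⟩
    constructor
    · rintro ⟨⟨m, h1, h2⟩, h3⟩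
      exact ⟨m, h1, h2, (hφ L hL _ _ (hm m h2)).1 h3⟩
    · rintro ⟨m, h1, h2, h3⟩
      exact ⟨⟨m, h1, h2⟩, (hφ L hL _ _ (hm m h2)).2 h3⟩
  refine (DefPred.exReal (P := fun L x r => ∃ m : ℕ, D L m ∧ r = m ∧ P L x m) h).congr
    fun L _ x => ?_
  constructor
  · rintro ⟨_, m, h1, _, h2⟩
    exact ⟨m, h1, h2⟩
  · rintro ⟨m, h1, h2⟩
    exact ⟨m, m, h1, rfl, h2⟩

lemma DefPred.exIdx {P : ℕ → γ → ℕ → Prop} (hP : DefPred (fun L (p : γ × ℕ) => P L p.1 p.2)) :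
    DefPred (fun L x => ∃ m, m < L ∧ P L x m) := by
  refine DefPred.exNatOf (D := fun L m => m < L) ⟨Sch.ex (Sch.sel 1 1 0), fun L _ r ρ h => ?_⟩ hP
  have h0 : ρ 0 0 = r := h
  simp only [Sch.sat, consArr, h0]
  constructor
  · rintro ⟨_, m, h1, h2, _⟩
    exact ⟨m, h1, h2⟩
  · rintro ⟨m, h1, h2⟩
    exact ⟨fun _ => ρ 0 m, m, h1, h2, rfl⟩

lemma DefPred.allIdx {P : ℕ → γ → ℕ → Prop} (hP : DefPred (fun L (p : γ × ℕ) => P L p.1 p.2)) :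
    DefPred (fun L x => ∀ m, m < L → P L x m) :=
  (DefPred.exIdx (P := fun L x m => ¬ P L x m) hP.not).not.congr fun L _ x => by
    push Not; rfl

/-- Numbers with at most `L` binary digits, through the array of their leading segments. -/
lemma exists_lt_two_pow_iff {L : ℕ} (hL : 0 < L) (r : ℝ) : (∃ m : ℕ, m < 2 ^ L ∧ r = m) ↔
    ∃ H : Arr, (acc L H 0 = 0 ∨ acc L H 0 = 1) ∧
      (∀ i, i < L → i + 1 < L → acc L H (i + 1) = acc L H i + acc L H i ∨
        acc L H (i + 1) = acc L H i + acc L H i + 1) ∧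
      ∃ i, i < L ∧ ¬ i + 1 < L ∧ r = acc L H i := by
  constructor
  · rintro ⟨m, hm, rfl⟩
    refine ⟨fun i => ((m / 2 ^ (L - 1 - i) : ℕ) : ℝ), ?_, ?_, L - 1, by omega, by omega, ?_⟩
    · have h1 : m / 2 ^ (L - 1 - 0) < 2 := by
        rw [Nat.div_lt_iff_lt_mul (by positivity), ← pow_succ']
        simpa [show L - 1 + 1 = L by omega] using hm
      rw [acc_of_lt hL]
      rcases Nat.lt_succ_iff_lt_or_eq.1 h1 with h | h
      · left; simp only [Nat.lt_one_iff.1 h, Nat.cast_zero]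
      · right; simp only [h, Nat.cast_one]
    · intro i hi hi'
      rw [acc_of_lt hi, acc_of_lt hi']
      have h1 : m / 2 ^ (L - 1 - i) = m / 2 ^ (L - 1 - (i + 1)) / 2 := by
        rw [Nat.div_div_eq_div_mul, ← pow_succ]
        congr 2; omega
      simp only [h1]
      generalize m / 2 ^ (L - 1 - (i + 1)) = y
      rcases Nat.mod_two_eq_zero_or_one y with h | h
      · left
        have : y = y / 2 + y / 2 := by omega
        exact_mod_cast this
      · right
        have : y = y / 2 + y / 2 + 1 := by omega
        exact_mod_cast this
    · rw [acc_of_lt (by omega)]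
      simp
  · rintro ⟨H, h0, h1, i, hi, -, rfl⟩
    suffices h : ∀ i, i < L → ∃ m : ℕ, m < 2 ^ (i + 1) ∧ acc L H i = m by
      obtain ⟨m, hm, e⟩ := h i hi
      exact ⟨m, hm.trans_le (Nat.pow_le_pow_right (by norm_num) hi), e⟩
    intro i
    induction i with
    | zero =>
      intro _
      rcases h0 with h | h
      · exact ⟨0, by norm_num, by simpa using h⟩
      · exact ⟨1, by norm_num, by simpa using h⟩
    | succ i ih =>
      intro hi'
      obtain ⟨m, hm, e⟩ := ih (by omega)
      rcases h1 i (by omega) hi' with h | h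
      · exact ⟨m + m, by rw [pow_succ]; omega, by rw [h, e]; push_cast; rfl⟩
      · exact ⟨m + m + 1, by rw [pow_succ]; omega, by rw [h, e]; push_cast; rfl⟩

lemma DefNat.len : DefNat (fun L (_ : γ) => L) := by
  have h : DefPred (fun L (p : γ × ℝ) => ∃ i, i < L ∧ (¬ ∃ j, j < L ∧ i + 1 = j) ∧
      p.2 = ((i + 1 : ℕ) : ℝ)) :=
    DefPred.exIdx (P := fun L (p : γ × ℝ) i => (¬ ∃ j, j < L ∧ i + 1 = j) ∧
      p.2 = ((i + 1 : ℕ) : ℝ))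
      ((DefPred.exIdx (P := fun _ (p : (γ × ℝ) × ℕ) j => p.2 + 1 = j)
        (DefPred.natEq ((DefNat.var (by fun_prop)).add (DefNat.const 1))
          (DefNat.var (by fun_prop)))).not.and
        (DefPred.eq (DefFun.real (f := fun p : (γ × ℝ) × ℕ => p.1.2) (by fun_prop))
          ((DefNat.var (by fun_prop)).add (DefNat.const 1))))
  refine h.congr fun L hL p => ?_
  constructor
  · rintro ⟨i, h1, h2, h3⟩
    have : i + 1 = L := by
      by_contra hne
      exact h2 ⟨i + 1, by omega, rfl⟩
    rw [h3, this]
  · intro e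
    refine ⟨L - 1, by omega, ?_, ?_⟩
    · rintro ⟨j, h1, h2⟩; omega
    · rw [e, Nat.sub_add_cancel hL]

lemma DefPred.exBig {P : ℕ → γ → ℕ → Prop} (hP : DefPred (fun L (p : γ × ℕ) => P L p.1 p.2)) :
    DefPred (fun L x => ∃ m, m < 2 ^ L ∧ P L x m) := by
  refine DefPred.exNatOf (D := fun L m => m < 2 ^ L) (DefPred.congr ?_ fun L hL r =>
    (exists_lt_two_pow_iff hL r).symm) hP
  have hs : ∀ {γ : Type} [Ctx γ] {H : γ → Arr} (_ : CtxMap H) {i : ℕ → γ → ℕ} (_ : DefNat i),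
      DefFun (fun L x => NCRSPPaper.acc L (H x) (i L x)) := fun h1 _ h2 => DefFun.acc h1 h2
  refine DefPred.exArr ?_
  refine DefPred.and (DefPred.or (DefPred.eq (hs (by fun_prop) (DefNat.const 0)) DefFun.zero)
    (DefPred.eq (hs (by fun_prop) (DefNat.const 0)) DefFun.one)) (DefPred.and
    (DefPred.allIdx (DefPred.imp (DefPred.natLt ((DefNat.var (by fun_prop)).add (DefNat.const 1))
      DefNat.len) ?_)) (DefPred.exIdx (DefPred.and
      (DefPred.natLt ((DefNat.var (by fun_prop)).add (DefNat.const 1)) DefNat.len).not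
      (DefPred.eq (DefFun.real (by fun_prop)) (hs (by fun_prop) (DefNat.var (by fun_prop)))))))
  have h1 : DefFun (fun L (p : (ℝ × Arr) × ℕ) => NCRSPPaper.acc L p.1.2 p.2) :=
    hs (by fun_prop) (DefNat.var (by fun_prop))
  have h2 : DefFun (fun L (p : (ℝ × Arr) × ℕ) => NCRSPPaper.acc L p.1.2 (p.2 + 1)) :=
    hs (by fun_prop) ((DefNat.var (by fun_prop)).add (DefNat.const 1))
  exact (DefPred.eq h2 (h1.add h1)).or (DefPred.eq h2 ((h1.add h1).add DefFun.one))

/-- Sums with an index bound. -/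
noncomputable def bsum (L n : ℕ) (f : ℕ → ℝ) : ℝ :=
  if n < L then ∑ v ∈ Finset.range n, f v else 0

lemma DefFun.bsum {n : ℕ → γ → ℕ} (hn : DefNat n) {f : ℕ → γ → ℕ → ℝ}
    (hf : DefFun (fun L (p : γ × ℕ) => f L p.1 p.2)) :
    DefFun (fun L x => bsum L (n L x) (f L x)) := by
  have hn1 : DefNat (fun L (p : γ × ℝ) => n L p.1) := hn.comp (by fun_prop)
  have h : DefPred (fun L (p : γ × ℝ) => ∃ T : Arr, NCRSPPaper.acc L T 0 = 0 ∧
      (∀ i, i < L → i < n L p.1 → NCRSPPaper.acc L T (i + 1) =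
        NCRSPPaper.acc L T i + f L p.1 i) ∧ p.2 = NCRSPPaper.acc L T (n L p.1)) := by
    refine DefPred.exArr (DefPred.and (DefPred.eq (DefFun.acc (by fun_prop) (DefNat.const 0))
      DefFun.zero) (DefPred.and (DefPred.allIdx (DefPred.imp (DefPred.natLt
        (DefNat.var (by fun_prop)) (hn.comp (g := fun p : ((γ × ℝ) × Arr) × ℕ => p.1.1.1)
        (by fun_prop))) (DefPred.eq (DefFun.acc (by fun_prop) ((DefNat.var (by fun_prop)).add
        (DefNat.const 1))) (DefFun.add (DefFun.acc (by fun_prop) (DefNat.var (by fun_prop)))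
        (hf.comp (g := fun p : ((γ × ℝ) × Arr) × ℕ => (p.1.1.1, p.2)) (by fun_prop))))))
      (DefPred.eq (DefFun.real (by fun_prop)) (DefFun.acc (by fun_prop)
        (hn.comp (g := fun p : (γ × ℝ) × Arr => p.1.1) (by fun_prop))))))
  refine (((DefPred.natLt hn1 DefNat.len).and h).or ((DefPred.natLt hn1 DefNat.len).not.and
    (DefPred.eq (DefFun.real (f := fun p : γ × ℝ => p.2) (by fun_prop)) DefFun.zero))).congr
    fun L hL p => ?_
  by_cases hlt : n L p.1 < L
  · simp only [hlt, NCRSPPaper.bsum, if_true, true_and, not_true, false_and, or_false]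
    constructor
    · rintro ⟨T, h0, h1, h2⟩
      rw [h2]
      suffices ∀ m, m ≤ n L p.1 → NCRSPPaper.acc L T m = ∑ v ∈ Finset.range m, f L p.1 v from
        this _ le_rfl
      intro m
      induction m with
      | zero => intro _; simpa using h0
      | succ m ih =>
        intro hm
        rw [Finset.sum_range_succ, ← ih (by omega), h1 m (by omega) (by omega)]
    · intro e
      refine ⟨fun m => ∑ v ∈ Finset.range m, f L p.1 v, ?_, fun i hi hi' => ?_, ?_⟩
      · rw [acc_of_lt hL]; simp
      · rw [acc_of_lt hi, acc_of_lt (by omega), Finset.sum_range_succ]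
      · rw [acc_of_lt hlt, e]
  · simp [hlt, NCRSPPaper.bsum]

end Definability

/-! ### The arithmetized decision problem -/

/-- The array segment of length `n` at offset `o` lists the list coded by `l`. -/
def IsListCode (L : ℕ) (l : ℕ) (a : Arr) (o n : ℕ) : Prop :=
  ∃ T : Arr, acc L T 0 = (l : ℝ) ∧ acc L T n = 0 ∧ ∀ i, i < L → i < n →
    ∃ h : ℕ, h < 2 ^ L ∧ ∃ t : ℕ, t < 2 ^ L ∧
      acc L a (o + i) = (h : ℝ) ∧ acc L T (i + 1) = (t : ℝ) ∧
      acc L T i = ((Nat.pair h t + 1 : ℕ) : ℝ)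

/-- The number `x` is the rational number coded by `q`. -/
def IsRatCode (L : ℕ) (q x : ℝ) : Prop :=
  ∃ z : ℕ, z < 2 ^ L ∧ ∃ d : ℕ, d < 2 ^ L ∧ q = (Nat.pair z d : ℕ) ∧ ∃ h : ℕ, h < 2 ^ L ∧
    ((z = h + h ∧ x * (d : ℝ) = (h : ℝ)) ∨ (z = h + h + 1 ∧ x * (d : ℝ) + (h + 1 : ℕ) = 0))

/-- The formula coded by `c` has truth value `b` under the valuation given by `E`. -/
def TruthCode (L : ℕ) (E : Arr) (c : ℕ) (b : ℝ) : Prop :=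
  ∃ C V : Arr, acc L C 0 = (c : ℝ) ∧ acc L V 0 = b ∧ ∀ j, j < L →
    ∃ t : ℕ, t < 2 ^ L ∧ ∃ x : ℕ, x < 2 ^ L ∧ acc L C j = (Nat.pair t x : ℕ) ∧
    ((t = 0 ∧ acc L V j = 1) ∨ (t = 1 ∧ acc L V j = 0) ∨
     (t = 2 ∧ ((acc L E x = 1 ∧ acc L V j = 1) ∨ (¬ acc L E x = 1 ∧ acc L V j = 0))) ∨
     (t = 3 ∧ ∃ i : ℕ, i < L ∧ acc L C i = (x : ℝ) ∧ acc L V j + acc L V i = 1) ∨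
     (∃ y : ℕ, y < 2 ^ L ∧ ∃ z : ℕ, z < 2 ^ L ∧ x = Nat.pair y z ∧
        ∃ i : ℕ, i < L ∧ ∃ i' : ℕ, i' < L ∧
        acc L C i = (y : ℝ) ∧ acc L C i' = (z : ℝ) ∧
        ((t = 4 ∧ acc L V j = acc L V i * acc L V i') ∨
         (t = 5 ∧ acc L V j + acc L V i * acc L V i' = acc L V i + acc L V i'))))

/-- Steps inside the Markov decision process controlled by the player with code `w`. -/
def ArrStep (L n w : ℕ) (own ed P : Arr) (a b : ℕ) : Prop :=
  (acc L own a = (w : ℝ) ∧ acc L ed (a * n + b) = 1) ∨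
  (¬ acc L own a = (w : ℝ) ∧ 0 < acc L P (a * n + b))

/-- End components given by an array. -/
def ArrEC (L n w : ℕ) (own ed P E : Arr) : Prop :=
  (∃ a : ℕ, a < L ∧ a < n ∧ acc L E a = 1) ∧
  (∀ T : Arr, (∃ a : ℕ, a < L ∧ a < n ∧ acc L T a = 1 ∧ acc L E a = 1) →
    (∀ a, a < L → a < n → ∀ b, b < L → b < n → acc L T a = 1 → acc L E a = 1 → acc L E b = 1 →
      ArrStep L n w own ed P a b → acc L T b = 1) →
    ∀ a, a < L → a < n → acc L E a = 1 → acc L T a = 1) ∧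
  (∀ a, a < L → a < n → ∀ b, b < L → b < n → acc L E a = 1 → ¬ acc L own a = (w : ℝ) →
    0 < acc L P (a * n + b) → acc L E b = 1) ∧
  (∀ a, a < L → a < n → acc L E a = 1 → acc L own a = (w : ℝ) →
    ∃ b : ℕ, b < L ∧ b < n ∧ acc L E b = 1 ∧ acc L ed (a * n + b) = 1)

/-- Certificates given by an array. -/
def ArrCert (L n w : ℕ) (own ed P : Arr) (c : ℕ) (b : ℝ) (r : Arr) : Prop :=
  (∀ u, u < L → u < n → 0 ≤ acc L r u) ∧
  (∀ u, u < L → u < n → ¬ acc L own u = (w : ℝ) →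
    bsum L n (fun v => acc L P (u * n + v) * acc L r v) ≤ acc L r u) ∧
  (∀ u, u < L → u < n → ∀ v, v < L → v < n → acc L own u = (w : ℝ) →
    acc L ed (u * n + v) = 1 → acc L r v ≤ acc L r u) ∧
  ∀ E : Arr, ArrEC L n w own ed P E → TruthCode L E c b → ∀ u, u < L → u < n →
    acc L E u = 1 → 1 ≤ acc L r u

/-- Transition matrices given by an array. -/
def ArrTrans (L n : ℕ) (own ed pr P : Arr) : Prop :=
  (∀ u, u < L → u < n → ∀ v, v < L → v < n → 0 ≤ acc L P (u * n + v)) ∧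
  (∀ u, u < L → u < n → bsum L n (fun v => acc L P (u * n + v)) = 1) ∧
  (∀ u, u < L → u < n → acc L own u = 0 → ∀ v, v < L → v < n →
    acc L P (u * n + v) = acc L pr (u * n + v)) ∧
  (∀ u, u < L → u < n → ∀ v, v < L → v < n → ¬ acc L own u = 0 → 0 < acc L P (u * n + v) →
    acc L ed (u * n + v) = 1)

/-- The decision problem for an arena and formulas given by arrays. -/
def ArrAnswer (L k n s : ℕ) (own ed pr ob : Arr) (μ : ℝ) : Prop :=
  ∃ w : ℕ, w < L ∧ w = k + 2 ∧ ∃ x : Arr, ArrTrans L n own ed pr x ∧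
    ∀ P : Arr, ArrTrans L n own ed pr P →
    (∀ u, u < L → u < n → acc L own u = 1 → ∀ v, v < L → v < n →
      acc L P (u * n + v) = acc L x (u * n + v)) →
    (∀ i, i < L → i < k + 1 → ¬ i = 0 → ∃ j : ℕ, j < L ∧ j = i + 1 ∧ ∃ c : ℕ, c < 2 ^ L ∧
      acc L ob i = (c : ℝ) ∧ ∃ r r' : Arr, ArrCert L n j own ed P c 1 r ∧
        ArrCert L n w own ed P c 0 r' ∧ acc L r s + acc L r' s ≤ 1) →
    ∃ c : ℕ, c < 2 ^ L ∧ acc L ob 0 = (c : ℝ) ∧ ∃ r : Arr, ArrCert L n w own ed P c 0 r ∧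
      acc L r s + μ ≤ 1

/-- The decision problem for the instance coded by `N`. -/
def CodeAnswer (L N : ℕ) : Prop :=
  ∃ k : ℕ, k < 2 ^ L ∧ ∃ n : ℕ, n < 2 ^ L ∧ ∃ lo : ℕ, lo < 2 ^ L ∧ ∃ le : ℕ, le < 2 ^ L ∧
  ∃ lp : ℕ, lp < 2 ^ L ∧
  ∃ s : ℕ, s < 2 ^ L ∧ ∃ lf : ℕ, lf < 2 ^ L ∧ ∃ lm : ℕ, lm < 2 ^ L ∧
  N = Nat.pair (Nat.pair k (Nat.pair n (Nat.pair lo (Nat.pair le (Nat.pair lp s)))))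
    (Nat.pair lf lm) ∧
  ∃ own ed pr ob : Arr, ∃ μ : ℝ, IsListCode L lo own 0 n ∧ IsListCode L lf ob 0 (k + 1) ∧
    IsRatCode L (lm : ℝ) μ ∧
    (∃ R : Arr, IsListCode L le R 0 n ∧ ∀ u, u < L → u < n → ∃ c : ℕ, c < 2 ^ L ∧
      acc L R u = (c : ℝ) ∧ IsListCode L c ed (u * n) n) ∧
    (∃ R Q : Arr, IsListCode L lp R 0 n ∧ ∀ u, u < L → u < n → ∃ c : ℕ, c < 2 ^ L ∧
      acc L R u = (c : ℝ) ∧ IsListCode L c Q (u * n) n ∧ ∀ v, v < L → v < n →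
        IsRatCode L (acc L Q (u * n + v)) (acc L pr (u * n + v))) ∧
    ArrAnswer L k n s own ed pr ob μ

section Definability

variable {γ : Type} [Ctx γ]

lemma DefFun.ofNat {f : ℕ → γ → ℕ} (hf : DefNat f) : DefFun (fun L x => (f L x : ℝ)) := hf

/-- A predicate applied to the value of a definable natural-number-valued function. -/
lemma DefPred.natSubst {P : ℕ → γ → ℕ → Prop} (hP : DefPred (fun L (p : γ × ℕ) => P L p.1 p.2))
    {f : ℕ → γ → ℕ} (hf : DefNat f) : DefPred (fun L x => P L x (f L x)) := by
  obtain ⟨φ, hφ⟩ := hP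
  obtain ⟨χ, hχ⟩ := hf
  have h : DefPred (fun L (p : γ × ℝ) => p.2 = f L p.1 ∧ P L p.1 (f L p.1)) := by
    refine ⟨Sch.and χ φ, fun L hL p ρ h => ?_⟩
    simp only [Sch.sat, hχ L hL p ρ h]
    refine and_congr_right fun e => hφ L hL (p.1, f L p.1) ρ ⟨h.1, ?_⟩
    change ρ 0 0 = _
    rw [← e]
    exact h.2
  exact (DefPred.exReal (P := fun L x r => r = f L x ∧ P L x (f L x)) h).congr
    fun L _ x => by simp

lemma defPred_isListCode_aux {l : γ → ℕ} {a : γ → Arr} {o : γ → ℕ} {n : γ → ℕ}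
    (hl : CtxMap l) (ha : CtxMap a) (ho : CtxMap o) (hn : CtxMap n) :
    DefPred (fun L x => IsListCode L (l x) (a x) (o x) (n x)) := by
  unfold IsListCode
  repeat' first
    | with_reducible apply DefPred.and
    | with_reducible apply DefPred.or
    | with_reducible apply DefPred.not
    | with_reducible apply DefPred.exIdx
    | with_reducible apply DefPred.allIdx
    | with_reducible apply DefPred.exBig
    | with_reducible apply DefPred.exArr
    | with_reducible apply DefPred.allArr
    | with_reducible apply DefPred.exReal
    | with_reducible apply DefPred.imp
    | with_reducible apply DefPred.natLt
    | with_reducible apply DefPred.natEq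
    | with_reducible apply DefPred.eq
    | with_reducible apply DefPred.le
    | with_reducible apply DefPred.lt
    | with_reducible apply DefFun.zero
    | with_reducible apply DefFun.one
    | with_reducible apply DefFun.acc
    | with_reducible apply DefFun.ofNat
    | with_reducible apply DefNat.const
    | with_reducible apply DefNat.len
    | with_reducible apply DefNat.add
    | with_reducible apply DefNat.mul
    | with_reducible apply DefNat.pair
    | with_reducible apply DefFun.bsum
    | with_reducible apply DefFun.add
    | with_reducible apply DefFun.mul
    | with_reducible apply DefNat.var
    | with_reducible apply DefFun.real
    | fun_prop

lemma defPred_isListCode {l : γ → ℕ} {a : γ → Arr} {o n : ℕ → γ → ℕ} (hl : CtxMap l)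
    (ha : CtxMap a) (ho : DefNat o) (hn : DefNat n) :
    DefPred (fun L x => IsListCode L (l x) (a x) (o L x) (n L x)) :=
  DefPred.natSubst (P := fun L x o => IsListCode L (l x) (a x) o (n L x))
    (DefPred.natSubst (P := fun L (p : γ × ℕ) n => IsListCode L (l p.1) (a p.1) p.2 n)
      (defPred_isListCode_aux (by fun_prop) (by fun_prop) (by fun_prop) (by fun_prop))
      (hn.comp (g := fun p : γ × ℕ => p.1) (by fun_prop))) ho

lemma defPred_isRatCode_aux {q : γ → ℝ} {y : γ → ℝ}
    (hq : CtxMap q) (hy : CtxMap y) :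
    DefPred (fun L x => IsRatCode L (q x) (y x)) := by
  unfold IsRatCode
  repeat' first
    | with_reducible apply DefPred.and
    | with_reducible apply DefPred.or
    | with_reducible apply DefPred.not
    | with_reducible apply DefPred.exIdx
    | with_reducible apply DefPred.allIdx
    | with_reducible apply DefPred.exBig
    | with_reducible apply DefPred.exArr
    | with_reducible apply DefPred.allArr
    | with_reducible apply DefPred.exReal
    | with_reducible apply DefPred.imp
    | with_reducible apply DefPred.natLt
    | with_reducible apply DefPred.natEq
    | with_reducible apply DefPred.eq
    | with_reducible apply DefPred.le
    | with_reducible apply DefPred.lt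
    | with_reducible apply DefFun.zero
    | with_reducible apply DefFun.one
    | with_reducible apply DefFun.acc
    | with_reducible apply DefFun.ofNat
    | with_reducible apply DefNat.const
    | with_reducible apply DefNat.len
    | with_reducible apply DefNat.add
    | with_reducible apply DefNat.mul
    | with_reducible apply DefNat.pair
    | with_reducible apply DefFun.bsum
    | with_reducible apply DefFun.add
    | with_reducible apply DefFun.mul
    | with_reducible apply DefNat.var
    | with_reducible apply DefFun.real
    | fun_prop

lemma defPred_isRatCode {q y : ℕ → γ → ℝ} (hq : DefFun q) (hy : DefFun y) :
    DefPred (fun L x => IsRatCode L (q L x) (y L x)) :=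
  DefPred.subst (P := fun L x r => IsRatCode L r (y L x))
    (DefPred.subst (P := fun L (p : γ × ℝ) r => IsRatCode L p.2 r)
      (defPred_isRatCode_aux (by fun_prop) (by fun_prop))
      (hy.comp (g := fun p : γ × ℝ => p.1) (by fun_prop))) hq

lemma defPred_truthCode_aux {E : γ → Arr} {c : γ → ℕ} {b : γ → ℝ}
    (hE : CtxMap E) (hc : CtxMap c) (hb : CtxMap b) :
    DefPred (fun L x => TruthCode L (E x) (c x) (b x)) := by
  unfold TruthCode
  repeat' first
    | with_reducible apply DefPred.and
    | with_reducible apply DefPred.or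
    | with_reducible apply DefPred.not
    | with_reducible apply DefPred.exIdx
    | with_reducible apply DefPred.allIdx
    | with_reducible apply DefPred.exBig
    | with_reducible apply DefPred.exArr
    | with_reducible apply DefPred.allArr
    | with_reducible apply DefPred.exReal
    | with_reducible apply DefPred.imp
    | with_reducible apply DefPred.natLt
    | with_reducible apply DefPred.natEq
    | with_reducible apply DefPred.eq
    | with_reducible apply DefPred.le
    | with_reducible apply DefPred.lt
    | with_reducible apply DefFun.zero
    | with_reducible apply DefFun.one
    | with_reducible apply DefFun.acc
    | with_reducible apply DefFun.ofNat
    | with_reducible apply DefNat.const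
    | with_reducible apply DefNat.len
    | with_reducible apply DefNat.add
    | with_reducible apply DefNat.mul
    | with_reducible apply DefNat.pair
    | with_reducible apply DefFun.bsum
    | with_reducible apply DefFun.add
    | with_reducible apply DefFun.mul
    | with_reducible apply DefNat.var
    | with_reducible apply DefFun.real
    | fun_prop

lemma defPred_truthCode {E : γ → Arr} {c : γ → ℕ} {b : ℕ → γ → ℝ} (hE : CtxMap E)
    (hc : CtxMap c) (hb : DefFun b) :
    DefPred (fun L x => TruthCode L (E x) (c x) (b L x)) :=
  DefPred.subst (P := fun L x r => TruthCode L (E x) (c x) r)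
    (defPred_truthCode_aux (by fun_prop) (by fun_prop) (by fun_prop)) hb

lemma defPred_arrStep {n : γ → ℕ} {w : γ → ℕ} {own : γ → Arr} {ed : γ → Arr} {P : γ → Arr}
    {a : γ → ℕ} {b : γ → ℕ}
    (hn : CtxMap n) (hw : CtxMap w) (hown : CtxMap own) (hed : CtxMap ed) (hP : CtxMap P)
      (ha : CtxMap a) (hb : CtxMap b) :
    DefPred (fun L x => ArrStep L (n x) (w x) (own x) (ed x) (P x) (a x) (b x)) := by
  unfold ArrStep
  repeat' first
    | with_reducible apply DefPred.and
    | with_reducible apply DefPred.or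
    | with_reducible apply DefPred.not
    | with_reducible apply DefPred.exIdx
    | with_reducible apply DefPred.allIdx
    | with_reducible apply DefPred.exBig
    | with_reducible apply DefPred.exArr
    | with_reducible apply DefPred.allArr
    | with_reducible apply DefPred.exReal
    | with_reducible apply DefPred.imp
    | with_reducible apply DefPred.natLt
    | with_reducible apply DefPred.natEq
    | with_reducible apply DefPred.eq
    | with_reducible apply DefPred.le
    | with_reducible apply DefPred.lt
    | with_reducible apply DefFun.zero
    | with_reducible apply DefFun.one
    | with_reducible apply DefFun.acc
    | with_reducible apply DefFun.ofNat
    | with_reducible apply DefNat.const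
    | with_reducible apply DefNat.len
    | with_reducible apply DefNat.add
    | with_reducible apply DefNat.mul
    | with_reducible apply DefNat.pair
    | with_reducible apply DefFun.bsum
    | with_reducible apply DefFun.add
    | with_reducible apply DefFun.mul
    | with_reducible apply DefNat.var
    | with_reducible apply DefFun.real
    | fun_prop

lemma defPred_arrEC {n : γ → ℕ} {w : γ → ℕ} {own : γ → Arr} {ed : γ → Arr} {P : γ → Arr}
    {E : γ → Arr}
    (hn : CtxMap n) (hw : CtxMap w) (hown : CtxMap own) (hed : CtxMap ed) (hP : CtxMap P)
      (hE : CtxMap E) :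
    DefPred (fun L x => ArrEC L (n x) (w x) (own x) (ed x) (P x) (E x)) := by
  unfold ArrEC
  repeat' first
    | with_reducible apply DefPred.and
    | with_reducible apply DefPred.or
    | with_reducible apply DefPred.not
    | with_reducible apply DefPred.exIdx
    | with_reducible apply DefPred.allIdx
    | with_reducible apply DefPred.exBig
    | with_reducible apply DefPred.exArr
    | with_reducible apply DefPred.allArr
    | with_reducible apply DefPred.exReal
    | with_reducible apply DefPred.imp
    | with_reducible apply DefPred.natLt
    | with_reducible apply DefPred.natEq
    | with_reducible apply DefPred.eq
    | with_reducible apply DefPred.le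
    | with_reducible apply DefPred.lt
    | with_reducible apply defPred_arrStep
    | with_reducible apply DefFun.zero
    | with_reducible apply DefFun.one
    | with_reducible apply DefFun.acc
    | with_reducible apply DefFun.ofNat
    | with_reducible apply DefNat.const
    | with_reducible apply DefNat.len
    | with_reducible apply DefNat.add
    | with_reducible apply DefNat.mul
    | with_reducible apply DefNat.pair
    | with_reducible apply DefFun.bsum
    | with_reducible apply DefFun.add
    | with_reducible apply DefFun.mul
    | with_reducible apply DefNat.var
    | with_reducible apply DefFun.real
    | fun_prop

lemma defPred_arrCert_aux {n : γ → ℕ} {w : γ → ℕ} {own : γ → Arr} {ed : γ → Arr} {P : γ → Arr}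
    {c : γ → ℕ} {b : γ → ℝ} {r : γ → Arr}
    (hn : CtxMap n) (hw : CtxMap w) (hown : CtxMap own) (hed : CtxMap ed) (hP : CtxMap P)
      (hc : CtxMap c) (hb : CtxMap b) (hr : CtxMap r) :
    DefPred (fun L x => ArrCert L (n x) (w x) (own x) (ed x) (P x) (c x) (b x) (r x)) := by
  unfold ArrCert
  repeat' first
    | with_reducible apply DefPred.and
    | with_reducible apply DefPred.or
    | with_reducible apply DefPred.not
    | with_reducible apply DefPred.exIdx
    | with_reducible apply DefPred.allIdx
    | with_reducible apply DefPred.exBig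
    | with_reducible apply DefPred.exArr
    | with_reducible apply DefPred.allArr
    | with_reducible apply DefPred.exReal
    | with_reducible apply DefPred.imp
    | with_reducible apply DefPred.natLt
    | with_reducible apply DefPred.natEq
    | with_reducible apply DefPred.eq
    | with_reducible apply DefPred.le
    | with_reducible apply DefPred.lt
    | with_reducible apply defPred_arrEC
    | with_reducible apply defPred_truthCode
    | with_reducible apply DefFun.zero
    | with_reducible apply DefFun.one
    | with_reducible apply DefFun.acc
    | with_reducible apply DefFun.ofNat
    | with_reducible apply DefNat.const
    | with_reducible apply DefNat.len
    | with_reducible apply DefNat.add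
    | with_reducible apply DefNat.mul
    | with_reducible apply DefNat.pair
    | with_reducible apply DefFun.bsum
    | with_reducible apply DefFun.add
    | with_reducible apply DefFun.mul
    | with_reducible apply DefNat.var
    | with_reducible apply DefFun.real
    | fun_prop

lemma defPred_arrCert {n w : γ → ℕ} {own ed P : γ → Arr} {c : γ → ℕ} {b : ℕ → γ → ℝ}
    {r : γ → Arr} (hn : CtxMap n) (hw : CtxMap w) (hown : CtxMap own) (hed : CtxMap ed)
    (hP : CtxMap P) (hc : CtxMap c) (hb : DefFun b) (hr : CtxMap r) :
    DefPred (fun L x => ArrCert L (n x) (w x) (own x) (ed x) (P x) (c x) (b L x) (r x)) :=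
  DefPred.subst (P := fun L x y => ArrCert L (n x) (w x) (own x) (ed x) (P x) (c x) y (r x))
    (defPred_arrCert_aux (by fun_prop) (by fun_prop) (by fun_prop) (by fun_prop) (by fun_prop)
      (by fun_prop) (by fun_prop) (by fun_prop)) hb

lemma defPred_arrTrans {n : γ → ℕ} {own : γ → Arr} {ed : γ → Arr} {pr : γ → Arr} {P : γ → Arr}
    (hn : CtxMap n) (hown : CtxMap own) (hed : CtxMap ed) (hpr : CtxMap pr) (hP : CtxMap P) :
    DefPred (fun L x => ArrTrans L (n x) (own x) (ed x) (pr x) (P x)) := by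
  unfold ArrTrans
  repeat' first
    | with_reducible apply DefPred.and
    | with_reducible apply DefPred.or
    | with_reducible apply DefPred.not
    | with_reducible apply DefPred.exIdx
    | with_reducible apply DefPred.allIdx
    | with_reducible apply DefPred.exBig
    | with_reducible apply DefPred.exArr
    | with_reducible apply DefPred.allArr
    | with_reducible apply DefPred.exReal
    | with_reducible apply DefPred.imp
    | with_reducible apply DefPred.natLt
    | with_reducible apply DefPred.natEq
    | with_reducible apply DefPred.eq
    | with_reducible apply DefPred.le
    | with_reducible apply DefPred.lt
    | with_reducible apply DefFun.zero
    | with_reducible apply DefFun.one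
    | with_reducible apply DefFun.acc
    | with_reducible apply DefFun.ofNat
    | with_reducible apply DefNat.const
    | with_reducible apply DefNat.len
    | with_reducible apply DefNat.add
    | with_reducible apply DefNat.mul
    | with_reducible apply DefNat.pair
    | with_reducible apply DefFun.bsum
    | with_reducible apply DefFun.add
    | with_reducible apply DefFun.mul
    | with_reducible apply DefNat.var
    | with_reducible apply DefFun.real
    | fun_prop

lemma defPred_arrAnswer {k : γ → ℕ} {n : γ → ℕ} {s : γ → ℕ} {own : γ → Arr} {ed : γ → Arr}
    {pr : γ → Arr} {ob : γ → Arr} {μ : γ → ℝ}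
    (hk : CtxMap k) (hn : CtxMap n) (hs : CtxMap s) (hown : CtxMap own) (hed : CtxMap ed)
      (hpr : CtxMap pr) (hob : CtxMap ob) (hμ : CtxMap μ) :
    DefPred (fun L x => ArrAnswer L (k x) (n x) (s x) (own x) (ed x) (pr x) (ob x) (μ x)) := by
  unfold ArrAnswer
  repeat' first
    | with_reducible apply DefPred.and
    | with_reducible apply DefPred.or
    | with_reducible apply DefPred.not
    | with_reducible apply DefPred.exIdx
    | with_reducible apply DefPred.allIdx
    | with_reducible apply DefPred.exBig
    | with_reducible apply DefPred.exArr
    | with_reducible apply DefPred.allArr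
    | with_reducible apply DefPred.exReal
    | with_reducible apply DefPred.imp
    | with_reducible apply DefPred.natLt
    | with_reducible apply DefPred.natEq
    | with_reducible apply DefPred.eq
    | with_reducible apply DefPred.le
    | with_reducible apply DefPred.lt
    | with_reducible apply defPred_arrTrans
    | with_reducible apply defPred_arrCert
    | with_reducible apply DefFun.zero
    | with_reducible apply DefFun.one
    | with_reducible apply DefFun.acc
    | with_reducible apply DefFun.ofNat
    | with_reducible apply DefNat.const
    | with_reducible apply DefNat.len
    | with_reducible apply DefNat.add
    | with_reducible apply DefNat.mul
    | with_reducible apply DefNat.pair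
    | with_reducible apply DefFun.bsum
    | with_reducible apply DefFun.add
    | with_reducible apply DefFun.mul
    | with_reducible apply DefNat.var
    | with_reducible apply DefFun.real
    | fun_prop

lemma defPred_codeAnswer : DefPred (fun L (N : ℕ) => CodeAnswer L N) := by
  unfold CodeAnswer
  repeat' first
    | with_reducible apply DefPred.and
    | with_reducible apply DefPred.or
    | with_reducible apply DefPred.not
    | with_reducible apply DefPred.exIdx
    | with_reducible apply DefPred.allIdx
    | with_reducible apply DefPred.exBig
    | with_reducible apply DefPred.exArr
    | with_reducible apply DefPred.allArr
    | with_reducible apply DefPred.exReal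
    | with_reducible apply DefPred.imp
    | with_reducible apply DefPred.natLt
    | with_reducible apply DefPred.natEq
    | with_reducible apply DefPred.eq
    | with_reducible apply DefPred.le
    | with_reducible apply DefPred.lt
    | with_reducible apply defPred_isListCode
    | with_reducible apply defPred_isRatCode
    | with_reducible apply defPred_arrAnswer
    | with_reducible apply DefFun.zero
    | with_reducible apply DefFun.one
    | with_reducible apply DefFun.acc
    | with_reducible apply DefFun.ofNat
    | with_reducible apply DefNat.const
    | with_reducible apply DefNat.len
    | with_reducible apply DefNat.add
    | with_reducible apply DefNat.mul
    | with_reducible apply DefNat.pair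
    | with_reducible apply DefFun.bsum
    | with_reducible apply DefFun.add
    | with_reducible apply DefFun.mul
    | with_reducible apply DefNat.var
    | with_reducible apply DefFun.real
    | fun_prop

end Definability

/-! ### Correctness of the arithmetization: codes -/

lemma encode_drop_le (l : List ℕ) (i : ℕ) : Encodable.encode (l.drop i) ≤ Encodable.encode l := by
  induction l generalizing i with
  | nil => simp
  | cons a l ih =>
    cases i with
    | zero => simp
    | succ i =>
      rw [List.drop_succ_cons, Encodable.encode_list_cons]
      exact (ih i).trans ((Nat.right_le_pair _ _).trans (Nat.le_succ _))

lemma encode_map_encode {α : Type} [Encodable α] (l : List α) :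
    Encodable.encode (l.map Encodable.encode) = Encodable.encode l := by
  induction l with
  | nil => rfl
  | cons a l ih =>
    rw [List.map_cons, Encodable.encode_list_cons, Encodable.encode_list_cons, ih]
    rfl

lemma isListCode_nat_iff {L : ℕ} {l : List ℕ} (hL : l.length < L) (hc : Encodable.encode l < 2 ^ L)
    (a : Arr) (o : ℕ) : IsListCode L (Encodable.encode l) a o l.length ↔
      ∀ i (h : i < l.length), acc L a (o + i) = (l[i] : ℝ) := by
  have hd : ∀ i (h : i < l.length), Encodable.encode (l.drop i) =
      Nat.pair l[i] (Encodable.encode (l.drop (i + 1))) + 1 := by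
    intro i h
    rw [List.drop_eq_getElem_cons h, Encodable.encode_list_cons]
    rfl
  constructor
  · rintro ⟨T, h0, -, h1⟩ i hi
    suffices H : ∀ i, i ≤ l.length → acc L T i = (Encodable.encode (l.drop i) : ℝ) by
      obtain ⟨h, -, t, -, e1, -, e3⟩ := h1 i (by omega) hi
      rw [H i hi.le, hd i hi, Nat.cast_inj, Nat.succ_inj, Nat.pair_eq_pair] at e3
      rw [e1, e3.1]
    intro i
    induction i with
    | zero => intro _; simpa using h0
    | succ i ih =>
      intro hi
      obtain ⟨h, -, t, -, -, e2, e3⟩ := h1 i (by omega) hi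
      rw [ih (by omega), hd i hi, Nat.cast_inj, Nat.succ_inj, Nat.pair_eq_pair] at e3
      rw [e2, e3.2]
  · intro h
    refine ⟨fun i => (Encodable.encode (l.drop i) : ℝ), ?_, ?_, fun i hi hi' => ?_⟩
    · rw [acc_of_lt (by omega)]; simp
    · rw [acc_of_lt hL]; simp
    · have e := encode_drop_le l i
      rw [hd i hi'] at e
      refine ⟨l[i], ?_, Encodable.encode (l.drop (i + 1)), ?_, h i hi', ?_, ?_⟩
      · have := Nat.left_le_pair l[i] (Encodable.encode (l.drop (i + 1)))
        omega
      · have := Nat.right_le_pair l[i] (Encodable.encode (l.drop (i + 1)))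
        omega
      · rw [acc_of_lt (by omega)]
      · rw [acc_of_lt hi, hd i hi']

lemma isListCode_iff {α : Type} [Encodable α] {L n : ℕ} (f : Fin n → α) (hL : n < L)
    (hc : Encodable.encode (List.ofFn f) < 2 ^ L) (a : Arr) (o : ℕ) :
    IsListCode L (Encodable.encode (List.ofFn f)) a o n ↔
      ∀ i : Fin n, acc L a (o + i) = (Encodable.encode (f i) : ℝ) := by
  have h := isListCode_nat_iff (L := L) (l := (List.ofFn f).map Encodable.encode) (by simpa)
    (by rwa [encode_map_encode]) a o
  rw [encode_map_encode] at h
  simp only [List.length_map, List.length_ofFn, List.getElem_map, List.getElem_ofFn] at h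
  rw [h]
  exact ⟨fun H i => H i i.2, fun H i hi => H ⟨i, hi⟩⟩

lemma isRatCode_iff {L : ℕ} {q : ℚ} (hq : Encodable.encode q < 2 ^ L) (x : ℝ) :
    IsRatCode L (Encodable.encode q : ℕ) x ↔ x = q := by
  have he : Encodable.encode q = Nat.pair (Encodable.encode q.num) q.den := rfl
  have hd : (q.den : ℝ) ≠ 0 := by exact_mod_cast q.den_ne_zero
  have h1 : Encodable.encode q.num ≤ Encodable.encode q := he ▸ Nat.left_le_pair _ _
  have h2 : q.den ≤ Encodable.encode q := he ▸ Nat.right_le_pair _ _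
  have hq' : (q : ℝ) = q.num / q.den := Rat.cast_def q
  have key : x = q ↔ x * q.den = q.num := by rw [hq', eq_div_iff hd]
  rw [key]
  rcases hn : q.num with m | m
  · have e : Encodable.encode q.num = m + m := by rw [hn, ← two_mul]; rfl
    constructor
    · rintro ⟨z, -, d, -, e1, h, -, e2⟩
      rw [Nat.cast_inj, he, Nat.pair_eq_pair] at e1
      obtain ⟨rfl, rfl⟩ := e1
      rcases e2 with ⟨e2, e3⟩ | ⟨e2, e3⟩
      · rw [e3]
        have : h = m := by omega
        simp [this]
      · omega
    · intro e3
      refine ⟨_, h1.trans_lt hq, _, h2.trans_lt hq, by rw [he], m, by omega, Or.inl ⟨e, ?_⟩⟩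
      simpa using e3
  · have e : Encodable.encode q.num = m + m + 1 := by rw [hn, ← two_mul]; rfl
    constructor
    · rintro ⟨z, -, d, -, e1, h, -, e2⟩
      rw [Nat.cast_inj, he, Nat.pair_eq_pair] at e1
      obtain ⟨rfl, rfl⟩ := e1
      rcases e2 with ⟨e2, e3⟩ | ⟨e2, e3⟩
      · omega
      · have : h = m := by omega
        subst this
        rw [eq_neg_of_add_eq_zero_left e3]
        simp [Int.negSucc_eq]
    · intro e3
      refine ⟨_, h1.trans_lt hq, _, h2.trans_lt hq, by rw [he], m, by omega, Or.inr ⟨e, ?_⟩⟩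
      rw [e3]
      simp [Int.negSucc_eq]

namespace BForm

/-- The list of subformulas. -/
def subs {α : Type} : BForm α → List (BForm α)
  | tru => [tru]
  | fls => [fls]
  | var a => [var a]
  | not f => not f :: subs f
  | and f g => and f g :: (subs f ++ subs g)
  | or f g => or f g :: (subs f ++ subs g)

lemma mem_subs_self {α : Type} (φ : BForm α) : φ ∈ φ.subs := by cases φ <;> simp [subs]

lemma subs_getD_zero {α : Type} (φ d : BForm α) : φ.subs.getD 0 d = φ := by cases φ <;> simp [subs]

lemma subs_length_pos {α : Type} (φ : BForm α) : 0 < φ.subs.length := by cases φ <;> simp [subs]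

lemma mem_subs_trans {α : Type} {f g : BForm α} (φ : BForm α) (hg : g ∈ φ.subs)
    (hf : f ∈ g.subs) : f ∈ φ.subs := by
  induction φ with
  | tru => simp [subs] at hg; subst hg; exact hf
  | fls => simp [subs] at hg; subst hg; exact hf
  | var a => simp [subs] at hg; subst hg; exact hf
  | not φ ih =>
    simp only [subs, List.mem_cons] at hg ⊢
    rcases hg with rfl | hg
    · simpa [subs] using hf
    · exact Or.inr (ih hg)
  | and φ ψ ih1 ih2 =>
    simp only [subs, List.mem_cons, List.mem_append] at hg ⊢
    rcases hg with rfl | hg | hg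
    · simpa [subs] using hf
    · exact Or.inr (Or.inl (ih1 hg))
    · exact Or.inr (Or.inr (ih2 hg))
  | or φ ψ ih1 ih2 =>
    simp only [subs, List.mem_cons, List.mem_append] at hg ⊢
    rcases hg with rfl | hg | hg
    · simpa [subs] using hf
    · exact Or.inr (Or.inl (ih1 hg))
    · exact Or.inr (Or.inr (ih2 hg))

lemma toNat_le_of_mem_subs {f : BForm ℕ} (φ : BForm ℕ) (hf : f ∈ φ.subs) :
    f.toNat ≤ φ.toNat := by
  induction φ with
  | tru => simp [subs] at hf; rw [hf]
  | fls => simp [subs] at hf; rw [hf]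
  | var a => simp [subs] at hf; rw [hf]
  | not φ ih =>
    simp only [subs, List.mem_cons] at hf
    rcases hf with rfl | hf
    · rfl
    · exact (ih hf).trans (Nat.right_le_pair _ _)
  | and φ ψ ih1 ih2 =>
    simp only [subs, List.mem_cons, List.mem_append] at hf
    rcases hf with rfl | hf | hf
    · rfl
    · exact (ih1 hf).trans ((Nat.left_le_pair _ _).trans (Nat.right_le_pair _ _))
    · exact (ih2 hf).trans ((Nat.right_le_pair _ _).trans (Nat.right_le_pair _ _))
  | or φ ψ ih1 ih2 =>
    simp only [subs, List.mem_cons, List.mem_append] at hf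
    rcases hf with rfl | hf | hf
    · rfl
    · exact (ih1 hf).trans ((Nat.left_le_pair _ _).trans (Nat.right_le_pair _ _))
    · exact (ih2 hf).trans ((Nat.right_le_pair _ _).trans (Nat.right_le_pair _ _))

lemma two_mul_pair_le (a b t : ℕ) (ht : 4 ≤ t) :
    (a + 2) ^ 2 * (b + 2) ^ 2 * 2 ≤ (Nat.pair t (Nat.pair a b) + 2) ^ 2 := by
  have h1 := Nat.max_sq_add_min_le_pair a b
  have h2 := Nat.max_sq_add_min_le_pair t (Nat.pair a b)
  set w := Nat.pair a b
  have h3 : 4 ^ 2 ≤ max t w ^ 2 := Nat.pow_le_pow_left (ht.trans (le_max_left _ _)) 2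
  have h4 : w ^ 2 ≤ max t w ^ 2 := Nat.pow_le_pow_left (le_max_right _ _) 2
  have h5 : (a + 2) * (b + 2) = (max a b + 2) * (min a b + 2) := by
    rcases le_total a b with h | h
    · rw [max_eq_right h, min_eq_left h, mul_comm]
    · rw [max_eq_left h, min_eq_right h]
  have h6 : min a b ≤ max a b := min_le_max
  suffices h : 2 * ((a + 2) * (b + 2)) ≤ Nat.pair t w + 2 by
    have := Nat.pow_le_pow_left h 2
    nlinarith
  rw [h5]
  generalize max a b = x at *
  generalize min a b = y at *
  by_cases hx : x ≤ 1
  · have : (x + 2) * (y + 2) ≤ 3 * 3 := Nat.mul_le_mul (by omega) (by omega)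
    omega
  · have h7 : (x ^ 2 + y) ^ 2 ≤ w ^ 2 := Nat.pow_le_pow_left h1 2
    have h8 : 2 * x ≤ x ^ 2 := by nlinarith
    have h9 : 8 * x ≤ (x ^ 2) ^ 2 := by nlinarith
    have h10 : 2 * x * y ≤ x ^ 2 * y := Nat.mul_le_mul_right y h8
    have h11 : 2 * y ≤ x * y := Nat.mul_le_mul_right y (by omega)
    have h12 : (x ^ 2 + y) ^ 2 = (x ^ 2) ^ 2 + 2 * (x ^ 2 * y) + y ^ 2 := by ring
    have h13 : 2 * ((x + 2) * (y + 2)) = 2 * (x * y) + 4 * x + 4 * y + 8 := by ring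
    have h14 : 2 * x * y = 2 * (x * y) := by ring
    rw [h12] at h7
    omega

/-- The number of subformulas is logarithmic in the code. -/
lemma two_pow_subs_length_le (φ : BForm ℕ) : 2 ^ φ.subs.length ≤ (φ.toNat + 2) ^ 2 := by
  induction φ with
  | tru => simp [subs, toNat, Nat.pair]
  | fls => simp [subs, toNat, Nat.pair]
  | var a =>
    simp only [subs, List.length_singleton, pow_one]
    nlinarith [Nat.zero_le (toNat (var a))]
  | not φ ih =>
    simp only [subs, toNat, List.length_cons, pow_succ 2]
    have h : 2 * φ.toNat + 2 ≤ Nat.pair 3 φ.toNat := by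
      rw [Nat.pair]
      split_ifs <;> nlinarith
    nlinarith
  | and φ ψ ih1 ih2 =>
    simp only [subs, toNat, List.length_cons, List.length_append, pow_succ 2, pow_add]
    exact le_trans (Nat.mul_le_mul_right _ (Nat.mul_le_mul ih1 ih2))
      (two_mul_pair_le _ _ 4 le_rfl)
  | or φ ψ ih1 ih2 =>
    simp only [subs, toNat, List.length_cons, List.length_append, pow_succ 2, pow_add]
    exact le_trans (Nat.mul_le_mul_right _ (Nat.mul_le_mul ih1 ih2))
      (two_mul_pair_le _ _ 5 (by norm_num))

lemma subs_length_le (φ : BForm ℕ) : φ.subs.length ≤ 2 * Nat.size (φ.toNat + 2) := by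
  have h1 := φ.two_pow_subs_length_le
  have h2 : φ.toNat + 2 < 2 ^ Nat.size (φ.toNat + 2) := Nat.lt_size_self _
  have h3 : 2 ^ φ.subs.length < 2 ^ (2 * Nat.size (φ.toNat + 2)) := by
    rw [pow_mul']
    exact h1.trans_lt (Nat.pow_lt_pow_left h2 (by norm_num))
  exact ((Nat.pow_lt_pow_iff_right (by norm_num)).1 h3).le

end BForm

open scoped Classical in
lemma truthCode_iff {L : ℕ} (E : Arr) {φ : BForm ℕ} (h1 : φ.subs.length ≤ L)
    (h2 : φ.toNat < 2 ^ L) (b : ℝ) : TruthCode L E φ.toNat b ↔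
      b = if BForm.holds (fun v => acc L E v = 1) φ then 1 else 0 := by
  have hL : 0 < L := φ.subs_length_pos.trans_le h1
  constructor
  · rintro ⟨C, V, hC0, hV0, H⟩
    rw [← hV0]
    suffices h : ∀ ψ : BForm ℕ, ∀ j, j < L → acc L C j = (ψ.toNat : ℝ) →
        acc L V j = if BForm.holds (fun v => acc L E v = 1) ψ then 1 else 0 from h φ 0 hL hC0
    intro ψ
    induction ψ with
    | tru =>
      intro j hj e
      obtain ⟨t, -, x, -, e1, h⟩ := H j hj
      rw [e, Nat.cast_inj, BForm.toNat, Nat.pair_eq_pair] at e1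
      obtain ⟨rfl, rfl⟩ := e1
      simp at h
      simpa [BForm.holds] using h
    | fls =>
      intro j hj e
      obtain ⟨t, -, x, -, e1, h⟩ := H j hj
      rw [e, Nat.cast_inj, BForm.toNat, Nat.pair_eq_pair] at e1
      obtain ⟨rfl, rfl⟩ := e1
      simp at h
      simpa [BForm.holds] using h
    | var a =>
      intro j hj e
      obtain ⟨t, -, x, -, e1, h⟩ := H j hj
      rw [e, Nat.cast_inj, BForm.toNat, Nat.pair_eq_pair] at e1
      obtain ⟨rfl, rfl⟩ := e1
      simp only [OfNat.ofNat_ne_zero, false_and, false_or, OfNat.ofNat_ne_one, true_and,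
        Nat.reduceEqDiff, or_false, and_false, exists_const] at h
      by_cases hE : acc L E a = 1
      · simp_all [BForm.holds]
      · simp_all [BForm.holds]
    | not f ih =>
      intro j hj e
      obtain ⟨t, -, x, -, e1, h⟩ := H j hj
      rw [e, Nat.cast_inj, BForm.toNat, Nat.pair_eq_pair] at e1
      obtain ⟨rfl, rfl⟩ := e1
      simp only [OfNat.ofNat_ne_zero, false_and, false_or, OfNat.ofNat_ne_one, true_and,
        Nat.reduceEqDiff, or_false, and_false, exists_const] at h
      obtain ⟨i, hi, h3, h4⟩ := h
      rw [ih i hi h3] at h4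
      by_cases hf : BForm.holds (fun v => acc L E v = 1) f
      · simp only [BForm.holds, hf, if_true, not_true, if_false] at h4 ⊢; linarith
      · simp only [BForm.holds, hf, if_true, not_false_iff, if_false] at h4 ⊢; linarith
    | and f g ihf ihg =>
      intro j hj e
      obtain ⟨t, -, x, -, e1, h⟩ := H j hj
      rw [e, Nat.cast_inj, BForm.toNat, Nat.pair_eq_pair] at e1
      obtain ⟨rfl, rfl⟩ := e1
      simp only [OfNat.ofNat_ne_zero, false_and, false_or, OfNat.ofNat_ne_one, true_and,
        Nat.reduceEqDiff, or_false, Nat.pair_eq_pair] at h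
      obtain ⟨y, -, z, -, ⟨rfl, rfl⟩, i, hi, i', hi', h3, h4, h5⟩ := h
      rw [h5, ihf i hi h3, ihg i' hi' h4]
      by_cases hf : BForm.holds (fun v => acc L E v = 1) f <;>
        by_cases hg : BForm.holds (fun v => acc L E v = 1) g <;> simp [BForm.holds, hf, hg]
    | or f g ihf ihg =>
      intro j hj e
      obtain ⟨t, -, x, -, e1, h⟩ := H j hj
      rw [e, Nat.cast_inj, BForm.toNat, Nat.pair_eq_pair] at e1
      obtain ⟨rfl, rfl⟩ := e1
      simp only [OfNat.ofNat_ne_zero, false_and, false_or, OfNat.ofNat_ne_one, true_and,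
        Nat.reduceEqDiff, Nat.pair_eq_pair] at h
      obtain ⟨y, -, z, -, ⟨rfl, rfl⟩, i, hi, i', hi', h3, h4, h5⟩ := h
      rw [ihf i hi h3, ihg i' hi' h4] at h5
      by_cases hf : BForm.holds (fun v => acc L E v = 1) f <;>
        by_cases hg : BForm.holds (fun v => acc L E v = 1) g <;>
        simp only [BForm.holds, hf, hg, if_true, if_false, or_true, or_false, or_self]
          at h5 ⊢ <;> linarith
  · rintro rfl
    set f : ℕ → BForm ℕ := fun j => φ.subs.getD j φ with hf
    have hmem : ∀ j, f j ∈ φ.subs := by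
      intro j
      rw [hf]
      by_cases hj : j < φ.subs.length
      · simp only [List.getD_eq_getElem _ _ hj]; exact List.getElem_mem _
      · simp only [List.getD_eq_default _ _ (not_lt.1 hj)]; exact φ.mem_subs_self
    have hidx : ∀ ψ ∈ φ.subs, ∃ i, i < L ∧ f i = ψ := by
      intro ψ hψ
      obtain ⟨i, hi, e⟩ := List.getElem_of_mem hψ
      exact ⟨i, hi.trans_le h1, by rw [hf]; simp only [List.getD_eq_getElem _ _ hi, e]⟩
    refine ⟨fun j => ((f j).toNat : ℝ),
      fun j => if BForm.holds (fun v => acc L E v = 1) (f j) then 1 else 0, ?_, ?_, ?_⟩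
    · rw [acc_of_lt hL, hf]; simp only [BForm.subs_getD_zero]
    · rw [acc_of_lt hL, hf]; simp only [BForm.subs_getD_zero]
    · intro j hj
      have hb := ((BForm.toNat_le_of_mem_subs φ (hmem j)).trans_lt h2)
      have hsub : ∀ ψ ∈ (f j).subs, ∃ i, i < L ∧ f i = ψ :=
        fun ψ hψ => hidx ψ (BForm.mem_subs_trans φ (hmem j) hψ)
      rw [acc_of_lt hj, acc_of_lt hj]
      rcases hψ : f j with _ | _ | a | g | ⟨g, g'⟩ | ⟨g, g'⟩ <;> rw [hψ] at hb hsub <;>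
        simp only [BForm.toNat] at hb
      · exact ⟨0, by positivity, 0, by positivity, rfl, Or.inl ⟨rfl, by simp [BForm.holds]⟩⟩
      · exact ⟨1, (Nat.left_le_pair 1 0).trans_lt hb, 0, by positivity, rfl,
          Or.inr (Or.inl ⟨rfl, by simp [BForm.holds]⟩)⟩
      · refine ⟨2, (Nat.left_le_pair _ _).trans_lt hb, a, (Nat.right_le_pair _ _).trans_lt hb, rfl,
          Or.inr (Or.inr (Or.inl ⟨rfl, ?_⟩))⟩
        by_cases hE : acc L E a = 1 <;> simp [BForm.holds, hE]
      · obtain ⟨i, hi, e⟩ := hsub g (by simp [BForm.subs, BForm.mem_subs_self])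
        refine ⟨3, (Nat.left_le_pair _ _).trans_lt hb, g.toNat, (Nat.right_le_pair _ _).trans_lt hb,
          rfl, Or.inr (Or.inr (Or.inr (Or.inl ⟨rfl, i, hi, ?_, ?_⟩)))⟩
        · rw [acc_of_lt hi, e]
        · rw [acc_of_lt hi, e]
          by_cases hE : BForm.holds (fun v => acc L E v = 1) g <;> simp [BForm.holds, hE]
      all_goals
        obtain ⟨i, hi, e⟩ := hsub g (by simp [BForm.subs, BForm.mem_subs_self])
        obtain ⟨i', hi', e'⟩ := hsub g' (by simp [BForm.subs, BForm.mem_subs_self])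
        have hb' := (Nat.right_le_pair _ _).trans_lt hb
        refine ⟨_, (Nat.left_le_pair _ _).trans_lt hb, _, hb', rfl, Or.inr (Or.inr (Or.inr (Or.inr
          ⟨g.toNat, (Nat.left_le_pair _ _).trans_lt hb', g'.toNat,
          (Nat.right_le_pair _ _).trans_lt hb', rfl, i, hi, i', hi', by rw [acc_of_lt hi, e],
            by rw [acc_of_lt hi', e'], ?_⟩)))⟩
        rw [acc_of_lt hi, acc_of_lt hi', e, e']
      · left
        refine ⟨rfl, ?_⟩
        by_cases hf : BForm.holds (fun v => acc L E v = 1) g <;>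
        by_cases hg : BForm.holds (fun v => acc L E v = 1) g' <;> simp [BForm.holds, hf, hg]
      · right
        refine ⟨rfl, ?_⟩
        by_cases hf : BForm.holds (fun v => acc L E v = 1) g <;>
        by_cases hg : BForm.holds (fun v => acc L E v = 1) g' <;> simp [BForm.holds, hf, hg]

/-! ### Correctness of the arithmetization: arrays -/

section Arrays

variable {L n : ℕ}

lemma forall_fin_iff (hn : n ≤ L) {p : ℕ → Prop} :
    (∀ u, u < L → u < n → p u) ↔ ∀ u : Fin n, p u :=
  ⟨fun h u => h u (u.2.trans_le hn) u.2, fun h u _ hu => h ⟨u, hu⟩⟩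

lemma exists_fin_iff (hn : n ≤ L) {p : ℕ → Prop} :
    (∃ u, u < L ∧ u < n ∧ p u) ↔ ∃ u : Fin n, p u :=
  ⟨fun ⟨u, _, hu, h⟩ => ⟨⟨u, hu⟩, h⟩, fun ⟨u, h⟩ => ⟨u, u.2.trans_le hn, u.2, h⟩⟩

/-- The vector given by an array. -/
noncomputable def toVec (L n : ℕ) (a : Arr) (u : Fin n) : ℝ := acc L a u

/-- The matrix given by an array. -/
noncomputable def toMat (L n : ℕ) (a : Arr) (u v : Fin n) : ℝ := acc L a (u * n + v)

/-- The set given by an array. -/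
def toSet (L n : ℕ) (a : Arr) : Set (Fin n) := {u | acc L a u = 1}

lemma mem_toSet {a : Arr} {u : Fin n} : u ∈ toSet L n a ↔ acc L a u = 1 := Iff.rfl

lemma toVec_surjective (hn : n ≤ L) : Function.Surjective (toVec L n) := by
  intro f
  refine ⟨fun i => if h : i < n then f ⟨i, h⟩ else 0, funext fun u => ?_⟩
  rw [toVec, acc_of_lt (u.2.trans_le hn)]
  simp

lemma index_lt (hn : n * n ≤ L) (u v : Fin n) : (u : ℕ) * n + v < L := by
  have : ((u : ℕ) + 1) * n ≤ n * n := Nat.mul_le_mul_right n u.2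
  have := v.2
  nlinarith

lemma toMat_surjective (hn : n * n ≤ L) : Function.Surjective (toMat L n) := by
  intro f
  refine ⟨fun i => if h : i / n < n ∧ i % n < n then f ⟨i / n, h.1⟩ ⟨i % n, h.2⟩ else 0,
    funext fun u => funext fun v => ?_⟩
  have h0 : 0 < n := Nat.lt_of_le_of_lt (Nat.zero_le _) u.2
  have h1 : ((u : ℕ) * n + v) / n = u := by
    rw [add_comm, Nat.add_mul_div_right _ _ h0, Nat.div_eq_of_lt v.2, zero_add]
  have h2 : ((u : ℕ) * n + v) % n = v := by
    rw [add_comm, Nat.add_mul_mod_self_right, Nat.mod_eq_of_lt v.2]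
  rw [toMat, acc_of_lt (index_lt hn u v)]
  simp [h1, h2]

lemma toSet_surjective (hn : n ≤ L) : Function.Surjective (toSet L n) := by
  classical
  intro E
  refine ⟨fun i => if h : i < n then (if (⟨i, h⟩ : Fin n) ∈ E then 1 else 0) else 0,
    Set.ext fun u => ?_⟩
  rw [mem_toSet, acc_of_lt (u.2.trans_le hn)]
  simp

lemma bsum_eq (hn : n < L) (f : ℕ → ℝ) : bsum L n f = ∑ v : Fin n, f v := by
  rw [bsum, if_pos hn, Finset.sum_range]

variable {own ed : Arr} {w : ℕ} {C : Fin n → Prop} {e : Fin n → Fin n → Prop}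

lemma arrStep_iff (hC : ∀ u : Fin n, acc L own u = (w : ℝ) ↔ C u)
    (he : ∀ u v : Fin n, acc L ed (u * n + v) = 1 ↔ e u v) (P : Arr) (a b : Fin n) :
    ArrStep L n w own ed P a b ↔ MStep C e (toMat L n P) a b := by
  rw [ArrStep, MStep, hC, he]
  rfl

lemma arrEC_iff (hn : n ≤ L) (hC : ∀ u : Fin n, acc L own u = (w : ℝ) ↔ C u)
    (he : ∀ u v : Fin n, acc L ed (u * n + v) = 1 ↔ e u v) (P E : Arr) :
    ArrEC L n w own ed P E ↔ IsEC C e (toMat L n P) (toSet L n E) := by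
  rw [ArrEC, IsEC, (toSet_surjective hn).forall]
  simp only [forall_fin_iff hn, exists_fin_iff hn, mem_toSet, arrStep_iff hC he, hC, he, toMat]

lemma arrCert_iff (hn : n < L) (hC : ∀ u : Fin n, acc L own u = (w : ℝ) ↔ C u)
    (he : ∀ u v : Fin n, acc L ed (u * n + v) = 1 ↔ e u v) {c : ℕ} {b : ℝ}
    {G : Set (Fin n) → Prop} (hG : ∀ E, TruthCode L E c b ↔ G (toSet L n E)) (P r : Arr) :
    ArrCert L n w own ed P c b r ↔ Cert C e (toMat L n P) G (toVec L n r) := by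
  rw [ArrCert, Cert, (toSet_surjective hn.le).forall]
  simp only [forall_fin_iff hn.le, mem_toSet, arrEC_iff hn.le hC he, hC, he, hG, bsum_eq hn,
    toMat, toVec]

end Arrays

section Arena

variable {L k n : ℕ} {A : Arena k (Fin n)} {own ed pr ob : Arr}

lemma arrTrans_iff (hn : n < L)
    (hown : ∀ u : Fin n, acc L own u = (Encodable.encode ((A.owner u).map Fin.val) : ℕ))
    (hed : ∀ u v : Fin n, acc L ed (u * n + v) = (Encodable.encode (A.edge u v) : ℕ))
    (hpr : ∀ u v : Fin n, acc L pr (u * n + v) = A.prob u v) (P : Arr) :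
    ArrTrans L n own ed pr P ↔ IsTransMatrix A (toMat L n P) := by
  have h0 : ∀ u : Fin n, acc L own u = 0 ↔ A.owner u = none := by
    intro u
    rw [hown, Nat.cast_eq_zero]
    cases A.owner u <;> simp
  have h1 : ∀ u v : Fin n, acc L ed (u * n + v) = 1 ↔ A.edge u v = true := by
    intro u v
    rw [hed]
    cases A.edge u v <;> simp
  rw [ArrTrans, IsTransMatrix]
  simp only [forall_fin_iff hn.le, bsum_eq hn, h0, h1, hpr, toMat]

lemma holds_map_val (φ : BForm (Fin n)) (E : Arr) :
    BForm.holds (fun v => acc L E v = 1) (BForm.map Fin.val φ) ↔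
      BForm.holds (· ∈ toSet L n E) φ := by
  induction φ <;> simp_all [BForm.holds, BForm.map, mem_toSet]

lemma arrAnswer_iff {φ : Fin (k + 1) → BForm (Fin n)} (hn : n < L) (hn' : n * n ≤ L)
    (hk : k + 2 < L)
    (hown : ∀ u : Fin n, acc L own u = (Encodable.encode ((A.owner u).map Fin.val) : ℕ))
    (hed : ∀ u v : Fin n, acc L ed (u * n + v) = (Encodable.encode (A.edge u v) : ℕ))
    (hpr : ∀ u v : Fin n, acc L pr (u * n + v) = A.prob u v)
    (hob : ∀ i : Fin (k + 1), acc L ob i = ((BForm.map Fin.val (φ i)).toNat : ℕ))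
    (hc : ∀ i, (BForm.map Fin.val (φ i)).toNat < 2 ^ L)
    (hs : ∀ i, (BForm.map Fin.val (φ i)).subs.length ≤ L) (μ : ℝ) :
    ArrAnswer L k n A.init own ed pr ob μ ↔ MatrixAnswer A φ μ := by
  classical
  have he : ∀ u v : Fin n, acc L ed (u * n + v) = 1 ↔ A.edge u v = true := by
    intro u v
    rw [hed]
    cases A.edge u v <;> simp
  have hw : ∀ u : Fin n, acc L own u = ((k + 2 : ℕ) : ℝ) ↔ False := by
    intro u
    rw [hown, Nat.cast_inj, iff_false]
    cases A.owner u with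
    | none => simp
    | some i => simp; omega
  have hj : ∀ (i : Fin (k + 1)) (u : Fin n),
      acc L own u = (((i : ℕ) + 1 : ℕ) : ℝ) ↔ A.owner u = some i := by
    intro i u
    rw [hown, Nat.cast_inj]
    cases A.owner u with
    | none => simp
    | some i => simp [Fin.ext_iff]
  have hz : ∀ u : Fin n, acc L own u = 1 ↔ A.owner u = some 0 := by
    intro u
    rw [← hj 0 u]
    simp
  have ht1 : ∀ (i : Fin (k + 1)) (E : Arr), TruthCode L E (BForm.map Fin.val (φ i)).toNat 1 ↔
      (fun E => BForm.holds (· ∈ E) (φ i)) (toSet L n E) := by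
    intro i E
    rw [truthCode_iff E (hs i) (hc i), holds_map_val]
    by_cases h : BForm.holds (· ∈ toSet L n E) (φ i) <;> simp [h]
  have ht0 : ∀ (i : Fin (k + 1)) (E : Arr), TruthCode L E (BForm.map Fin.val (φ i)).toNat 0 ↔
      (fun E => ¬ BForm.holds (· ∈ E) (φ i)) (toSet L n E) := by
    intro i E
    rw [truthCode_iff E (hs i) (hc i), holds_map_val]
    by_cases h : BForm.holds (· ∈ toSet L n E) (φ i) <;> simp [h]
  have hex : ∀ (i : Fin (k + 1)) (Q : ℕ → Prop), (∃ c : ℕ, c < 2 ^ L ∧ acc L ob i = (c : ℝ) ∧ Q c) ↔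
      Q (BForm.map Fin.val (φ i)).toNat := by
    intro i Q
    rw [hob]
    constructor
    · rintro ⟨c, -, h, hQ⟩
      rw [Nat.cast_inj] at h
      rwa [h]
    · intro hQ
      exact ⟨_, hc i, rfl, hQ⟩
  have hex0 := hex 0
  rw [Fin.val_zero] at hex0
  have hidx : ∀ (m : ℕ) (Q : ℕ → Prop), m < L → ((∃ w, w < L ∧ w = m ∧ Q w) ↔ Q m) := by
    intro m Q hm
    exact ⟨fun ⟨_, _, h, hQ⟩ => h ▸ hQ, fun hQ => ⟨m, hm, rfl, hQ⟩⟩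
  have hplayer : ∀ P : Arr, (∀ i, i < L → i < k + 1 → ¬ i = 0 → ∃ j, j < L ∧ j = i + 1 ∧
      ∃ c : ℕ, c < 2 ^ L ∧ acc L ob i = (c : ℝ) ∧ ∃ r r' : Arr, ArrCert L n j own ed P c 1 r ∧
        ArrCert L n (k + 2) own ed P c 0 r' ∧ acc L r A.init + acc L r' A.init ≤ 1) ↔
      (∀ i : Fin (k + 1), i ≠ 0 → ∃ r r', PlayerCert A i (φ i) (toMat L n P) r ∧
        ChainCert A (φ i) (toMat L n P) r' ∧ r A.init + r' A.init ≤ 1) := by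
    intro P
    rw [forall_fin_iff (show k + 1 ≤ L by omega)]
    refine forall_congr' fun i => ?_
    rw [hidx _ _ (show (i : ℕ) + 1 < L by omega), hex i, (toVec_surjective hn.le).exists]
    refine imp_congr (by rw [Ne, Fin.ext_iff]; rfl) (exists_congr fun r => ?_)
    rw [(toVec_surjective hn.le).exists]
    refine exists_congr fun r' => ?_
    rw [arrCert_iff hn (hj i) he (G := fun E => BForm.holds (· ∈ E) (φ i)) (ht1 i),
      arrCert_iff hn hw he (G := fun E => ¬ BForm.holds (· ∈ E) (φ i)) (ht0 i)]
    rfl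
  rw [ArrAnswer, MatrixAnswer, hidx _ _ hk, (toMat_surjective hn').exists]
  refine exists_congr fun x => and_congr (arrTrans_iff hn hown hed hpr x) ?_
  rw [(toMat_surjective hn').forall]
  refine forall_congr' fun P => imp_congr (arrTrans_iff hn hown hed hpr P) (imp_congr ?_
    (imp_congr (hplayer P) ?_))
  · simp only [forall_fin_iff hn.le, hz]
    rfl
  · rw [hex0, (toVec_surjective hn.le).exists]
    refine exists_congr fun r => ?_
    rw [arrCert_iff hn hw he (G := fun E => ¬ BForm.holds (· ∈ E) (φ 0)) (ht0 0)]
    rfl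

end Arena

/-! ### Correctness of the arithmetization: instances -/

lemma mul_self_le_pair (a b : ℕ) : b * b ≤ Nat.pair a b := by
  unfold Nat.pair
  split_ifs <;> nlinarith

lemma two_pow_length_le_encode {α : Type} [Encodable α] (l : List α) :
    l.length = 0 ∨ 2 ^ l.length ≤ 2 * Encodable.encode l := by
  induction l with
  | nil => simp
  | cons x l ih =>
    right
    rw [Encodable.encode_list_cons, List.length_cons, pow_succ]
    have h := mul_self_le_pair (Encodable.encode x) (Encodable.encode l)
    rcases ih with h0 | h0
    · rw [h0]
      simp
    · have : 2 * Encodable.encode l ≤ Encodable.encode l * Encodable.encode l + 1 := by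
        zify
        nlinarith [sq_nonneg ((Encodable.encode l : ℤ) - 1)]
      omega

lemma length_le_size_encode {α : Type} [Encodable α] (l : List α) :
    l.length ≤ Nat.size (Encodable.encode l) := by
  rcases two_pow_length_le_encode l with h | h
  · omega
  · cases h' : l.length with
    | zero => simp
    | succ n =>
      rw [h', pow_succ] at h
      exact Nat.lt_size.mpr (by omega)

lemma encode_le_of_mem {α : Type} [Encodable α] {x : α} {l : List α} (h : x ∈ l) :
    Encodable.encode x ≤ Encodable.encode l := by
  induction l with
  | nil => simp at h
  | cons y l ih =>
    rw [Encodable.encode_list_cons]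
    rcases List.mem_cons.mp h with rfl | h
    · exact (Nat.left_le_pair _ _).trans (Nat.le_succ _)
    · exact (ih h).trans ((Nat.right_le_pair _ _).trans (Nat.le_succ _))

lemma encode_apply_le {α : Type} [Encodable α] {n : ℕ} (f : Fin n → α) (i : Fin n) :
    Encodable.encode (f i) ≤ Encodable.encode (List.ofFn f) :=
  encode_le_of_mem (List.mem_ofFn.mpr ⟨i, rfl⟩)

/-- The number coding an instance. -/
def MullerInstance.code (I : MullerInstance) : ℕ :=
  Encodable.encode (encodeArena I.A,
    List.ofFn (fun i => (BForm.map Fin.val (I.obj i)).toNat), Encodable.encode I.μ)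

/-- The array bound used for inputs of `m` bits. -/
def bound (N : ℕ) : ℕ := (Nat.size N + 1) * (Nat.size N + 1) + 1

lemma MullerInstance.code_eq (I : MullerInstance) :
    I.code = Nat.pair (Nat.pair I.k (Nat.pair I.n (Nat.pair
      (Encodable.encode (List.ofFn fun v => (I.A.owner v).map Fin.val)) (Nat.pair
      (Encodable.encode (List.ofFn fun v => List.ofFn fun w => I.A.edge v w)) (Nat.pair
      (Encodable.encode (List.ofFn fun v => List.ofFn fun w => I.A.prob v w)) I.A.init)))))
      (Nat.pair (Encodable.encode (List.ofFn fun i => (BForm.map Fin.val (I.obj i)).toNat))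
        (Encodable.encode I.μ)) := by
  simp only [code, encodeArena, Encodable.encode_prod_val, Encodable.encode_nat]

lemma exists_arr_vec {L n : ℕ} (hn : n ≤ L) (f : Fin n → ℝ) :
    ∃ a : Arr, ∀ u : Fin n, acc L a u = f u := by
  obtain ⟨a, ha⟩ := toVec_surjective hn f
  exact ⟨a, fun u => congrFun ha u⟩

lemma exists_arr_mat {L n : ℕ} (hn : n * n ≤ L) (f : Fin n → Fin n → ℝ) :
    ∃ a : Arr, ∀ u v : Fin n, acc L a (u * n + v) = f u v := by
  obtain ⟨a, ha⟩ := toMat_surjective hn f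
  exact ⟨a, fun u v => congrFun (congrFun ha u) v⟩

lemma codeAnswer_iff (I : MullerInstance) :
    CodeAnswer (bound I.code) I.code ↔ MatrixAnswer I.A I.obj (I.μ : ℝ) := by
  have hcode := I.code_eq
  obtain ⟨k, n, A, φ, μ, wf, hμ0, hμ1⟩ := I
  dsimp only at hcode ⊢
  generalize MullerInstance.code _ = N at *
  set lo := Encodable.encode (List.ofFn fun v => (A.owner v).map Fin.val) with hlo
  set le := Encodable.encode (List.ofFn fun v => List.ofFn fun w => A.edge v w) with hle
  set lp := Encodable.encode (List.ofFn fun v => List.ofFn fun w => A.prob v w) with hlp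
  set lf := Encodable.encode (List.ofFn fun i => (BForm.map Fin.val (φ i)).toNat) with hlf
  set lm := Encodable.encode μ with hlm
  have bN : N < 2 ^ Nat.size N := Nat.lt_size_self N
  have b1 := Nat.left_le_pair (Nat.pair k (Nat.pair n (Nat.pair lo (Nat.pair le
    (Nat.pair lp A.init))))) (Nat.pair lf lm)
  have b2 := Nat.right_le_pair (Nat.pair k (Nat.pair n (Nat.pair lo (Nat.pair le
    (Nat.pair lp A.init))))) (Nat.pair lf lm)
  rw [← hcode] at b1 b2
  have b3 := (Nat.left_le_pair _ _).trans b2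
  have b4 := (Nat.right_le_pair _ _).trans b2
  have bk := (Nat.left_le_pair _ _).trans b1
  have b5 := (Nat.right_le_pair _ _).trans b1
  have bn := (Nat.left_le_pair _ _).trans b5
  have b6 := (Nat.right_le_pair _ _).trans b5
  have b7 := (Nat.left_le_pair _ _).trans b6
  have b8 := (Nat.right_le_pair _ _).trans b6
  have b9 := (Nat.left_le_pair _ _).trans b8
  have b10 := (Nat.right_le_pair _ _).trans b8
  have b11 := (Nat.left_le_pair _ _).trans b10
  have b12 := (Nat.right_le_pair _ _).trans b10
  have sn : n ≤ Nat.size N := by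
    have := length_le_size_encode (List.ofFn fun v => (A.owner v).map Fin.val)
    rw [List.length_ofFn] at this
    exact this.trans (Nat.size_le_size b7)
  have sk : k + 1 ≤ Nat.size N := by
    have := length_le_size_encode (List.ofFn fun i => (BForm.map Fin.val (φ i)).toNat)
    rw [List.length_ofFn] at this
    exact this.trans (Nat.size_le_size b3)
  have hL : Nat.size N + 1 < bound N := by
    unfold bound
    nlinarith
  have hn' : n * n ≤ bound N := (Nat.mul_le_mul (by omega) (by omega)).trans (Nat.le_succ _)
  have hlt : ∀ {x : ℕ}, x ≤ N → x < 2 ^ bound N := fun hx =>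
    (hx.trans_lt bN).trans_le (Nat.pow_le_pow_right (by norm_num) (by omega))
  have hn : n < bound N := by omega
  have hk : k + 2 < bound N := by omega
  have hc : ∀ i, (BForm.map Fin.val (φ i)).toNat ≤ N := fun i =>
    (encode_apply_le (fun i => (BForm.map Fin.val (φ i)).toNat) i).trans b3
  have hs : ∀ i, (BForm.map Fin.val (φ i)).subs.length ≤ bound N := by
    intro i
    refine (BForm.subs_length_le _).trans ?_
    have h1 : Nat.size ((BForm.map Fin.val (φ i)).toNat + 2) ≤ Nat.size N + 1 := by
      rw [Nat.size_le, pow_succ]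
      have := Nat.pow_le_pow_right (show 0 < 2 by norm_num) (show 1 ≤ Nat.size N by omega)
      have := hc i
      omega
    unfold bound
    nlinarith
  have key : ∀ (own ed pr ob : Arr) (x : ℝ), x = μ →
      (∀ u : Fin n, acc (bound N) own u = (Encodable.encode ((A.owner u).map Fin.val) : ℕ)) →
      (∀ u v : Fin n, acc (bound N) ed (u * n + v) = (Encodable.encode (A.edge u v) : ℕ)) →
      (∀ u v : Fin n, acc (bound N) pr (u * n + v) = A.prob u v) →
      (∀ i : Fin (k + 1), acc (bound N) ob i = ((BForm.map Fin.val (φ i)).toNat : ℕ)) →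
      (ArrAnswer (bound N) k n A.init own ed pr ob x ↔ MatrixAnswer A φ (μ : ℝ)) := by
    rintro own ed pr ob x rfl h1 h2 h3 h4
    exact arrAnswer_iff hn hn' hk h1 h2 h3 h4 (fun i => hlt (hc i)) hs _
  have hrow : ∀ u, Encodable.encode (List.ofFn fun w => A.edge u w) ≤ N := fun u =>
    (encode_apply_le (fun v => List.ofFn fun w => A.edge v w) u).trans b9
  have hrow' : ∀ u, Encodable.encode (List.ofFn fun w => A.prob u w) ≤ N := fun u =>
    (encode_apply_le (fun v => List.ofFn fun w => A.prob v w) u).trans b11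
  have hent : ∀ u v, Encodable.encode (A.prob u v) ≤ N := fun u v =>
    (encode_apply_le (fun w => A.prob u w) v).trans (hrow' u)
  have lOwn : ∀ a, IsListCode (bound N) lo a 0 n ↔ _ := fun a => isListCode_iff _ hn (hlt b7) a 0
  have lOb : ∀ a, IsListCode (bound N) lf a 0 (k + 1) ↔ _ :=
    fun a => isListCode_iff _ (by omega) (hlt b3) a 0
  have lEd : ∀ a, IsListCode (bound N) le a 0 n ↔ _ := fun a => isListCode_iff _ hn (hlt b9) a 0
  have lPr : ∀ a, IsListCode (bound N) lp a 0 n ↔ _ := fun a => isListCode_iff _ hn (hlt b11) a 0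
  simp only [zero_add] at lOwn lOb lEd lPr
  have lM : ∀ x, IsRatCode (bound N) lm x ↔ _ := isRatCode_iff (hlt b4)
  constructor
  · rintro ⟨k', -, n', -, lo', -, le', -, lp', -, s', -, lf', -, lm', -, hN, own, ed, pr, ob, x,
      h1, h2, h3, ⟨R, hR, hR'⟩, ⟨S, Q, hS, hS'⟩, h⟩
    obtain ⟨⟨rfl, rfl, rfl, rfl, rfl, rfl⟩, rfl, rfl⟩ := by
      simpa only [Nat.pair_eq_pair] using hcode.symm.trans hN
    rw [lOwn] at h1
    rw [lOb] at h2
    rw [lM] at h3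
    rw [lEd] at hR
    rw [lPr] at hS
    refine (key own ed pr ob x h3 h1 (fun u => ?_) (fun u v => ?_) h2).mp h
    · obtain ⟨c, -, hc1, hc2⟩ := hR' u (u.2.trans hn) u.2
      rw [hR, Nat.cast_inj] at hc1
      subst hc1
      exact (isListCode_iff (A.edge u) hn (hlt (hrow u)) _ _).mp hc2
    · obtain ⟨c, -, hc1, hc2, hc3⟩ := hS' u (u.2.trans hn) u.2
      rw [hS, Nat.cast_inj] at hc1
      subst hc1
      have := hc3 v (v.2.trans hn) v.2
      rw [(isListCode_iff (A.prob u) hn (hlt (hrow' u)) _ _).mp hc2] at this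
      exact (isRatCode_iff (hlt (hent u v)) _).mp this
  · intro h
    obtain ⟨own, h1⟩ := exists_arr_vec hn.le fun u =>
      ((Encodable.encode ((A.owner u).map Fin.val) : ℕ) : ℝ)
    obtain ⟨ed, h2⟩ := exists_arr_mat hn' fun u v => ((Encodable.encode (A.edge u v) : ℕ) : ℝ)
    obtain ⟨pr, h3⟩ := exists_arr_mat hn' fun u v => (A.prob u v : ℝ)
    obtain ⟨Q, h3'⟩ := exists_arr_mat hn' fun u v => ((Encodable.encode (A.prob u v) : ℕ) : ℝ)
    obtain ⟨ob, h4⟩ := exists_arr_vec (L := bound N) (n := k + 1) (by omega)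
      fun i => (((BForm.map Fin.val (φ i)).toNat : ℕ) : ℝ)
    obtain ⟨R, hR⟩ := exists_arr_vec hn.le fun u =>
      ((Encodable.encode (List.ofFn fun w => A.edge u w) : ℕ) : ℝ)
    obtain ⟨S, hS⟩ := exists_arr_vec hn.le fun u =>
      ((Encodable.encode (List.ofFn fun w => A.prob u w) : ℕ) : ℝ)
    refine ⟨k, hlt bk, n, hlt bn, lo, hlt b7, le, hlt b9, lp, hlt b11, A.init, hlt b12, lf, hlt b3,
      lm, hlt b4, hcode, own, ed, pr, ob, μ, (lOwn _).mpr h1, (lOb _).mpr h4, (lM _).mpr rfl,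
      ⟨R, (lEd _).mpr hR, fun u _ hu => ⟨_, hlt (hrow ⟨u, hu⟩), hR ⟨u, hu⟩, ?_⟩⟩,
      ⟨S, Q, (lPr _).mpr hS, fun u _ hu => ⟨_, hlt (hrow' ⟨u, hu⟩), hS ⟨u, hu⟩, ?_,
        fun v _ hv => ?_⟩⟩, (key own ed pr ob μ rfl h1 h2 h3 h4).mpr h⟩
    · exact (isListCode_iff (A.edge ⟨u, hu⟩) hn (hlt (hrow _)) _ _).mpr (h2 ⟨u, hu⟩)
    · exact (isListCode_iff (A.prob ⟨u, hu⟩) hn (hlt (hrow' _)) _ _).mpr (h3' ⟨u, hu⟩)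
    · rw [h3' ⟨u, hu⟩ ⟨v, hv⟩]
      exact (isRatCode_iff (hlt (hent ⟨u, hu⟩ ⟨v, hv⟩)) _).mpr (h3 ⟨u, hu⟩ ⟨v, hv⟩)

/-! ### A small programming language -/

/-- Arithmetical operations that are computed by a single pass over the binary expansions. -/
inductive OpKind : Type
  | add : OpKind
  | land : OpKind
  | const : Bool → OpKind

/-- The result of an operation. -/
def OpKind.eval : OpKind → ℕ → ℕ → ℕ
  | add, x, y => x + y
  | land, x, y => x &&& y
  | const b, _, _ => b.toNat

/-- Programs with registers holding natural numbers. -/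
inductive Prog : Type
  | skip : Prog
  | op : OpKind → ℕ → ℕ → ℕ → Prog
  | seq : Prog → Prog → Prog
  | whileLt : ℕ → ℕ → Prog → Prog

/-- `Ex p s t s'` means that `p` started with registers `s` executes `t` instructions and
terminates with registers `s'`. -/
inductive Ex : Prog → (ℕ → ℕ) → ℕ → (ℕ → ℕ) → Prop
  | skip (s) : Ex Prog.skip s 0 s
  | op (k r x y s) : Ex (Prog.op k r x y) s 1 (Function.update s r (k.eval (s x) (s y)))
  | seq {p q s t s' t' s''} : Ex p s t s' → Ex q s' t' s'' → Ex (Prog.seq p q) s (t + t') s''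
  | done {p x y s} : ¬ s x < s y → Ex (Prog.whileLt x y p) s 1 s
  | step {p x y s t s' t' s''} : s x < s y → Ex p s t s' →
      Ex (Prog.whileLt x y p) s' t' s'' → Ex (Prog.whileLt x y p) s (t + t' + 2) s''

/-- Copying a block of registers. -/
def copyBlock (b : ℕ → ℕ) (o : ℕ) : ℕ → Prog
  | 0 => Prog.skip
  | w + 1 => Prog.seq (copyBlock b o w) (Prog.op OpKind.land (o + w) (b w) (b w))

lemma ex_copyBlock (b : ℕ → ℕ) (o w : ℕ) (s : ℕ → ℕ)
    (h : ∀ i < w, ∀ j < w, b i ≠ o + j) :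
    ∃ s', Ex (copyBlock b o w) s w s' ∧ (∀ j < w, s' (o + j) = s (b j)) ∧
      ∀ r, (∀ j < w, r ≠ o + j) → s' r = s r := by
  induction w with
  | zero => exact ⟨s, Ex.skip s, by simp, by simp⟩
  | succ w ih =>
    obtain ⟨s', h1, h2, h3⟩ := ih fun i hi j hj => h i (by omega) j (by omega)
    refine ⟨_, Ex.seq h1 (Ex.op _ _ _ _ _), fun j hj => ?_, fun r hr => ?_⟩
    · rcases Nat.lt_succ_iff_lt_or_eq.mp hj with hj' | rfl
      · rw [Function.update_of_ne (by omega), h2 j hj']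
      · rw [Function.update_self, h3 _ fun i hi => h j (by omega) i (by omega)]
        simp [OpKind.eval]
    · rw [Function.update_of_ne (hr w (by omega)), h3 r fun j hj => hr j (by omega)]

/-! ### Functions computed by programs -/

/-- The basic complexity parameter. -/
def param (N : ℕ) : ℕ := 2 ^ bound N

lemma two_le_param (N : ℕ) : 2 ≤ param N := by
  have : 2 ^ 1 ≤ param N := Nat.pow_le_pow_right (by norm_num) (by unfold bound; omega)
  simpa using this

/-- Quantities bounded by a power of the complexity parameter. -/
def PolyBd (u : ℕ → ℕ) : Prop := ∃ k, ∀ N, u N ≤ param N ^ k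

lemma param_pow_mono {N k l : ℕ} (h : k ≤ l) : param N ^ k ≤ param N ^ l :=
  Nat.pow_le_pow_right ((by norm_num : 0 < 2).trans_le (two_le_param N)) h

lemma PolyBd.pow (k : ℕ) : PolyBd (fun N => param N ^ k) := ⟨k, fun _ => le_rfl⟩

lemma PolyBd.const (n : ℕ) : PolyBd (fun _ => n) :=
  ⟨n, fun N => (Nat.lt_two_pow_self).le.trans (Nat.pow_le_pow_left (two_le_param N) n)⟩

lemma PolyBd.add {u v : ℕ → ℕ} (hu : PolyBd u) (hv : PolyBd v) : PolyBd (fun N => u N + v N) := by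
  obtain ⟨k, hk⟩ := hu
  obtain ⟨l, hl⟩ := hv
  refine ⟨k + l + 1, fun N => ?_⟩
  have h1 := (hk N).trans (param_pow_mono (N := N) (show k ≤ k + l by omega))
  have h2 := (hl N).trans (param_pow_mono (N := N) (show l ≤ k + l by omega))
  have h3 := two_le_param N
  rw [pow_succ]
  nlinarith

lemma PolyBd.mul {u v : ℕ → ℕ} (hu : PolyBd u) (hv : PolyBd v) : PolyBd (fun N => u N * v N) := by
  obtain ⟨k, hk⟩ := hu
  obtain ⟨l, hl⟩ := hv
  exact ⟨k + l, fun N => by rw [pow_add]; exact Nat.mul_le_mul (hk N) (hl N)⟩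

/-- Data stored in a fixed number of registers. -/
class Reg (γ : Type) where
  width : ℕ
  enc : γ → ℕ → ℕ

instance : Reg Unit := ⟨0, fun _ _ => 0⟩
instance : Reg ℕ := ⟨1, fun n _ => n⟩
instance {γ δ : Type} [Reg γ] [Reg δ] : Reg (γ × δ) :=
  ⟨Reg.width γ + Reg.width δ, fun p j =>
    if j < Reg.width γ then Reg.enc p.1 j else Reg.enc p.2 (j - Reg.width γ)⟩

section Computable

variable {γ δ ε σ : Type} [Reg γ] [Reg δ] [Reg ε] [Reg σ]

/-- The data `x` is stored in the registers given by `a`. -/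
def Stored (x : γ) (a : ℕ → ℕ) (s : ℕ → ℕ) : Prop := ∀ j < Reg.width γ, s (a j) = Reg.enc x j

/-- All components of `x` have at most `m` bits. -/
def Small (x : γ) (m : ℕ) : Prop := ∀ j < Reg.width γ, Reg.enc x j < 2 ^ m

lemma Small.mono {x : γ} {m m' : ℕ} (h : Small x m) (hm : m ≤ m') : Small x m' :=
  fun j hj => (h j hj).trans_le (Nat.pow_le_pow_right (by norm_num) hm)

lemma small_nat {n m : ℕ} : Small n m ↔ n < 2 ^ m :=
  ⟨fun h => h 0 (Nat.zero_lt_one), fun h _ _ => h⟩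

lemma stored_nat {n : ℕ} {a s : ℕ → ℕ} : Stored n a s ↔ s (a 0) = n :=
  ⟨fun h => h 0 (Nat.zero_lt_one), fun h j hj => by
    have : j = 0 := Nat.lt_one_iff.mp hj
    subst this
    exact h⟩

lemma small_prod {x : γ} {y : δ} {m : ℕ} : Small (x, y) m ↔ Small x m ∧ Small y m := by
  constructor
  · intro h
    refine ⟨fun j hj => ?_, fun j hj => ?_⟩
    · have := h j (Nat.lt_add_right _ hj)
      simpa [Reg.enc, hj] using this
    · have := h (Reg.width γ + j) (Nat.add_lt_add_left hj _)
      simpa [Reg.enc] using this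
  · rintro ⟨h1, h2⟩ j hj
    change j < Reg.width γ + Reg.width δ at hj
    by_cases h : j < Reg.width γ
    · simpa [Reg.enc, h] using h1 j h
    · simpa [Reg.enc, h] using h2 (j - Reg.width γ) (by omega)

lemma stored_prod {x : γ} {y : δ} {a s : ℕ → ℕ} :
    Stored (x, y) a s ↔ Stored x a s ∧ Stored y (fun j => a (Reg.width γ + j)) s := by
  constructor
  · intro h
    refine ⟨fun j hj => ?_, fun j hj => ?_⟩
    · have := h j (Nat.lt_add_right _ hj)
      simpa [Reg.enc, hj] using this
    · have := h (Reg.width γ + j) (Nat.add_lt_add_left hj _)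
      simpa [Reg.enc] using this
  · rintro ⟨h1, h2⟩ j hj
    change j < Reg.width γ + Reg.width δ at hj
    by_cases h : j < Reg.width γ
    · simpa [Reg.enc, h] using h1 j h
    · have := h2 (j - Reg.width γ) (by omega)
      simp only [show Reg.width γ + (j - Reg.width γ) = j by omega] at this
      simpa [Reg.enc, h] using this

/-- Two register assignments side by side. -/
def glue (w : ℕ) (a b : ℕ → ℕ) (j : ℕ) : ℕ := if j < w then a j else b (j - w)

lemma glue_lt {w w' e : ℕ} {a b : ℕ → ℕ} (ha : ∀ j < w, a j < e) (hb : ∀ j < w', b j < e) :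
    ∀ j < w + w', glue w a b j < e := by
  intro j hj
  unfold glue
  split_ifs with h
  · exact ha j h
  · exact hb _ (by omega)

lemma Stored.glue {x : γ} {y : δ} {a b s : ℕ → ℕ} (h1 : Stored x a s) (h2 : Stored y b s) :
    Stored (x, y) (glue (Reg.width γ) a b) s := by
  refine stored_prod.mpr ⟨fun j hj => ?_, fun j hj => ?_⟩
  · rw [NCRSPPaper.glue, if_pos hj, h1 j hj]
  · simp only [NCRSPPaper.glue]
    rw [if_neg (by omega), Nat.add_sub_cancel_left, h2 j hj]

lemma Stored.congr {x : γ} {a s s' : ℕ → ℕ} {e : ℕ} (h : Stored x a s)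
    (ha : ∀ j < Reg.width γ, a j < e) (hs : ∀ r < e, s' r = s r) : Stored x a s' :=
  fun j hj => by rw [hs _ (ha j hj), h j hj]

/-- The function `f` is computed by a program in time polynomial in the complexity parameter. -/
def Cmp (f : ℕ → γ → δ) : Prop :=
  ∀ (a : ℕ → ℕ) (e : ℕ), 0 < e → (∀ j < Reg.width γ, a j < e) →
    ∃ (p : Prog) (b : ℕ → ℕ) (e' : ℕ), e ≤ e' ∧ (∀ j < Reg.width δ, b j < e') ∧
      ∀ c, ∃ k, ∀ N x s, s 0 = N → Stored x a s → Small x (param N ^ c) →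
        Small (f N x) (param N ^ k) ∧ ∃ t ≤ param N ^ k, ∃ s', Ex p s t s' ∧
          (∀ r < e, s' r = s r) ∧ Stored (f N x) b s'

lemma Cmp.small {f : ℕ → γ → δ} (hf : Cmp f) (c : ℕ) :
    ∃ k, ∀ N x, Small x (param N ^ c) → Small (f N x) (param N ^ k) := by
  obtain ⟨p, b, _, -, -, h⟩ := hf (fun j => j + 1) (Reg.width γ + 1) (by omega) (by simp)
  obtain ⟨k, hk⟩ := h c
  exact ⟨k, fun N x hx =>
    (hk N x (fun j => if j = 0 then N else Reg.enc x (j - 1)) rfl (fun _ _ => rfl) hx).1⟩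

lemma Cmp.id : Cmp (fun _ (x : γ) => x) := fun a e _ ha =>
  ⟨Prog.skip, a, e, le_rfl, ha, fun c => ⟨c, fun _ _ s _ hx hb =>
    ⟨hb, 0, Nat.zero_le _, s, Ex.skip s, fun _ _ => rfl, hx⟩⟩⟩

lemma Cmp.comp {g : ℕ → δ → ε} {f : ℕ → γ → δ} (hg : Cmp g) (hf : Cmp f) :
    Cmp (fun N x => g N (f N x)) := by
  intro a e he ha
  obtain ⟨p, b, e1, he1, hb, h1⟩ := hf a e he ha
  obtain ⟨q, b', e2, he2, hb', h2⟩ := hg b e1 (by omega) hb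
  refine ⟨Prog.seq p q, b', e2, he1.trans he2, hb', fun c => ?_⟩
  obtain ⟨k, hk⟩ := h1 c
  obtain ⟨l, hl⟩ := h2 k
  obtain ⟨m, hm⟩ := (PolyBd.pow k).add (PolyBd.pow l)
  refine ⟨m, fun N x s hs hx hc => ?_⟩
  obtain ⟨hy, t, ht, s', hE, hp, hst⟩ := hk N x s hs hx hc
  obtain ⟨hz, t', ht', s'', hE', hp', hst'⟩ := hl N _ s' (by rw [hp 0 he, hs]) hst hy
  refine ⟨hz.mono ((Nat.le_add_left _ _).trans (hm N)), t + t', ?_, s'', hE.seq hE',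
    fun r hr => ?_, hst'⟩
  · exact (Nat.add_le_add ht ht').trans (hm N)
  · rw [hp' r (by omega), hp r hr]

lemma Cmp.prodMk {f : ℕ → γ → δ} {g : ℕ → γ → ε} (hf : Cmp f) (hg : Cmp g) :
    Cmp (fun N x => (f N x, g N x)) := by
  intro a e he ha
  obtain ⟨p, b, e1, he1, hb, h1⟩ := hf a e he ha
  obtain ⟨q, b', e2, he2, hb', h2⟩ := hg a e1 (by omega) fun j hj => (ha j hj).trans_le he1
  refine ⟨Prog.seq p q, glue (Reg.width δ) b b', e2, he1.trans he2,
    glue_lt (fun j hj => (hb j hj).trans_le he2) hb', fun c => ?_⟩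
  obtain ⟨k, hk⟩ := h1 c
  obtain ⟨l, hl⟩ := h2 c
  obtain ⟨m, hm⟩ := (PolyBd.pow k).add (PolyBd.pow l)
  refine ⟨m, fun N x s hs hx hc => ?_⟩
  obtain ⟨hy, t, ht, s', hE, hp, hst⟩ := hk N x s hs hx hc
  obtain ⟨hz, t', ht', s'', hE', hp', hst'⟩ := hl N x s' (by rw [hp 0 he, hs])
    (hx.congr ha hp) hc
  refine ⟨small_prod.mpr ⟨hy.mono ((Nat.le_add_right _ _).trans (hm N)),
    hz.mono ((Nat.le_add_left _ _).trans (hm N))⟩, t + t', ?_, s'', hE.seq hE',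
    fun r hr => ?_, (hst.congr hb hp').glue hst'⟩
  · exact (Nat.add_le_add ht ht').trans (hm N)
  · rw [hp' r (by omega), hp r hr]

lemma Cmp.fst' : Cmp (fun _ (x : γ × δ) => x.1) := fun a e _ ha =>
  ⟨Prog.skip, a, e, le_rfl, fun j hj => ha j (Nat.lt_add_right _ hj), fun c => ⟨c,
    fun _ _ s _ hx hb => ⟨(small_prod.mp hb).1, 0, Nat.zero_le _, s, Ex.skip s, fun _ _ => rfl,
      (stored_prod.mp hx).1⟩⟩⟩

lemma Cmp.snd' : Cmp (fun _ (x : γ × δ) => x.2) := fun a e _ ha =>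
  ⟨Prog.skip, fun j => a (Reg.width γ + j), e, le_rfl,
    fun _ hj => ha _ (Nat.add_lt_add_left hj _), fun c => ⟨c,
    fun _ _ s _ hx hb => ⟨(small_prod.mp hb).2, 0, Nat.zero_le _, s, Ex.skip s, fun _ _ => rfl,
      (stored_prod.mp hx).2⟩⟩⟩

lemma Cmp.fst {f : ℕ → γ → δ × ε} (hf : Cmp f) : Cmp (fun N x => (f N x).1) :=
  Cmp.fst'.comp hf

lemma Cmp.snd {f : ℕ → γ → δ × ε} (hf : Cmp f) : Cmp (fun N x => (f N x).2) :=
  Cmp.snd'.comp hf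

lemma lt_two_pow_param (N : ℕ) : N < 2 ^ param N := by
  have h1 : Nat.size N ≤ bound N := by unfold bound; nlinarith
  exact (Nat.lt_size_self N).trans_le
    (Nat.pow_le_pow_right (by norm_num) (h1.trans (Nat.lt_two_pow_self).le))

lemma Cmp.input : Cmp (fun N (_ : γ) => N) := fun a e he _ =>
  ⟨Prog.skip, fun _ => 0, e, le_rfl, fun _ _ => he, fun c => ⟨1,
    fun N _ s hs _ _ => ⟨small_nat.mpr (by rw [pow_one]; exact lt_two_pow_param N), 0,
      Nat.zero_le _, s, Ex.skip s, fun _ _ => rfl, stored_nat.mpr hs⟩⟩⟩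

lemma OpKind.eval_lt (k : OpKind) {x y m : ℕ} (hx : x < 2 ^ m) (hy : y < 2 ^ m) :
    k.eval x y < 2 ^ (m + 1) := by
  have h : 2 ^ m < 2 ^ (m + 1) := Nat.pow_lt_pow_right (by norm_num) (by omega)
  cases k with
  | add => rw [eval, pow_succ]; omega
  | land => exact (Nat.and_le_left.trans_lt hx).trans h
  | const b =>
    have : 1 ≤ 2 ^ m := Nat.one_le_two_pow
    cases b <;> simp [eval]

lemma Cmp.op' (k : OpKind) : Cmp (fun _ (x : ℕ × ℕ) => k.eval x.1 x.2) := by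
  intro a e he ha
  refine ⟨Prog.op k e (a 0) (a 1), fun _ => e, e + 1, by omega, fun _ _ => Nat.lt_succ_self e,
    fun c => ?_⟩
  obtain ⟨m, hm⟩ := (PolyBd.pow c).add (PolyBd.const 1)
  refine ⟨m, fun N x s hs hx hc => ?_⟩
  obtain ⟨x, y⟩ := x
  obtain ⟨h1, h2⟩ := small_prod.mp hc
  obtain ⟨h3, h4⟩ := stored_prod.mp hx
  rw [small_nat] at h1 h2
  rw [stored_nat] at h3 h4
  refine ⟨small_nat.mpr ((k.eval_lt h1 h2).trans_le (Nat.pow_le_pow_right (by norm_num) (hm N))),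
    1, (Nat.le_add_left _ _).trans (hm N), _, Ex.op _ _ _ _ _, fun r hr => ?_, ?_⟩
  · rw [Function.update_of_ne (by omega)]
  · rw [stored_nat, Function.update_self]
    rw [h3]
    exact congrArg _ h4

lemma Cmp.add {f g : ℕ → γ → ℕ} (hf : Cmp f) (hg : Cmp g) : Cmp (fun N x => f N x + g N x) :=
  (Cmp.op' OpKind.add).comp (hf.prodMk hg)

lemma Cmp.land {f g : ℕ → γ → ℕ} (hf : Cmp f) (hg : Cmp g) :
    Cmp (fun N x => f N x &&& g N x) :=
  (Cmp.op' OpKind.land).comp (hf.prodMk hg)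

lemma Cmp.const (n : ℕ) : Cmp (fun _ (_ : γ) => n) := by
  have h (b : Bool) : Cmp (fun _ (_ : γ) => b.toNat) :=
    (Cmp.op' (OpKind.const b)).comp (Cmp.input.prodMk Cmp.input)
  induction n with
  | zero => exact h false
  | succ n ih => exact ih.add (h true)

/-- Selection between two values. -/
lemma Cmp.ite' : Cmp (fun _ (x : (ℕ × ℕ) × (ℕ × ℕ)) => if x.1.1 < x.1.2 then x.2.1 else x.2.2) := by
  intro a e he ha
  refine ⟨Prog.seq (Prog.op OpKind.land (e + 1) (a 0) (a 0)) (Prog.seq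
    (Prog.op OpKind.land e (a 3) (a 3)) (Prog.whileLt (e + 1) (a 1) (Prog.seq
    (Prog.op OpKind.land e (a 2) (a 2)) (Prog.op OpKind.land (e + 1) (a 1) (a 1))))),
    fun _ => e, e + 2, by omega, fun _ _ => Nat.lt_add_of_pos_right (by norm_num), fun c => ?_⟩
  obtain ⟨m, hm⟩ := (PolyBd.pow c).add (PolyBd.const 7)
  refine ⟨m, fun N x s hs hx hc => ?_⟩
  obtain ⟨⟨u, v⟩, x, y⟩ := x
  have a0 := ha 0 (by decide)
  have a1 := ha 1 (by decide)
  have a2 := ha 2 (by decide)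
  have a3 := ha 3 (by decide)
  have h0 : s (a 0) = u := hx 0 (by decide)
  have h1 : s (a 1) = v := hx 1 (by decide)
  have h2 : s (a 2) = x := hx 2 (by decide)
  have h3 : s (a 3) = y := hx 3 (by decide)
  have b2 : x < 2 ^ param N ^ c := hc 2 (by decide)
  have b3 : y < 2 ^ param N ^ c := hc 3 (by decide)
  refine ⟨small_nat.mpr (lt_of_lt_of_le (b := 2 ^ param N ^ c) ?_
    (Nat.pow_le_pow_right (by norm_num) ((Nat.le_add_right _ _).trans (hm N)))), ?_⟩
  · dsimp only
    split_ifs <;> assumption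
  by_cases huv : u < v
  · refine ⟨_, ?_, _, Ex.seq (Ex.op _ _ _ _ _) (Ex.seq (Ex.op _ _ _ _ _)
      (Ex.step ?_ (Ex.seq (Ex.op _ _ _ _ _) (Ex.op _ _ _ _ _)) (Ex.done ?_))),
      fun r hr => ?_, ?_⟩
    · exact (Nat.le_add_left _ _).trans (hm N)
    · simp (disch := omega) [Function.update_of_ne, OpKind.eval, h0, h1, huv]
    · simp (disch := omega) [Function.update_of_ne, OpKind.eval]
    · simp (disch := omega) [Function.update_of_ne]
    · rw [stored_nat]
      simp (disch := omega) [Function.update_of_ne, OpKind.eval, h2, huv]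
  · refine ⟨_, ?_, _, Ex.seq (Ex.op _ _ _ _ _) (Ex.seq (Ex.op _ _ _ _ _) (Ex.done ?_)),
      fun r hr => ?_, ?_⟩
    · exact le_trans (show _ ≤ param N ^ c + 7 by omega) (hm N)
    · simp (disch := omega) [Function.update_of_ne, OpKind.eval, h0, h1, huv]
    · simp (disch := omega) [Function.update_of_ne]
    · rw [stored_nat]
      simp (disch := omega) [Function.update_of_ne, OpKind.eval, h3, huv]

lemma Cmp.ite {u v f g : ℕ → γ → ℕ} (hu : Cmp u) (hv : Cmp v) (hf : Cmp f) (hg : Cmp g) :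
    Cmp (fun N x => if u N x < v N x then f N x else g N x) :=
  Cmp.ite'.comp ((hu.prodMk hv).prodMk (hf.prodMk hg))

end Computable

/-! ### Iteration -/

lemma ex_loop {M X n K : ℕ} {body : Prog} {I : ℕ → (ℕ → ℕ) → Prop}
    (hguard : ∀ i s, I i s → (s M < s X ↔ i < n))
    (hbody : ∀ i < n, ∀ s, I i s → ∃ t ≤ K, ∃ s', Ex body s t s' ∧ I (i + 1) s') (d : ℕ) :
    ∀ i s, i + d = n → I i s →
      ∃ t ≤ d * (K + 2) + 1, ∃ s', Ex (Prog.whileLt M X body) s t s' ∧ I n s' := by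
  induction d with
  | zero =>
    intro i s hi h
    refine ⟨1, by omega, s, Ex.done ?_, by rwa [← hi]⟩
    rw [hguard i s h]
    omega
  | succ d ih =>
    intro i s hi h
    obtain ⟨t, ht, s', hE, h'⟩ := hbody i (by omega) s h
    obtain ⟨t', ht', s'', hE', h''⟩ := ih (i + 1) s' (by omega) h'
    refine ⟨_, ?_, s'', Ex.step ((hguard i s h).mpr (by omega)) hE hE', h''⟩
    rw [Nat.add_mul]
    omega

section Iteration

variable {γ σ : Type} [Reg γ] [Reg σ]

/-- Iteration along the binary expansion of a number. -/
lemma Cmp.iterate {x : ℕ → γ → ℕ} {init : ℕ → γ → σ} {step : ℕ → γ × σ → σ} (hx : Cmp x)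
    (hi : Cmp init) (hs : Cmp step)
    (hgrow : ∀ c, ∃ k, ∀ N g, Small g (param N ^ c) → ∀ i ≤ Nat.size (x N g),
      Small ((fun st => step N (g, st))^[i] (init N g)) (param N ^ k)) :
    Cmp (fun N g => (fun st => step N (g, st))^[Nat.size (x N g)] (init N g)) := by
  intro a e he ha
  obtain ⟨p, b, e1, he1, hb, h1⟩ := hx a e he ha
  have ha1 : ∀ j < Reg.width γ, a j < e1 := fun j hj => (ha j hj).trans_le he1
  obtain ⟨q, b', e2, he2, hb', h2⟩ := hi a e1 (by omega) ha1
  have ha2 : ∀ j < Reg.width γ, a j < e2 := fun j hj => (ha1 j hj).trans_le he2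
  set w := Reg.width σ with hw
  set M := e2 + w with hM
  obtain ⟨r, b'', e4, he4, hb'', h3⟩ := hs (glue (Reg.width γ) a (fun j => e2 + j)) (M + 2)
    (by omega)
    (glue_lt (fun j hj => (ha2 j hj).trans_le (by omega))
      (fun j (hj : j < w) => show e2 + j < M + 2 by omega))
  set body := Prog.seq r (Prog.seq (copyBlock b'' e4 w) (Prog.seq
    (copyBlock (fun j => e4 + j) e2 w) (Prog.op OpKind.add M M M))) with hbody
  refine ⟨Prog.seq p (Prog.seq q (Prog.seq (copyBlock b' e2 w) (Prog.seq
    (Prog.op (OpKind.const true) M M M) (Prog.seq (Prog.op OpKind.add (M + 1) (b 0) M)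
    (Prog.whileLt M (M + 1) body))))), fun j => e2 + j, e4, by omega,
    fun j (hj : j < w) => show e2 + j < e4 by omega, fun c => ?_⟩
  obtain ⟨kx, hkx⟩ := h1 c
  obtain ⟨ki, hki⟩ := h2 c
  obtain ⟨kg, hkg⟩ := hgrow c
  obtain ⟨ks, hks⟩ := h3 (c + kg)
  obtain ⟨kt, hkt⟩ := ((PolyBd.pow kx).add ((PolyBd.pow ki).add ((PolyBd.const (w + 3)).add
    ((PolyBd.pow kx).mul ((PolyBd.pow ks).add (PolyBd.const (w + w + 1 + 2)))))))
  refine ⟨kt + kg, fun N g s hs0 hg hc => ?_⟩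
  refine ⟨(hkg N g hc _ le_rfl).mono (param_pow_mono (by omega)), ?_⟩
  obtain ⟨hxs, t1, ht1, s1, hE1, hp1, hst1⟩ := hkx N g s hs0 hg hc
  have hg1 := hg.congr ha hp1
  obtain ⟨his, t2, ht2, s2, hE2, hp2, hst2⟩ := hki N g s1 (by rw [hp1 0 he, hs0]) hg1 hc
  have hg2 := hg1.congr ha1 hp2
  have hst12 := hst1.congr hb hp2
  rw [stored_nat] at hst12
  obtain ⟨s3, hE3, hc3, hp3⟩ := ex_copyBlock b' e2 w s2 fun i hi j hj => by
    have := hb' i hi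
    omega
  set n := Nat.size (x N g) with hn
  have hnx : n ≤ param N ^ kx := Nat.size_le.mpr (small_nat.mp hxs)
  set it : ℕ → σ := fun i => (fun st => step N (g, st))^[i] (init N g) with hit
  let I : ℕ → (ℕ → ℕ) → Prop := fun i s' => (∀ r < e2, s' r = s2 r) ∧
    Stored (it i) (fun j => e2 + j) s' ∧ s' M = 2 ^ i ∧ s' (M + 1) = x N g + 1
  have hguard : ∀ i s', I i s' → (s' M < s' (M + 1) ↔ i < n) := by
    rintro i s' ⟨-, -, h5, h6⟩
    rw [h5, h6, hn, Nat.lt_size]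
    omega
  have hstep : ∀ i < n, ∀ s', I i s' → ∃ t ≤ param N ^ ks + (w + w + 1), ∃ s'',
      Ex body s' t s'' ∧ I (i + 1) s'' := by
    rintro i hin s' ⟨h5, h6, h7, h8⟩
    have h0 : s' 0 = N := by rw [h5 0 (by omega), hp2 0 (by omega), hp1 0 he, hs0]
    obtain ⟨-, t, ht, s4, hE4, hp4, hst4⟩ := hks N (g, it i) s' h0
      ((hg2.congr ha2 h5).glue h6) (small_prod.mpr ⟨hc.mono (param_pow_mono (by omega)),
        (hkg N g hc i hin.le).mono (param_pow_mono (by omega))⟩)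
    obtain ⟨s5, hE5, hc5, hp5⟩ := ex_copyBlock b'' e4 w s4 fun i hi j hj => by
      have := hb'' i hi
      omega
    obtain ⟨s6, hE6, hc6, hp6⟩ := ex_copyBlock (fun j => e4 + j) e2 w s5 fun i hi j hj => by
      omega
    refine ⟨_, ?_, _, hE4.seq (hE5.seq (hE6.seq (Ex.op _ _ _ _ _))), fun r hr => ?_,
      fun j hj => ?_, ?_, ?_⟩
    · omega
    · rw [Function.update_of_ne (by omega), hp6 r fun j _ => by omega, hp5 r fun j _ => by omega,
        hp4 r (by omega), h5 r hr]
    · change j < w at hj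
      rw [show (fun j => e2 + j) j = e2 + j from rfl, Function.update_of_ne (by omega), hc6 j hj,
        hc5 j hj, hst4 j hj, hit]
      simp only [Function.iterate_succ_apply']
    · rw [Function.update_self, hp6 M fun j _ => by omega, hp5 M fun j _ => by omega,
        hp4 M (by omega), h7, OpKind.eval, pow_succ]
      omega
    · rw [Function.update_of_ne (by omega), hp6 _ fun j _ => by omega,
        hp5 _ fun j _ => by omega, hp4 _ (by omega), h8]
  have hI0 : I 0 (Function.update (Function.update s3 M 1) (M + 1) (x N g + 1)) := by
    refine ⟨fun r hr => ?_, fun j hj => ?_, ?_, ?_⟩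
    · rw [Function.update_of_ne (by omega), Function.update_of_ne (by omega),
        hp3 r fun j _ => by omega]
    · change j < w at hj
      rw [show (fun j => e2 + j) j = e2 + j from rfl, Function.update_of_ne (by omega),
        Function.update_of_ne (by omega), hc3 j hj,
        hst2 j hj]
      rfl
    · rw [Function.update_of_ne (by omega), Function.update_self, pow_zero]
    · rw [Function.update_self]
  obtain ⟨t7, ht7, s7, hE7, hI7⟩ := ex_loop hguard hstep n 0 _ (by omega) hI0
  have hb0 : b 0 < e1 := hb 0 Nat.zero_lt_one
  refine ⟨t1 + (t2 + (w + (1 + (1 + t7)))), ?_, s7, hE1.seq (hE2.seq (hE3.seq ((Ex.op _ _ _ _ _).seq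
    ((Ex.op _ _ _ _ _).seq ?_)))), fun r hr => ?_, hI7.2.1⟩
  · refine le_trans ?_ (param_pow_mono (show kt ≤ kt + kg by omega))
    refine le_trans ?_ (hkt N)
    have := Nat.mul_le_mul_right (param N ^ ks + (w + w + 1 + 2)) hnx
    simp only [← add_assoc] at this ht7 ⊢
    omega
  · have hv : OpKind.add.eval (Function.update s3 M 1 (b 0)) (Function.update s3 M 1 M) =
        x N g + 1 := by
      rw [Function.update_of_ne (by omega), Function.update_self,
        hp3 (b 0) fun j _ => by omega, hst12, OpKind.eval]
    rw [← hv] at hE7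
    exact hE7
  · rw [hI7.1 r (by omega), hp2 r (by omega), hp1 r hr]

end Iteration

/-! ### Basic arithmetical functions -/

section Arithmetic

variable {γ δ ε σ : Type} [Reg γ] [Reg δ] [Reg ε] [Reg σ]

lemma mulStep_iterate (a b i : ℕ) :
    (fun st : ℕ × ℕ × ℕ => (if 0 < b &&& st.2.2 then st.1 + st.2.1 else st.1,
      st.2.1 + st.2.1, st.2.2 + st.2.2))^[i] (0, a, 1) = (a * (b % 2 ^ i), a * 2 ^ i, 2 ^ i) := by
  induction i with
  | zero => simp [Nat.mod_one]
  | succ i ih =>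
    rw [Function.iterate_succ_apply', ih]
    simp only [Nat.and_two_pow, Nat.mod_pow_succ, ← Nat.toNat_testBit, Prod.mk.injEq]
    refine ⟨?_, by ring, by ring⟩
    cases h : b.testBit i
    · simp
    · simp [Nat.mul_add]

lemma Cmp.mul' : Cmp (fun _ (x : ℕ × ℕ) => x.1 * x.2) := by
  have h := Cmp.iterate (γ := ℕ × ℕ) (σ := ℕ × ℕ × ℕ) (x := fun _ g => g.2)
    (init := fun _ g => (0, g.1, 1))
    (step := fun _ y => (if 0 < y.1.2 &&& y.2.2.2 then y.2.1 + y.2.2.1 else y.2.1,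
      y.2.2.1 + y.2.2.1, y.2.2.2 + y.2.2.2)) Cmp.snd'
    ((Cmp.const 0).prodMk (Cmp.fst'.prodMk (Cmp.const 1)))
    ((Cmp.ite (Cmp.const 0) (Cmp.land Cmp.fst'.snd Cmp.snd'.snd.snd)
      (Cmp.snd'.fst.add Cmp.snd'.snd.fst) Cmp.snd'.fst).prodMk
      ((Cmp.snd'.snd.fst.add Cmp.snd'.snd.fst).prodMk (Cmp.snd'.snd.snd.add Cmp.snd'.snd.snd)))
    (by
      intro c
      obtain ⟨k, hk⟩ := ((PolyBd.pow c).add (PolyBd.pow c)).add (PolyBd.const 1)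
      refine ⟨k, ?_⟩
      rintro N ⟨a, b⟩ hg i hi
      obtain ⟨ha, hb⟩ := small_prod.mp hg
      rw [small_nat] at ha hb
      dsimp only at hi ⊢
      rw [mulStep_iterate]
      have hi' : i ≤ param N ^ c := hi.trans (Nat.size_le.mpr hb)
      have h1 : 2 ^ i ≤ 2 ^ param N ^ c := Nat.pow_le_pow_right (by norm_num) hi'
      have h2 : 2 ^ (param N ^ c + param N ^ c + 1) ≤ 2 ^ param N ^ k :=
        Nat.pow_le_pow_right (by norm_num) (hk N)
      have h3 : 0 < 2 ^ param N ^ c := by positivity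
      have h4 : b % 2 ^ i < 2 ^ i := Nat.mod_lt _ (by positivity)
      rw [pow_succ, pow_add] at h2
      refine small_prod.mpr ⟨small_nat.mpr ?_, small_prod.mpr ⟨small_nat.mpr ?_, small_nat.mpr ?_⟩⟩
      · nlinarith
      · nlinarith
      · nlinarith)
  have h2 := h.fst
  simp only [mulStep_iterate] at h2
  convert h2 using 3 with N x
  rw [Nat.mod_eq_of_lt (Nat.lt_size_self _)]

lemma Cmp.mul {f g : ℕ → γ → ℕ} (hf : Cmp f) (hg : Cmp g) : Cmp (fun N x => f N x * g N x) :=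
  Cmp.mul'.comp (hf.prodMk hg)

lemma Cmp.pair {f g : ℕ → γ → ℕ} (hf : Cmp f) (hg : Cmp g) :
    Cmp (fun N x => Nat.pair (f N x) (g N x)) :=
  Cmp.ite hf hg ((hg.mul hg).add hf) (((hf.mul hf).add hf).add hg)

lemma Cmp.size {x : ℕ → γ → ℕ} (hx : Cmp x) : Cmp (fun N g => Nat.size (x N g)) := by
  have hit (i : ℕ) : (fun st => st + 1)^[i] 0 = i := by
    induction i with
    | zero => rfl
    | succ i ih => rw [Function.iterate_succ_apply', ih]
  have h := Cmp.iterate hx (Cmp.const 0) (Cmp.snd'.add (Cmp.const 1)) (by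
    intro c
    obtain ⟨k, hk⟩ := hx.small c
    refine ⟨k, fun N g hg i hi => ?_⟩
    rw [hit]
    exact small_nat.mpr (Nat.lt_two_pow_self.trans_le (Nat.pow_le_pow_right (by norm_num)
      (hi.trans (Nat.size_le.mpr (small_nat.mp (hk N g hg)))))))
  simpa only [hit] using h

lemma mul_iterate_one (w i : ℕ) : (fun st => st * w)^[i] 1 = w ^ i := by
  induction i with
  | zero => rfl
  | succ i ih => rw [Function.iterate_succ_apply', ih, pow_succ]

lemma Cmp.two_pow_size {x : ℕ → γ → ℕ} (hx : Cmp x) : Cmp (fun N g => 2 ^ Nat.size (x N g)) := by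
  have h := Cmp.iterate hx (Cmp.const 1) (Cmp.snd'.mul (Cmp.const 2)) (by
    intro c
    obtain ⟨k, hk⟩ := hx.small c
    obtain ⟨k', hk'⟩ := (PolyBd.pow k).add (PolyBd.const 1)
    refine ⟨k', fun N g hg i hi => ?_⟩
    rw [mul_iterate_one]
    have := hi.trans (Nat.size_le.mpr (small_nat.mp (hk N g hg)))
    exact small_nat.mpr (Nat.pow_lt_pow_right (by norm_num)
      ((Nat.lt_succ_of_le this).trans_le (hk' N))))
  simpa only [mul_iterate_one] using h

lemma Cmp.two_pow_sq : Cmp (fun N (_ : γ) => 2 ^ ((Nat.size N + 1) * (Nat.size N + 1))) := by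
  have h := Cmp.iterate (γ := γ) Cmp.input.two_pow_size (Cmp.const 1)
    (Cmp.snd'.mul (Cmp.input.two_pow_size.mul (Cmp.const 2))) (by
      intro c
      refine ⟨1, fun N g _ i hi => ?_⟩
      rw [mul_iterate_one]
      rw [Nat.size_pow] at hi
      rw [small_nat, pow_one, ← pow_succ, ← pow_mul]
      refine Nat.pow_lt_pow_right (by norm_num) ?_
      have h1 : (Nat.size N + 1) * i ≤ (Nat.size N + 1) * (Nat.size N + 1) :=
        Nat.mul_le_mul_left _ hi
      have h2 : bound N < param N := Nat.lt_two_pow_self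
      unfold bound at h2
      omega)
  simp only [mul_iterate_one, Nat.size_pow, ← pow_succ, ← pow_mul] at h
  exact h

lemma Cmp.bound : Cmp (fun N (_ : γ) => NCRSPPaper.bound N) := by
  have h := (Cmp.two_pow_sq (γ := γ)).size
  simp only [Nat.size_pow] at h
  exact h

/-! ### Iterations of functions of linear growth -/

/-- The bit length of the result is linear in the bit length of the argument. -/
def Lin (f : ℕ → γ → δ) : Prop :=
  ∃ q, ∀ N x m, 1 ≤ m → Nat.size N ≤ m → Small x m → Small (f N x) (q * m)

lemma Lin.id : Lin (fun _ (x : γ) => x) := ⟨1, fun _ _ m _ _ h => by rwa [one_mul]⟩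

lemma Lin.prodMk {f : ℕ → γ → δ} {g : ℕ → γ → ε} (hf : Lin f) (hg : Lin g) :
    Lin (fun N x => (f N x, g N x)) := by
  obtain ⟨p, hp⟩ := hf
  obtain ⟨q, hq⟩ := hg
  exact ⟨p + q, fun N x m h1 h2 h => small_prod.mpr
    ⟨(hp N x m h1 h2 h).mono (Nat.mul_le_mul_right _ (by omega)),
      (hq N x m h1 h2 h).mono (Nat.mul_le_mul_right _ (by omega))⟩⟩

lemma Lin.fst {f : ℕ → γ → δ × ε} (hf : Lin f) : Lin (fun N x => (f N x).1) := by
  obtain ⟨p, hp⟩ := hf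
  exact ⟨p, fun N x m h1 h2 h => (small_prod.mp (hp N x m h1 h2 h)).1⟩

lemma Lin.snd {f : ℕ → γ → δ × ε} (hf : Lin f) : Lin (fun N x => (f N x).2) := by
  obtain ⟨p, hp⟩ := hf
  exact ⟨p, fun N x m h1 h2 h => (small_prod.mp (hp N x m h1 h2 h)).2⟩

lemma Lin.const (n : ℕ) : Lin (fun _ (_ : γ) => n) :=
  ⟨n, fun _ _ m h _ _ => small_nat.mpr (Nat.lt_two_pow_self.trans_le
    (Nat.pow_le_pow_right (by norm_num) (Nat.le_mul_of_pos_right _ h)))⟩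

lemma Lin.binary {f g : ℕ → γ → ℕ} {o : ℕ → ℕ → ℕ} (hf : Lin f) (hg : Lin g)
    (ho : ∀ x y m, x < 2 ^ m → y < 2 ^ m → o x y < 2 ^ (2 * m + 1)) :
    Lin (fun N x => o (f N x) (g N x)) := by
  obtain ⟨p, hp⟩ := hf
  obtain ⟨q, hq⟩ := hg
  refine ⟨2 * (p + q) + 1, fun N x m h1 h2 h => small_nat.mpr ?_⟩
  refine (ho _ _ ((p + q) * m) ?_ ?_).trans_le (Nat.pow_le_pow_right (by norm_num) ?_)
  · exact small_nat.mp ((hp N x m h1 h2 h).mono (Nat.mul_le_mul_right _ (by omega)))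
  · exact small_nat.mp ((hq N x m h1 h2 h).mono (Nat.mul_le_mul_right _ (by omega)))
  · rw [add_mul (2 * (p + q)) 1 m, one_mul, mul_assoc]
    omega

lemma Lin.add {f g : ℕ → γ → ℕ} (hf : Lin f) (hg : Lin g) : Lin (fun N x => f N x + g N x) :=
  hf.binary hg fun _ _ m h1 h2 => (OpKind.add.eval_lt h1 h2).trans_le
    (Nat.pow_le_pow_right (by norm_num) (by omega))

lemma Lin.pair {f g : ℕ → γ → ℕ} (hf : Lin f) (hg : Lin g) :
    Lin (fun N x => Nat.pair (f N x) (g N x)) :=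
  hf.binary hg fun x y m h1 h2 => by
    refine (Nat.pair_lt_max_add_one_sq x y).trans_le ?_
    have h : max x y + 1 ≤ 2 ^ m := max_lt h1 h2
    calc (max x y + 1) ^ 2 ≤ (2 ^ m) ^ 2 := Nat.pow_le_pow_left h 2
      _ = 2 ^ (m * 2) := by rw [pow_mul]
      _ ≤ 2 ^ (2 * m + 1) := Nat.pow_le_pow_right (by norm_num) (by omega)

lemma Lin.ite {u v f g : ℕ → γ → ℕ} (hf : Lin f) (hg : Lin g) :
    Lin (fun N x => if u N x < v N x then f N x else g N x) := by
  obtain ⟨p, hp⟩ := hf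
  obtain ⟨q, hq⟩ := hg
  refine ⟨p + q, fun N x m h1 h2 h => ?_⟩
  dsimp only
  split_ifs
  · exact (hp N x m h1 h2 h).mono (Nat.mul_le_mul_right _ (by omega))
  · exact (hq N x m h1 h2 h).mono (Nat.mul_le_mul_right _ (by omega))

lemma Cmp.iterate_bound {init : ℕ → γ → σ} {step : ℕ → γ × σ → σ} (hi : Cmp init) (hs : Cmp step)
    (hl : Lin step) : Cmp (fun N g => (fun st => step N (g, st))^[NCRSPPaper.bound N] (init N g))
      := by
  have h := Cmp.iterate Cmp.two_pow_sq hi hs (by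
    intro c
    obtain ⟨q, hq⟩ := hl
    obtain ⟨k, hk⟩ := hi.small c
    obtain ⟨l, hl⟩ := (PolyBd.pow (q + 1)).mul (PolyBd.pow (c + k + 1))
    refine ⟨l, fun N g hg i hi => ?_⟩
    rw [Nat.size_pow] at hi
    set m := param N ^ (c + k + 1) with hm
    have h1 : 1 ≤ m := Nat.one_le_pow _ _ ((by norm_num : 0 < 2).trans_le (two_le_param N))
    have h2 : Nat.size N ≤ m := by
      calc Nat.size N ≤ param N := Nat.size_le.mpr (lt_two_pow_param N)
        _ = param N ^ 1 := (pow_one _).symm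
        _ ≤ m := param_pow_mono (by omega)
    have key : ∀ j, Small ((fun st => step N (g, st))^[j] (init N g)) ((q + 1) ^ j * m) := by
      intro j
      induction j with
      | zero =>
        rw [pow_zero, one_mul]
        exact (hk N g hg).mono (param_pow_mono (by omega))
      | succ j ih =>
        rw [Function.iterate_succ_apply']
        have h3 : m ≤ (q + 1) ^ j * m := Nat.le_mul_of_pos_left _ (by positivity)
        refine (hq N _ ((q + 1) ^ j * m) (h1.trans h3) (h2.trans h3)
          (small_prod.mpr ⟨hg.mono ((param_pow_mono (by omega)).trans h3), ih⟩)).mono ?_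
        rw [pow_succ, ← mul_assoc, mul_comm q, mul_right_comm]
        exact (Nat.mul_le_mul_left _ (by omega : q ≤ q + 1)).trans_eq (by ring)
    refine (key i).mono ((Nat.mul_le_mul_right m ?_).trans (hl N))
    calc (q + 1) ^ i ≤ (q + 1) ^ (NCRSPPaper.bound N) := Nat.pow_le_pow_right (by omega) hi
      _ ≤ (2 ^ (q + 1)) ^ (NCRSPPaper.bound N) := Nat.pow_le_pow_left Nat.lt_two_pow_self.le _
      _ = param N ^ (q + 1) := by rw [param, ← pow_mul, ← pow_mul, mul_comm])
  simp only [Nat.size_pow] at h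
  exact h

end Arithmetic

/-! ### Writing down the first-order formula -/

/-- The value `2 ^ i` and the number formed by the last `i` bits of `N`, as terms. -/
def RTerm.bin (N : ℕ) : ℕ → RTerm × RTerm
  | 0 => (RTerm.one, RTerm.zero)
  | i + 1 => (RTerm.add (bin N i).1 (bin N i).1, RTerm.add (bin N i).2
      (if 0 < N &&& 2 ^ i then (bin N i).1 else RTerm.zero))

lemma RTerm.eval_bin (N : ℕ) (ρ : ℕ → ℝ) (i : ℕ) :
    (RTerm.bin N i).1.eval ρ = ((2 ^ i : ℕ) : ℝ) ∧
      (RTerm.bin N i).2.eval ρ = ((N % 2 ^ i : ℕ) : ℝ) := by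
  induction i with
  | zero => simp [RTerm.bin, RTerm.eval, Nat.mod_one]
  | succ i ih =>
    obtain ⟨h1, h2⟩ := ih
    refine ⟨?_, ?_⟩
    · simp only [RTerm.bin, RTerm.eval, h1]
      push_cast
      ring
    · simp only [RTerm.bin, RTerm.eval, h2, Nat.and_two_pow, Nat.mod_pow_succ, ← Nat.toNat_testBit]
      cases h : N.testBit i
      · simp [RTerm.eval]
      · simp [h1]

/-- The code of an equation. -/
def eqCode (s t : ℕ) : ℕ :=
  Nat.pair 2 (Nat.pair (Nat.pair 0 (Nat.pair s t)) (Nat.pair 0 (Nat.pair t s)))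

lemma RForm.toNat_exBlock (L : ℕ) (f : RForm) :
    (RForm.exBlock L f).toNat = (fun v => Nat.pair 4 v)^[L] f.toNat := by
  induction L with
  | zero => rfl
  | succ L ih => rw [Function.iterate_succ_apply', ← ih]; rfl

section

variable {γ : Type} [Reg γ]

lemma Cmp.eqCode {f g : ℕ → γ → ℕ} (hf : Cmp f) (hg : Cmp g) :
    Cmp (fun N x => NCRSPPaper.eqCode (f N x) (g N x)) :=
  (Cmp.const 2).pair (((Cmp.const 0).pair (hf.pair hg)).pair ((Cmp.const 0).pair (hg.pair hf)))

lemma Lin.eqCode {f g : ℕ → γ → ℕ} (hf : Lin f) (hg : Lin g) :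
    Lin (fun N x => NCRSPPaper.eqCode (f N x) (g N x)) :=
  (Lin.const 2).pair (((Lin.const 0).pair (hf.pair hg)).pair ((Lin.const 0).pair (hg.pair hf)))

lemma Cmp.exBlock {f : ℕ → RForm} (hf : Cmp (fun N (_ : γ) => (f N).toNat)) :
    Cmp (fun N (_ : γ) => (RForm.exBlock (NCRSPPaper.bound N) (f N)).toNat) := by
  simp only [RForm.toNat_exBlock]
  exact Cmp.iterate_bound (step := fun _ (x : γ × ℕ) => Nat.pair 4 x.2) hf
    ((Cmp.const 4).pair Cmp.id.snd) ((Lin.const 4).pair Lin.id.snd)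

lemma Cmp.bin : Cmp (fun N (_ : γ) => (RTerm.bin N (NCRSPPaper.bound N)).2.toNat) := by
  have h := Cmp.iterate_bound (γ := γ) (σ := ℕ × ℕ × ℕ)
    (init := fun _ _ => (1, RTerm.one.toNat, RTerm.zero.toNat))
    (step := fun N x => (x.2.1 + x.2.1, Nat.pair 3 (Nat.pair x.2.2.1 x.2.2.1),
      Nat.pair 3 (Nat.pair x.2.2.2 (if 0 < N &&& x.2.1 then x.2.2.1 else RTerm.zero.toNat))))
    ((Cmp.const _).prodMk ((Cmp.const _).prodMk (Cmp.const _)))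
    ((Cmp.id.snd.fst.add Cmp.id.snd.fst).prodMk
      (((Cmp.const 3).pair (Cmp.id.snd.snd.fst.pair Cmp.id.snd.snd.fst)).prodMk
        ((Cmp.const 3).pair (Cmp.id.snd.snd.snd.pair (Cmp.ite (Cmp.const 0)
          (Cmp.input.land Cmp.id.snd.fst) Cmp.id.snd.snd.fst (Cmp.const _))))))
    ((Lin.id.snd.fst.add Lin.id.snd.fst).prodMk
      (((Lin.const 3).pair (Lin.id.snd.snd.fst.pair Lin.id.snd.snd.fst)).prodMk
        ((Lin.const 3).pair (Lin.id.snd.snd.snd.pair (Lin.ite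
          Lin.id.snd.snd.fst (Lin.const _))))))
  have key (N : ℕ) (i : ℕ) : (fun st : ℕ × ℕ × ℕ => (st.1 + st.1, Nat.pair 3
    (Nat.pair st.2.1 st.2.1),
      Nat.pair 3 (Nat.pair st.2.2 (if 0 < N &&& st.1 then st.2.1 else RTerm.zero.toNat))))^[i]
      (1, RTerm.one.toNat, RTerm.zero.toNat) =
      (2 ^ i, (RTerm.bin N i).1.toNat, (RTerm.bin N i).2.toNat) := by
    induction i with
    | zero => rfl
    | succ i ih =>
      rw [Function.iterate_succ_apply', ih]
      simp only [RTerm.bin, RTerm.toNat, Prod.mk.injEq, true_and]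
      refine ⟨by ring, ?_⟩
      split_ifs <;> rfl
  have h2 := h.snd.snd
  simp only [key] at h2
  exact h2

lemma Cmp.select (a b c : ℕ) : Cmp (fun N (_ : γ) =>
    (RForm.select (NCRSPPaper.bound N) a b c (NCRSPPaper.bound N)).toNat) := by
  have h := Cmp.iterate_bound (γ := ℕ × ℕ × ℕ) (σ := ℕ × ℕ × ℕ)
    (init := fun _ g => ((RForm.le RTerm.one RTerm.zero).toNat, g.1, RTerm.zero.toNat))
    (step := fun _ x => (Nat.pair 3 (Nat.pair x.2.1 (Nat.pair 2 (Nat.pair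
      (NCRSPPaper.eqCode x.1.2.1 x.2.2.2) (NCRSPPaper.eqCode x.1.2.2 (Nat.pair 0 x.2.2.1))))),
      x.2.2.1 + 1, Nat.pair 3 (Nat.pair x.2.2.2 RTerm.one.toNat)))
    ((Cmp.const _).prodMk (Cmp.id.fst.prodMk (Cmp.const _)))
    (((Cmp.const 3).pair (Cmp.id.snd.fst.pair ((Cmp.const 2).pair
      ((Cmp.eqCode Cmp.id.fst.snd.fst Cmp.id.snd.snd.snd).pair
        (Cmp.eqCode Cmp.id.fst.snd.snd ((Cmp.const 0).pair Cmp.id.snd.snd.fst)))))).prodMk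
      ((Cmp.id.snd.snd.fst.add (Cmp.const 1)).prodMk
        ((Cmp.const 3).pair (Cmp.id.snd.snd.snd.pair (Cmp.const _)))))
    (((Lin.const 3).pair (Lin.id.snd.fst.pair ((Lin.const 2).pair
      ((Lin.eqCode Lin.id.fst.snd.fst Lin.id.snd.snd.snd).pair
        (Lin.eqCode Lin.id.fst.snd.snd ((Lin.const 0).pair Lin.id.snd.snd.fst)))))).prodMk
      ((Lin.id.snd.snd.fst.add (Lin.const 1)).prodMk
        ((Lin.const 3).pair (Lin.id.snd.snd.snd.pair (Lin.const _)))))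
  have key (L i : ℕ) : (fun st : ℕ × ℕ × ℕ => (Nat.pair 3 (Nat.pair st.1 (Nat.pair 2 (Nat.pair
      (NCRSPPaper.eqCode (Nat.pair 0 (b * L)) st.2.2)
      (NCRSPPaper.eqCode (Nat.pair 0 (c * L)) (Nat.pair 0 st.2.1))))),
      st.2.1 + 1, Nat.pair 3 (Nat.pair st.2.2 RTerm.one.toNat)))^[i]
      ((RForm.le RTerm.one RTerm.zero).toNat, a * L, RTerm.zero.toNat) =
      ((RForm.select L a b c i).toNat, a * L + i, (RTerm.unary i).toNat) := by
    induction i with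
    | zero => rfl
    | succ i ih =>
      rw [Function.iterate_succ_apply', ih]
      rfl
  have h2 := (h.comp (((Cmp.const a).mul Cmp.bound).prodMk
    (((Cmp.const 0).pair ((Cmp.const b).mul Cmp.bound)).prodMk
      ((Cmp.const 0).pair ((Cmp.const c).mul (Cmp.bound (γ := γ))))))).fst
  simp only [key] at h2
  exact h2

lemma Cmp.scale (t : RTerm) : Cmp (fun N (_ : γ) => (t.scale (NCRSPPaper.bound N)).toNat) := by
  induction t with
  | var j => exact (Cmp.const 0).pair ((Cmp.const j).mul Cmp.bound)
  | zero => exact Cmp.const _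
  | one => exact Cmp.const _
  | add s t h1 h2 => exact (Cmp.const 3).pair (h1.pair h2)
  | mul s t h1 h2 => exact (Cmp.const 4).pair (h1.pair h2)

lemma Cmp.compile (φ : Sch) : Cmp (fun N (_ : γ) => (φ.compile (NCRSPPaper.bound N)).toNat) := by
  induction φ with
  | le s t => exact (Cmp.const 0).pair ((Cmp.scale s).pair (Cmp.scale t))
  | not φ h => exact (Cmp.const 1).pair h
  | and φ ψ h1 h2 => exact (Cmp.const 2).pair (h1.pair h2)
  | sel a b c => exact Cmp.select a b c
  | ex φ h => exact Cmp.exBlock h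

end

/-- The first-order sentence expressing a property of the number `N`. -/
def sentence (φ : Sch) (N : ℕ) : RForm :=
  RForm.exBlock (bound N) (RForm.and
    (RForm.eq (RTerm.var 0) (RTerm.bin N (bound N)).2) (φ.compile (bound N)))

lemma cmp_sentence {γ : Type} [Reg γ] (φ : Sch) :
    Cmp (fun N (_ : γ) => (sentence φ N).toNat) :=
  Cmp.exBlock ((Cmp.const 2).pair ((Cmp.eqCode (Cmp.const _) Cmp.bin).pair (Cmp.compile φ)))

lemma valid_sentence {P : ℕ → ℕ → Prop} {φ : Sch}
    (hφ : ∀ L, 0 < L → ∀ (x : ℕ) ρ, Ctx.Rep L x ρ → (φ.sat L ρ ↔ P L x)) (N : ℕ) :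
    (sentence φ N).valid ↔ P (bound N) N := by
  have hL : 0 < bound N := by unfold bound; omega
  have hN : N % 2 ^ bound N = N := Nat.mod_eq_of_lt ((Nat.lt_size_self N).trans_le
    (Nat.pow_le_pow_right (by norm_num) (by unfold bound; nlinarith)))
  have key (ρ : ℕ → ℝ) : (sentence φ N).holds ρ ↔ P (bound N) N := by
    rw [sentence, RForm.holds_exBlock]
    have hc (r : ℕ → ℝ) (hr : r 0 = N) :
        (φ.compile (bound N)).holds r ↔ P (bound N) N := by
      rw [Sch.holds_compile hL φ r (fun j i => r (j * bound N + i)) fun _ _ _ => rfl]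
      exact hφ _ hL N _ (show r (0 * bound N + 0) = N by simpa using hr)
    constructor
    · rintro ⟨a, h1, h2⟩
      rw [RForm.holds_eq, (RTerm.eval_bin N _ _).2, hN] at h1
      exact (hc (fun i => if i < bound N then a i else ρ (i - bound N)) h1).mp h2
    · intro h
      refine ⟨fun _ => N, ?_, (hc _ ?_).mpr h⟩
      · rw [RForm.holds_eq, (RTerm.eval_bin N _ _).2, hN]
        simp [RTerm.eval, hL]
      · simp [hL]
  exact ⟨fun h => (key _).mp (h (fun _ => 0)), fun h ρ => (key ρ).mpr h⟩

lemma exists_sentence : ∃ φ : Sch, ∀ I : MullerInstance,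
    (sentence φ I.code).valid ↔ I.AnswerStationary := by
  obtain ⟨φ, hφ⟩ := defPred_codeAnswer
  refine ⟨φ, fun I => ?_⟩
  rw [valid_sentence hφ, codeAnswer_iff, MullerInstance.AnswerStationary,
    ncrspAnswer_iff_matrixAnswer I.wf]

/-! ### Flat code -/

/-- Instructions: an operation, or a jump unless the first register is smaller. -/
inductive Instr : Type
  | op : OpKind → ℕ → ℕ → ℕ → Instr
  | jge : ℕ → ℕ → ℕ → Instr

/-- The effect of an instruction on the program counter and the registers. -/
def Instr.exec (pc : ℕ) (s : ℕ → ℕ) : Instr → ℕ × (ℕ → ℕ)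
  | op k r x y => (pc + 1, Function.update s r (k.eval (s x) (s y)))
  | jge x y l => (if s x < s y then pc + 1 else l, s)

/-- `Flat P pc s t pc' s'` means that `t` instructions lead from `(pc, s)` to `(pc', s')`. -/
inductive Flat (P : List Instr) : ℕ → (ℕ → ℕ) → ℕ → ℕ → (ℕ → ℕ) → Prop
  | refl (pc s) : Flat P pc s 0 pc s
  | head {pc s t pc' s'} {i : Instr} : P[pc]? = some i → (i.exec pc s).1 ≤ P.length →
      Flat P (i.exec pc s).1 (i.exec pc s).2 t pc' s' → Flat P pc s (t + 1) pc' s'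

lemma Flat.trans {P : List Instr} {pc s t pc' s' t' pc'' s''} (h : Flat P pc s t pc' s')
    (h' : Flat P pc' s' t' pc'' s'') : Flat P pc s (t + t') pc'' s'' := by
  induction h with
  | refl => rwa [Nat.zero_add]
  | head h1 h2 _ ih =>
    rw [Nat.add_right_comm]
    exact Flat.head h1 h2 (ih h')

/-- The flat code of a program placed at a given address. -/
def Prog.flat : Prog → ℕ → List Instr
  | skip, _ => []
  | op k r x y, _ => [Instr.op k r x y]
  | seq p q, l => flat p l ++ flat q (l + (flat p l).length)
  | whileLt x y p, l => Instr.jge x y (l + (flat p (l + 1)).length + 2) ::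
      (flat p (l + 1) ++ [Instr.jge 0 0 l])

lemma Ex.flat {p : Prog} {s t s'} (h : Ex p s t s') : ∀ l₁ l₂ : List Instr,
    Flat (l₁ ++ p.flat l₁.length ++ l₂) l₁.length s t
      (l₁.length + (p.flat l₁.length).length) s' := by
  induction h with
  | skip s => exact fun l₁ l₂ => Flat.refl _ _
  | op k r x y s =>
    intro l₁ l₂
    refine Flat.head (i := Instr.op k r x y) (by simp [Prog.flat]) ?_ (Flat.refl _ _)
    simp [Prog.flat, Instr.exec]
  | seq _ _ ih1 ih2 =>
    rename_i p q _ _ _ _ _ _ _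
    intro l₁ l₂
    have h1 := ih1 l₁ (q.flat (l₁.length + (p.flat l₁.length).length) ++ l₂)
    have h2 := ih2 (l₁ ++ p.flat l₁.length) l₂
    simp only [Prog.flat, List.length_append, List.append_assoc, Nat.add_assoc] at h1 h2 ⊢
    exact h1.trans h2
  | @done p x y s h =>
    intro l₁ l₂
    refine Flat.head (i := Instr.jge x y (l₁.length + (p.flat (l₁.length + 1)).length + 2))
      (by simp [Prog.flat]) ?_ ?_
    · simp only [Prog.flat, Instr.exec, if_neg h, List.length_append, List.length_cons,
        List.length_nil]
      omega
    · simp only [Instr.exec, if_neg h, Prog.flat, List.length_append, List.length_cons,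
        List.length_nil]
      rw [show l₁.length + ((p.flat (l₁.length + 1)).length + (0 + 1) + 1) =
        l₁.length + (p.flat (l₁.length + 1)).length + 2 by omega]
      exact Flat.refl _ _
  | @step p x y s t s' t' s'' h _ _ ih1 ih2 =>
    intro l₁ l₂
    have h1 := ih1 (l₁ ++ [Instr.jge x y (l₁.length + (p.flat (l₁.length + 1)).length + 2)])
      (Instr.jge 0 0 l₁.length :: l₂)
    have h2 := ih2 l₁ l₂
    simp only [List.length_append, List.length_cons, List.length_nil, Nat.zero_add,
      List.append_assoc, List.cons_append, List.nil_append] at h1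
    have he : l₁ ++ (Prog.whileLt x y p).flat l₁.length ++ l₂ =
        l₁ ++ Instr.jge x y (l₁.length + (p.flat (l₁.length + 1)).length + 2) ::
          (p.flat (l₁.length + 1) ++ Instr.jge 0 0 l₁.length :: l₂) := by
      simp [Prog.flat]
    rw [he] at h2 ⊢
    have h3 : Flat (l₁ ++ Instr.jge x y (l₁.length + (p.flat (l₁.length + 1)).length + 2) ::
        (p.flat (l₁.length + 1) ++ Instr.jge 0 0 l₁.length :: l₂))
        (l₁.length + 1 + (p.flat (l₁.length + 1)).length) s' 1 l₁.length s' := by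
      refine Flat.head (i := Instr.jge 0 0 l₁.length) ?_ ?_ ?_
      · rw [List.getElem?_append_right (by omega), List.getElem?_cons,
          if_neg (by omega), List.getElem?_append_right (by omega)]
        rw [show l₁.length + 1 + (p.flat (l₁.length + 1)).length - l₁.length - 1 -
          (p.flat (l₁.length + 1)).length = 0 by omega]
        rfl
      · simp [Instr.exec]
      · simp only [Instr.exec, lt_irrefl, if_false]
        exact Flat.refl _ _
    rw [show t + t' + 2 = t + (1 + t') + 1 by omega]
    refine Flat.head (i := Instr.jge x y (l₁.length + (p.flat (l₁.length + 1)).length + 2))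
      (by simp) ?_ ?_
    · simp only [Instr.exec, if_pos h, List.length_append, List.length_cons]
      omega
    · simp only [Instr.exec, if_pos h]
      exact h1.trans (h3.trans h2)

/-! ### Machines with structured states and symbols -/

/-- Tape symbols: blanks, input bits, and further symbols. -/
abbrev Sym (K : Type) := Option Bool ⊕ K

/-- A Turing machine with states in `Q`. -/
structure Mach (Q K : Type) where
  start : Q
  step : Q → Sym K → Option (Q × Sym K × Bool)

namespace Mach

variable {Q K : Type} (M : Mach Q K)

/-- Reachability in a given number of steps. -/
inductive Reach : Q → (ℕ → Sym K) → ℕ → ℕ → Q → (ℕ → Sym K) → ℕ → Prop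
  | refl (q w i) : Reach q w i 0 q w i
  | head {q w i q' a mv t q'' w'' i''} : M.step q (w i) = some (q', a, mv) →
      Reach q' (Function.update w i a) (if mv then i + 1 else i - 1) t q'' w'' i'' →
      Reach q w i (t + 1) q'' w'' i''

variable {M}

lemma Reach.trans {q w i t q' w' i' t' q'' w'' i''} (h : M.Reach q w i t q' w' i')
    (h' : M.Reach q' w' i' t' q'' w'' i'') : M.Reach q w i (t + t') q'' w'' i'' := by
  induction h with
  | refl => rwa [Nat.zero_add]
  | head h1 _ ih =>
    rw [Nat.add_right_comm]
    exact Reach.head h1 (ih h')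

/-- The numbering of symbols. -/
def symNum {n : ℕ} (e : K → Fin n) : Sym K → Fin (n + 3)
  | Sum.inl none => blankSym n
  | Sum.inl (some b) => bitSym n b
  | Sum.inr k => ⟨e k + 3, by have := (e k).2; omega⟩

lemma symNum_injective {n : ℕ} {e : K → Fin n} (he : Function.Injective e) :
    Function.Injective (symNum e) := by
  rintro ((_ | _ | _) | k) ((_ | _ | _) | l) h <;>
    simp_all [symNum, blankSym, bitSym, Fin.ext_iff]
  exact he (Fin.ext h)

/-- The machine as a machine with numbered states and symbols. -/
lemma exists_tm [Finite Q] [Finite K] (M : Mach Q K) : ∃ (T : TM) (e : Sym K → Fin (T.symbols + 3)),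
    e (Sum.inl none) = blankSym _ ∧ (∀ b, e (Sum.inl (some b)) = bitSym _ b) ∧
    ∀ (x : List Bool) t q w i, M.Reach M.start (fun j => Sum.inl x[j]?) 0 t q w i →
      M.step q (w i) = none → ∃ c, T.run x t = some c ∧ T.Halted c ∧ c.tape = fun j => e (w j) := by
  obtain ⟨m, ⟨eQ⟩⟩ := Finite.exists_equiv_fin Q
  obtain ⟨n, ⟨eK⟩⟩ := Finite.exists_equiv_fin K
  have hm : ∃ m', m = m' + 1 := ⟨m - 1, by have := (eQ M.start).2; omega⟩
  obtain ⟨m, rfl⟩ := hm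
  have : Nonempty (Sym K) := ⟨Sum.inl none⟩
  set e := symNum eK with he
  have hinv : ∀ a, Function.invFun e (e a) = a :=
    Function.leftInverse_invFun (symNum_injective eK.injective)
  let T : TM :=
    { states := m
      symbols := n
      start := eQ M.start
      accept := eQ M.start
      step := fun q a => (M.step (eQ.symm q) (Function.invFun e a)).map
        fun z => (eQ z.1, e z.2.1, z.2.2) }
  have hstep (q : Q) (w : ℕ → Sym K) (i : ℕ) : T.step (eQ q) (e (w i)) =
      (M.step q (w i)).map fun z => (eQ z.1, e z.2.1, z.2.2) := by
    simp only [T, hinv, Equiv.symm_apply_apply]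
  have hreach {q w i t q' w' i'} (h : M.Reach q w i t q' w' i') (x : List Bool) :
      ∀ u, T.run x u = some ⟨eQ q, fun j => e (w j), i⟩ →
        T.run x (u + t) = some ⟨eQ q', fun j => e (w' j), i'⟩ := by
    induction h with
    | refl => exact fun u h => h
    | @head q w i q' a mv t q'' w'' i'' h1 _ ih =>
      intro u hu
      rw [show u + (t + 1) = (u + 1) + t by omega]
      refine ih (u + 1) ?_
      rw [TM.run, hu, Option.bind_some, TM.stepCfg]
      simp only [hstep, h1, Option.map_some]
      congr 2
      funext j
      by_cases hj : j = i
      · subst hj; simp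
      · simp [Function.update_of_ne hj]
  refine ⟨T, e, rfl, fun b => rfl, fun x t q w i h hn => ⟨⟨eQ q, fun j => e (w j), i⟩, ?_, ?_, rfl⟩⟩
  · have := hreach h x 0 ?_
    · rwa [Nat.zero_add] at this
    · rw [TM.run, initCfg]
      congr 2
      funext j
      by_cases hj : j < x.length
      · simp [hj, e, symNum]
        rfl
      · simp [hj, e, symNum]
        rfl
  · rw [TM.Halted, TM.stepCfg]
    simp only [hstep, hn, Option.map_none]

end Mach

/-! ### Bitwise execution of instructions -/

/-- One bit of the result of an operation, and the carry. -/
def OpKind.bit : OpKind → Bool → Bool → Bool → Bool × Bool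
  | add, x, y, b => (x ^^ y ^^ b, (x && y) || (x && b) || (y && b))
  | land, x, y, _ => (x && y, false)
  | const _, _, _, b => (b, false)

/-- The initial carry. -/
def Instr.carryInit : Instr → Bool
  | op (OpKind.const b) _ _ _ => b
  | _ => false

/-- The effect of an instruction on one bit of each register, and the carry. -/
def Instr.bit (f : ℕ → Bool) (b : Bool) : Instr → (ℕ → Bool) × Bool
  | op k r x y => (Function.update f r (k.bit (f x) (f y) b).1, (k.bit (f x) (f y) b).2)
  | jge x y _ => (f, if f x = f y then b else f y)

/-- The next program counter, depending on the final carry. -/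
def Instr.next (pc : ℕ) (b : Bool) : Instr → ℕ
  | op _ _ _ _ => pc + 1
  | jge _ _ l => if b then pc + 1 else l

/-- The bits at a given position. -/
def col (s : ℕ → ℕ) (j : ℕ) (r : ℕ) : Bool := (s r).testBit j

/-- The carry at a given position. -/
def Instr.carry (i : Instr) (s : ℕ → ℕ) : ℕ → Bool
  | 0 => i.carryInit
  | j + 1 => (i.bit (col s j) (carry i s j)).2

lemma carry_add (r x y : ℕ) (s : ℕ → ℕ) (j : ℕ) : (Instr.op OpKind.add r x y).carry s j =
    decide (2 ^ j ≤ s x % 2 ^ j + s y % 2 ^ j) := by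
  induction j with
  | zero => simp [Instr.carry, Instr.carryInit, Nat.mod_one]
  | succ j ih =>
    rw [Instr.carry, ih]
    simp only [Instr.bit, OpKind.bit, col, Nat.mod_pow_succ]
    have hx := Nat.mod_lt (s x) (show 0 < 2 ^ j by positivity)
    have hy := Nat.mod_lt (s y) (show 0 < 2 ^ j by positivity)
    rw [pow_succ, ← Nat.toNat_testBit, ← Nat.toNat_testBit]
    generalize 2 ^ j = p at *
    generalize s x % p = u at *
    generalize s y % p = v at *
    cases (s x).testBit j <;> cases (s y).testBit j <;> simp <;> omega

lemma bit_add (r x y : ℕ) (s : ℕ → ℕ) (j : ℕ) :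
    (OpKind.add.bit (col s j x) (col s j y) ((Instr.op OpKind.add r x y).carry s j)).1 =
      (s x + s y).testBit j := by
  rw [carry_add]
  simp only [OpKind.bit, col, Nat.testBit_eq_decide_div_mod_eq,
    Nat.add_div (show 0 < 2 ^ j by positivity)]
  generalize s x / 2 ^ j = u
  generalize s y / 2 ^ j = v
  rcases Nat.mod_two_eq_zero_or_one u with hu | hu <;>
    rcases Nat.mod_two_eq_zero_or_one v with hv | hv <;>
    by_cases h : 2 ^ j ≤ s x % 2 ^ j + s y % 2 ^ j <;> simp [Nat.add_mod, hu, hv, h]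

lemma carry_jge (x y l : ℕ) (s : ℕ → ℕ) (j : ℕ) : (Instr.jge x y l).carry s j =
    decide (s x % 2 ^ j < s y % 2 ^ j) := by
  induction j with
  | zero => simp [Instr.carry, Instr.carryInit, Nat.mod_one]
  | succ j ih =>
    rw [Instr.carry, ih]
    simp only [Instr.bit, col, Nat.mod_pow_succ]
    have hx := Nat.mod_lt (s x) (show 0 < 2 ^ j by positivity)
    have hy := Nat.mod_lt (s y) (show 0 < 2 ^ j by positivity)
    rw [← Nat.toNat_testBit, ← Nat.toNat_testBit]
    have key (u v p : ℕ) (a b : Bool) (hu : u < p) (hv : v < p) :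
        (if a = b then decide (u < v) else b) = decide (u + p * a.toNat < v + p * b.toNat) := by
      cases a <;> cases b <;> simp <;> omega
    exact key _ _ _ _ _ hx hy

lemma bit_eq_col (i : Instr) (pc : ℕ) (s : ℕ → ℕ) (j : ℕ) :
    (i.bit (col s j) (i.carry s j)).1 = col (i.exec pc s).2 j := by
  rcases i with ⟨k, r, x, y⟩ | ⟨x, y, l⟩
  · have h : (k.bit (col s j x) (col s j y) ((Instr.op k r x y).carry s j)).1 =
        (k.eval (s x) (s y)).testBit j := by
      rcases k with _ | _ | b
      · exact bit_add r x y s j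
      · simp [OpKind.bit, OpKind.eval, col]
      · cases j with
        | zero => cases b <;> simp [OpKind.bit, OpKind.eval, Instr.carry, Instr.carryInit]
        | succ j =>
          cases b <;> simp [OpKind.bit, OpKind.eval, Instr.carry, Instr.bit, Nat.testBit_succ]
    funext q
    simp only [Instr.bit, Instr.exec, h]
    by_cases hq : q = r
    · subst hq; simp [col]
    · simp [Function.update_of_ne hq, col]
  · rfl

lemma next_eq (i : Instr) (pc : ℕ) (s : ℕ → ℕ) (m : ℕ) (hs : ∀ r, s r < 2 ^ m) :
    i.next pc (i.carry s m) = (i.exec pc s).1 := by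
  rcases i with ⟨k, r, x, y⟩ | ⟨x, y, l⟩
  · rfl
  · simp only [Instr.next, Instr.exec, carry_jge, Nat.mod_eq_of_lt (hs _), decide_eq_true_eq]

lemma Instr.exec_lt (i : Instr) (pc : ℕ) (s : ℕ → ℕ) (m : ℕ) (hs : ∀ r, s r < 2 ^ m) (r : ℕ) :
    (i.exec pc s).2 r < 2 ^ (m + 1) := by
  have h : s r < 2 ^ (m + 1) := (hs r).trans (Nat.pow_lt_pow_right (by norm_num) (by omega))
  rcases i with ⟨k, q, x, y⟩ | ⟨x, y, l⟩
  · simp only [Instr.exec]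
    by_cases hq : r = q
    · subst hq
      rw [Function.update_self]
      exact k.eval_lt (hs x) (hs y)
    · rwa [Function.update_of_ne hq]
  · exact h

/-! ### A Turing machine for flat code -/

/-- States of the machine executing flat code. -/
inductive Phase (n : ℕ) : Type
  | init : Phase n
  | fwd : Fin (n + 1) → Bool → Phase n
  | bwd : Fin (n + 1) → Phase n
  | seek : Phase n
  | write : Bool → Phase n
  | halt : Phase n

instance (n : ℕ) : Finite (Phase n) := by
  let f : Phase n → Fin 6 × Fin (n + 1) × Bool
    | Phase.init => (0, 0, false)
    | Phase.fwd pc b => (1, pc, b)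
    | Phase.bwd pc => (2, pc, false)
    | Phase.seek => (3, 0, false)
    | Phase.write b => (4, 0, b)
    | Phase.halt => (5, 0, false)
  refine Finite.of_injective f ?_
  rintro (_ | ⟨_, _⟩ | _ | _ | _ | _) (_ | ⟨_, _⟩ | _ | _ | _ | _) h <;> simp_all [f]

/-- Further tape symbols: a mark and one bit of each of the `R` registers. -/
abbrev Cell (R : ℕ) := Bool × (Fin R → Bool)

namespace Sym

variable {R : ℕ}

/-- The bit of register `r`. -/
def bitAt : Sym (Cell R) → ℕ → Bool
  | Sum.inl none, _ => false
  | Sum.inl (some b), r => decide (r = 0) && b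
  | Sum.inr k, r => if h : r < R then k.2 ⟨r, h⟩ else false

/-- Whether the cell is marked. -/
def marked : Sym (Cell R) → Bool
  | Sum.inl _ => false
  | Sum.inr k => k.1

/-- Whether the cell is blank. -/
def isBlank : Sym (Cell R) → Bool
  | Sum.inl none => true
  | _ => false

/-- The symbol with a given mark and given bits. -/
def cell (m : Bool) (f : ℕ → Bool) : Sym (Cell R) := Sum.inr (m, fun r => f r)

lemma bitAt_cell (m : Bool) {f : ℕ → Bool} (hf : ∀ r, R ≤ r → f r = false) :
    bitAt (cell (R := R) m f) = f := by
  funext r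
  by_cases h : r < R
  · simp [bitAt, cell, h]
  · simp [bitAt, cell, h, hf r (not_lt.mp h)]

lemma isBlank_eq {g : Sym (Cell R)} (h : g.isBlank = true) : g = Sum.inl none := by
  rcases g with (_ | _) | _ <;> simp_all [isBlank]

end Sym

/-- The transition function of the machine executing the code `P`. -/
def sweepStep (P : List Instr) (R out : ℕ) :
    Phase P.length → Sym (Cell R) → Option (Phase P.length × Sym (Cell R) × Bool)
  | Phase.init, g => some (Phase.bwd 0, Sym.cell true g.bitAt, false)
  | Phase.fwd pc b, g =>
      match P[(pc : ℕ)]? with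
      | none => none
      | some i =>
          if g.isBlank then
            some (Phase.bwd (Fin.ofNat _ (i.next pc (i.bit g.bitAt b).2)),
              Sym.cell false (i.bit g.bitAt b).1, false)
          else some (Phase.fwd pc (i.bit g.bitAt b).2, Sym.cell g.marked (i.bit g.bitAt b).1, true)
  | Phase.bwd pc, g =>
      if g.marked then
        match P[(pc : ℕ)]? with
        | none => some (Phase.seek, g, false)
        | some i => some (Phase.fwd pc i.carryInit, g, false)
      else some (Phase.bwd pc, g, false)
  | Phase.seek, g => if g.isBlank then some (Phase.write false, g, false)
      else some (Phase.seek, g, true)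
  | Phase.write b, g => some (if g.marked then Phase.halt else Phase.write (b || g.bitAt out),
      if b || g.bitAt out then Sum.inl (some (g.bitAt out)) else Sum.inl none, false)
  | Phase.halt, _ => none

/-- The machine executing the code `P`. -/
def sweepMach (P : List Instr) (R out : ℕ) : Mach (Phase P.length) (Cell R) :=
  ⟨Phase.init, sweepStep P R out⟩

/-- The tape stores the registers in the first `m` cells. -/
structure Holds {R : ℕ} (w : ℕ → Sym (Cell R)) (s : ℕ → ℕ) (m : ℕ) : Prop where
  pos : 0 < m
  blank : ∀ j, (w j).isBlank = decide (m ≤ j)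
  mark : ∀ j, (w j).marked = decide (j = 0)
  bits : ∀ j, (w j).bitAt = col s j

namespace Holds

variable {P : List Instr} {R out : ℕ} {w : ℕ → Sym (Cell R)} {s : ℕ → ℕ} {m : ℕ}

lemma col_of_le (h : Holds w s m) {j : ℕ} (hj : m ≤ j) (r : ℕ) : col s j r = false := by
  rw [← h.bits, Sym.isBlank_eq ((h.blank j).trans (decide_eq_true hj)), Sym.bitAt]

lemma lt_pow (h : Holds w s m) (r : ℕ) : s r < 2 ^ m :=
  Nat.lt_pow_two_of_testBit _ fun _ hj => h.col_of_le hj r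

lemma eq_zero (h : Holds w s m) {r : ℕ} (hr : max R 1 ≤ r) : s r = 0 := by
  refine Nat.eq_of_testBit_eq fun j => ?_
  rw [Nat.zero_testBit]
  have h1 := congrFun (h.bits j) r
  rw [col] at h1
  rw [← h1]
  rcases w j with (_ | b) | k
  · rfl
  · simp [Sym.bitAt, show r ≠ 0 by omega]
  · simp [Sym.bitAt, show ¬ r < R by omega]

end Holds

section Sweep

variable {P : List Instr} {R out : ℕ}

open Mach

lemma reach_bwd {w : ℕ → Sym (Cell R)} (hw : ∀ j, (w j).marked = decide (j = 0))
    (pc : Fin (P.length + 1)) (j : ℕ) :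
    (sweepMach P R out).Reach (Phase.bwd pc) w j j (Phase.bwd pc) w 0 := by
  induction j with
  | zero => exact Reach.refl _ _ _
  | succ j ih =>
    refine Reach.head (q' := Phase.bwd pc) (a := w (j + 1)) (mv := false) ?_ ?_
    · simp [sweepMach, sweepStep, hw]
    · simpa using ih

lemma exists_reach_exec {w : ℕ → Sym (Cell R)} {s : ℕ → ℕ} {m : ℕ} (h : Holds w s m)
    (pc : Fin (P.length + 1)) {i : Instr} (hi : P[(pc : ℕ)]? = some i)
    (hd : ∀ r, R ≤ r → (i.exec pc s).2 r = 0) :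
    ∃ w', (sweepMach P R out).Reach (Phase.bwd pc) w 0 (2 * m + 1)
      (Phase.bwd (Fin.ofNat _ (i.exec pc s).1)) w' 0 ∧ Holds w' (i.exec pc s).2 (m + 1) := by
  set s' := (i.exec pc s).2 with hs'
  let mix : ℕ → ℕ → Sym (Cell R) := fun j k =>
    if k < j then Sym.cell (decide (k = 0)) (col s' k) else w k
  have hmix (j : ℕ) : Function.update (mix j) j (Sym.cell (decide (j = 0)) (col s' j)) =
      mix (j + 1) := by
    funext k
    rcases lt_trichotomy k j with hk | rfl | hk
    · simp [mix, Function.update_of_ne hk.ne, hk, Nat.lt_succ_of_lt hk]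
    · simp [mix]
    · simp [mix, Function.update_of_ne hk.ne', hk.not_gt, show ¬ k < j + 1 by omega]
  have hmix' (j : ℕ) : mix j j = w j := if_neg (lt_irrefl j)
  have hcol (k r : ℕ) (hr : R ≤ r) : col s' k r = false := by
    rw [col, hd r hr, Nat.zero_testBit]
  have hfin : Holds (mix (m + 1)) s' (m + 1) := by
    refine ⟨by omega, fun j => ?_, fun j => ?_, fun j => ?_⟩
    · by_cases hj : j < m + 1
      · simp [mix, hj, Sym.cell, Sym.isBlank]
        omega
      · simp only [mix, hj, if_false, h.blank, decide_eq_decide]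
        omega
    · by_cases hj : j < m + 1
      · simp [mix, hj, Sym.cell, Sym.marked]
      · simp only [mix, hj, if_false, h.mark]
    · by_cases hj : j < m + 1
      · simp only [mix, hj, if_true]
        exact Sym.bitAt_cell _ (hcol j)
      · simp only [mix, hj, if_false, h.bits]
        funext r
        rw [h.col_of_le (by omega), col, Nat.testBit_lt_two_pow]
        exact (i.exec_lt pc s m h.lt_pow r).trans_le
          (Nat.pow_le_pow_right (by norm_num) (by omega))
  refine ⟨mix (m + 1), ?_, hfin⟩
  have hfwd (d : ℕ) : ∀ j, j + d = m → (sweepMach P R out).Reach (Phase.fwd pc (i.carry s j))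
      (mix j) j (d + 1) (Phase.bwd (Fin.ofNat _ (i.exec pc s).1)) (mix (m + 1)) (m - 1) := by
    induction d with
    | zero =>
      rintro j rfl
      refine Reach.head (q' := Phase.bwd (Fin.ofNat _ (i.exec pc s).1))
        (a := Sym.cell (decide (j = 0)) (col s' j)) (mv := false) ?_ ?_
      · have hj : 0 < j := h.pos
        have hn : i.next pc (i.carry s (j + 1)) = (i.exec pc s).1 :=
          next_eq i pc s (j + 1) fun r => (h.lt_pow r).trans
            (Nat.pow_lt_pow_right (by norm_num) (by omega))
        rw [Instr.carry] at hn
        simp only [sweepMach, sweepStep, hi, hmix', h.blank, h.bits, bit_eq_col i pc s j]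
        simp [hn, hj.ne', hs']
      · rw [hmix]
        exact Reach.refl _ _ _
    | succ d ih =>
      intro j hj
      refine Reach.head (q' := Phase.fwd pc (i.carry s (j + 1)))
        (a := Sym.cell (decide (j = 0)) (col s' j)) (mv := true) ?_ ?_
      · simp only [sweepMach, sweepStep, hi, hmix', h.blank, h.bits, h.mark, bit_eq_col i pc s j,
          show ¬ m ≤ j by omega]
        simp [Instr.carry, hs']
      · rw [hmix]
        exact ih (j + 1) (by omega)
  have h1 := (hfwd m 0 (by omega)).trans (reach_bwd hfin.mark _ (m - 1))
  rw [show 2 * m + 1 = (m + 1 + (m - 1)) + 1 by have := h.pos; omega]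
  refine Reach.head (q' := Phase.fwd pc i.carryInit) (a := w 0) (mv := false) ?_ ?_
  · simp [sweepMach, sweepStep, h.mark, hi]
  · rw [Function.update_eq_self]
    have h0 : mix 0 = w := by
      funext k
      simp [mix]
    rw [h0] at h1
    exact h1

lemma exists_reach_flat (hR : 0 < R) (hP : ∀ i ∈ P, ∀ pc s, (∀ r, R ≤ r → s r = 0) →
      ∀ r, R ≤ r → (Instr.exec pc s i).2 r = 0) {pc s t pc' s'}
    (h : Flat P pc s t pc' s') : ∀ {w : ℕ → Sym (Cell R)} {m : ℕ}, Holds w s m → pc ≤ P.length →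
    ∃ w' u, u ≤ t * (2 * (m + t) + 1) ∧ (sweepMach P R out).Reach (Phase.bwd (Fin.ofNat _ pc)) w 0 u
      (Phase.bwd (Fin.ofNat _ pc')) w' 0 ∧ Holds w' s' (m + t) := by
  induction h with
  | refl => exact fun {w m} hw _ => ⟨w, 0, Nat.zero_le _, Reach.refl _ _ _, hw⟩
  | @head pc s t pc' s' i h1 h2 _ ih =>
    intro w m hw hpc
    have hv : ((Fin.ofNat (P.length + 1) pc : Fin (P.length + 1)) : ℕ) = pc :=
      Nat.mod_eq_of_lt (by omega)
    obtain ⟨w1, hr1, hw1⟩ := exists_reach_exec (out := out) hw (Fin.ofNat _ pc) (i := i)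
      (by rw [hv]; exact h1) (by
        rw [hv]
        exact hP i (List.mem_of_getElem? h1) pc s fun r hr => hw.eq_zero (by omega))
    rw [hv] at hr1 hw1
    obtain ⟨w2, u, hu, hr2, hw2⟩ := ih hw1 h2
    refine ⟨w2, 2 * m + 1 + u, ?_, hr1.trans hr2, by rwa [show m + (t + 1) = m + 1 + t by omega]⟩
    rw [Nat.add_mul, one_mul, show m + (t + 1) = m + 1 + t by omega]
    omega

lemma lt_size_iff (v j : ℕ) : j < Nat.size v ↔ j + 1 < Nat.size v ∨ v.testBit j = true := by
  rw [Nat.lt_size, Nat.lt_size, Nat.testBit_eq_decide_div_mod_eq, decide_eq_true_eq, pow_succ]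
  have h : 0 < 2 ^ j := by positivity
  constructor
  · intro h1
    by_cases h2 : 2 ^ j * 2 ≤ v
    · exact Or.inl h2
    · right
      have : v / 2 ^ j = 1 := by
        rw [Nat.div_eq_iff h]
        omega
      rw [this]
  · rintro (h1 | h1)
    · omega
    · by_contra h2
      rw [Nat.div_eq_of_lt (by omega)] at h1
      omega

lemma exists_reach_output {w : ℕ → Sym (Cell R)} {s : ℕ → ℕ} {m : ℕ} (h : Holds w s m)
    (pc : Fin (P.length + 1)) (hpc : P[(pc : ℕ)]? = none) :
    ∃ w', (sweepMach P R out).Reach (Phase.bwd pc) w 0 (2 * m + 2) Phase.halt w' 0 ∧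
      ∀ j, w' j = if j < Nat.size (s out) then Sum.inl (some ((s out).testBit j))
        else Sum.inl none := by
  set v := s out with hv
  let fin : ℕ → Sym (Cell R) := fun j =>
    if j < Nat.size v then Sum.inl (some (v.testBit j)) else Sum.inl none
  let mix : ℕ → ℕ → Sym (Cell R) := fun j k => if k < j then w k else fin k
  have hmix (j : ℕ) : Function.update (mix (j + 1)) j (fin j) = mix j := by
    funext k
    rcases lt_trichotomy k j with hk | rfl | hk
    · rw [Function.update_of_ne hk.ne]
      simp only [mix, hk, Nat.lt_succ_of_lt hk, if_true]
    · simp [mix]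
    · rw [Function.update_of_ne hk.ne']
      simp only [mix, hk.not_gt, show ¬ k < j + 1 by omega, if_false]
  have hmix' (j : ℕ) : mix (j + 1) j = w j := if_pos (Nat.lt_succ_self j)
  have hsize : Nat.size v ≤ m := Nat.size_le.mpr (h.lt_pow out)
  have hb (j : ℕ) : (decide (j + 1 < Nat.size v) || (w j).bitAt out) =
      decide (j < Nat.size v) := by
    rw [h.bits, col, Bool.eq_iff_iff, decide_eq_true_eq, Bool.or_eq_true, decide_eq_true_eq]
    exact (lt_size_iff _ _).symm
  have hwrite (j : ℕ) : (sweepMach P R out).Reach (Phase.write (decide (j + 1 < Nat.size v)))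
      (mix (j + 1)) j (j + 1) Phase.halt (mix 0) 0 := by
    induction j with
    | zero =>
      refine Reach.head (q' := Phase.halt) (a := fin 0) (mv := false) ?_ ?_
      · simp only [sweepMach, sweepStep, hmix', hb, h.mark]
        simp [fin, h.bits, col, ← hv]
      · rw [hmix]
        exact Reach.refl _ _ _
    | succ j ih =>
      refine Reach.head (q' := Phase.write (decide (j + 1 < Nat.size v))) (a := fin (j + 1))
        (mv := false) ?_ ?_
      · simp only [sweepMach, sweepStep, hmix', hb, h.mark]
        simp [fin, h.bits, col, ← hv]
      · rw [hmix]
        exact ih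
  have hseek (d : ℕ) : ∀ j, j + d = m → (sweepMach P R out).Reach Phase.seek w j (d + 1)
      (Phase.write false) w (m - 1) := by
    induction d with
    | zero =>
      rintro j rfl
      refine Reach.head (q' := Phase.write false) (a := w j) (mv := false) ?_ ?_
      · simp [sweepMach, sweepStep, h.blank]
      · rw [Function.update_eq_self]
        exact Reach.refl _ _ _
    | succ d ih =>
      intro j hj
      refine Reach.head (q' := Phase.seek) (a := w j) (mv := true) ?_ ?_
      · simp [sweepMach, sweepStep, h.blank, show j < m by omega]
      · rw [Function.update_eq_self]
        exact ih (j + 1) (by omega)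
  have hm := h.pos
  have hmw : mix m = w := by
    funext k
    by_cases hk : k < m
    · simp [mix, hk]
    · simp only [mix, hk, if_false, fin, show ¬ k < Nat.size v by omega]
      exact (Sym.isBlank_eq ((h.blank k).trans (decide_eq_true (by omega)))).symm
  have h2 := hwrite (m - 1)
  rw [show m - 1 + 1 = m by omega, hmw, decide_eq_false (by omega)] at h2
  refine ⟨mix 0, ?_, fun j => rfl⟩
  rw [show 2 * m + 2 = (m + 1 + m) + 1 by omega]
  refine Reach.head (q' := Phase.seek) (a := w 0) (mv := false) ?_ ?_
  · simp [sweepMach, sweepStep, h.mark, hpc]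
  · rw [Function.update_eq_self]
    exact (hseek m 0 (by omega)).trans h2

end Sweep

/-! ### Computing the sentence -/

lemma getElem?_bits (n j : ℕ) :
    (Nat.bits n)[j]? = if j < Nat.size n then some (n.testBit j) else none := by
  rw [← Nat.size_eq_bits_len]
  split
  · rename_i h
    rw [List.getElem?_eq_getElem h, Nat.testBit_eq_inth, List.getI_eq_getElem _ h]
  · rename_i h
    exact List.getElem?_eq_none (not_lt.mp h)

lemma exists_exec_eq (P : List Instr) : ∃ R, 0 < R ∧ ∀ i ∈ P, ∀ pc s r, R ≤ r →
    (Instr.exec pc s i).2 r = s r := by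
  induction P with
  | nil => exact ⟨1, one_pos, by simp⟩
  | cons i P ih =>
    obtain ⟨R, h1, h2⟩ := ih
    have h3 : ∃ R', ∀ pc s r, R' ≤ r → (Instr.exec pc s i).2 r = s r := by
      cases i with
      | op k r x y => exact ⟨r + 1, fun pc s r' hr => Function.update_of_ne (by omega) _ _⟩
      | jge x y l => exact ⟨0, fun _ _ _ _ => rfl⟩
    obtain ⟨R', h3⟩ := h3
    refine ⟨R + R', by omega, fun i' hi pc s r hr => ?_⟩
    rcases List.mem_cons.mp hi with rfl | hi
    · exact h3 pc s r (by omega)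
    · exact h2 i' hi pc s r (by omega)

lemma exists_reach_start (P : List Instr) {R : ℕ} (out : ℕ) (hR : 0 < R) (n : ℕ) :
    ∃ w : ℕ → Sym (Cell R), (sweepMach P R out).Reach Phase.init
      (fun j => Sum.inl (Nat.bits n)[j]?) 0 1 (Phase.bwd 0) w 0 ∧
      Holds w (fun r => if r = 0 then n else 0) (max 1 (Nat.size n)) := by
  set w₀ : ℕ → Sym (Cell R) := fun j => Sum.inl (Nat.bits n)[j]? with hw₀
  have hbits (j : ℕ) : (w₀ j).bitAt = col (fun r => if r = 0 then n else 0) j := by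
    funext r
    simp only [hw₀, getElem?_bits, col]
    by_cases hj : j < Nat.size n
    · by_cases hr : r = 0 <;> simp [hj, hr, Sym.bitAt]
    · have : n.testBit j = false :=
        Nat.testBit_lt_two_pow ((Nat.lt_size_self n).trans_le
          (Nat.pow_le_pow_right (by norm_num) (not_lt.mp hj)))
      by_cases hr : r = 0 <;> simp [hj, hr, this, Sym.bitAt]
  have hw (j : ℕ) (hj : j ≠ 0) : Function.update w₀ 0 (Sym.cell true (w₀ 0).bitAt) j = w₀ j :=
    Function.update_of_ne hj _ _
  refine ⟨Function.update w₀ 0 (Sym.cell true (w₀ 0).bitAt),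
    Mach.Reach.head (q' := Phase.bwd 0) (mv := false) rfl (Mach.Reach.refl _ _ _),
    by omega, fun j => ?_, fun j => ?_, fun j => ?_⟩
  all_goals rcases eq_or_ne j 0 with rfl | hj
  · simp [Sym.cell, Sym.isBlank]
  · rw [hw j hj]
    simp only [hw₀, getElem?_bits]
    by_cases h : j < Nat.size n
    · simp [h, Sym.isBlank]
    · simp only [h, if_false, Sym.isBlank]
      simp
      omega
  · simp [Sym.cell, Sym.marked]
  · rw [hw j hj]
    simp [hw₀, Sym.marked, hj]
  · rw [Function.update_self, ← hbits]
    refine Sym.bitAt_cell _ fun r hr => ?_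
    rw [hbits]
    simp [col, show r ≠ 0 by omega]
  · rw [hw j hj, hbits]

lemma time_le (k N t : ℕ) (ht : t ≤ param N ^ k) :
    1 + t * (2 * (max 1 (Nat.size N) + t) + 1) + (2 * (max 1 (Nat.size N) + t) + 2) ≤
      2 ^ ((Nat.size N) ^ (20 * (k + 1) + 2) + (20 * (k + 1) + 2)) := by
  set m := Nat.size N with hm
  set T := 2 ^ (bound N * (k + 1)) with hT
  have hB : bound N = (m + 1) * (m + 1) + 1 := rfl
  have hB2 : m + 1 < bound N := by rw [hB]; nlinarith
  have hBT : bound N < T := (Nat.lt_two_pow_self).trans_le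
    (Nat.pow_le_pow_right (by norm_num) (Nat.le_mul_of_pos_right _ (by omega)))
  have htT : t ≤ T := by
    refine ht.trans ?_
    rw [param, ← pow_mul]
    exact Nat.pow_le_pow_right (by norm_num) (Nat.mul_le_mul_left _ (by omega))
  have hm0 : max 1 m ≤ T := by omega
  have h3T : 3 ≤ T := by omega
  have h1 : 1 + t * (2 * (max 1 m + t) + 1) + (2 * (max 1 m + t) + 2) ≤ T ^ 4 := by
    have h3 : t * (2 * (max 1 m + t) + 1) ≤ T * (4 * T + 1) :=
      Nat.mul_le_mul htT (by omega)
    have h4 : 3 * T ≤ T * T := Nat.mul_le_mul_right _ h3T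
    have h5 : 9 * (T * T) ≤ T ^ 4 := by
      rw [show T ^ 4 = (T * T) * (T * T) by ring]
      exact Nat.mul_le_mul_right _ (by omega)
    have h6 : T * (4 * T + 1) = 4 * (T * T) + T := by ring
    omega
  refine h1.trans ?_
  rw [hT, ← pow_mul]
  refine Nat.pow_le_pow_right (by norm_num) ?_
  rw [hB]
  by_cases h2 : 2 ≤ m
  · have h3 : 20 * (k + 1) ≤ m ^ (20 * (k + 1)) :=
      (Nat.lt_two_pow_self).le.trans (Nat.pow_le_pow_left h2 _)
    have h4 : (m + 1) * (m + 1) + 1 ≤ 4 * m ^ 2 := by nlinarith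
    have h5 : m ^ (20 * (k + 1) + 2) = m ^ (20 * (k + 1)) * m ^ 2 := pow_add _ _ _
    have h6 := Nat.mul_le_mul_right (m ^ 2) h3
    have h7 := Nat.mul_le_mul_right ((k + 1) * 4) h4
    rw [h5]
    nlinarith
  · have h3 : (m + 1) * (m + 1) ≤ 2 * 2 := Nat.mul_le_mul (by omega) (by omega)
    have h4 := Nat.mul_le_mul_right ((k + 1) * 4) (Nat.add_le_add_right h3 1)
    rw [← mul_assoc] at h4
    omega

lemma exists_tm_sentence (φ : Sch) : ∃ (M : TM) (d : ℕ),
    M.ComputesOn encodeMullerInstance (fun I => encodeRForm (sentence φ I.code))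
      (fun m => 2 ^ (m ^ d + d)) := by
  obtain ⟨p, b, e', -, -, h⟩ := cmp_sentence (γ := Unit) φ (fun _ => 0) 1 one_pos
    (fun j hj => absurd hj (Nat.not_lt_zero j))
  obtain ⟨k, hk⟩ := h 0
  set P := p.flat 0 with hP
  obtain ⟨R, hR, hd⟩ := exists_exec_eq P
  obtain ⟨T, e, h0, h1, hT⟩ := (sweepMach P R (b 0)).exists_tm
  refine ⟨T, 20 * (k + 1) + 2, fun I => ?_⟩
  set N := I.code with hN
  obtain ⟨-, t, ht, s', hex, -, hs'⟩ := hk N () (fun r => if r = 0 then N else 0) rfl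
    (fun j hj => absurd hj (Nat.not_lt_zero j)) (fun j hj => absurd hj (Nat.not_lt_zero j))
  rw [stored_nat] at hs'
  obtain ⟨w, hr, hw⟩ := exists_reach_start P (b 0) hR N
  have hf := hex.flat [] []
  simp only [List.nil_append, List.append_nil, List.length_nil, Nat.zero_add] at hf
  obtain ⟨w', u, hu, hr', hw'⟩ := exists_reach_flat (out := b 0) hR
    (fun i hi pc s hs r hr => (hd i hi pc s r hr).trans (hs r hr)) hf hw (Nat.zero_le _)
  obtain ⟨w'', hr'', hw''⟩ := exists_reach_output (out := b 0) hw' (Fin.ofNat _ P.length)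
    (List.getElem?_eq_none (Nat.mod_eq_of_lt (Nat.lt_succ_self _)).ge)
  obtain ⟨c, hc1, hc2, hc3⟩ := hT (Nat.bits N) _ _ _ _ ((hr.trans hr').trans hr'') rfl
  refine ⟨_, ?_, c, hc1, hc2, ?_⟩
  · refine le_trans ?_ ((time_le k N t ht).trans_eq ?_)
    · omega
    · rw [← Nat.size_eq_bits_len]
      rfl
  · set v := s' (b 0) with hv
    have he : encodeRForm (sentence φ N) = Nat.bits v := congrArg Nat.bits hs'.symm
    change readsOff c.tape (encodeRForm (sentence φ N))
    rw [he, hc3]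
    clear_value v
    refine ⟨fun i => ?_, ?_⟩
    · have hi : (i : ℕ) < (Nat.bits v).length := i.2
      have hg := getElem?_bits v i
      rw [List.getElem?_eq_getElem hi, ← Nat.size_eq_bits_len, if_pos hi, Option.some_inj] at hg
      change e (w'' i) = _
      rw [hw'', ← Nat.size_eq_bits_len, if_pos hi, h1, ← hg]
      rfl
    · change e (w'' (Nat.bits v).length) = _
      rw [hw'', if_neg (by rw [Nat.size_eq_bits_len]; exact lt_irrefl _), h0]

/-- From an SMG with Muller objectives and a threshold
`μ ∈ [0,1]` one can construct, in exponential time, a first-order sentence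
`ψ` over `(ℝ, +, ×, 0, 1, ≤)` that is true iff the answer of
Stationary-Muller-NCRSP for `(G, μ)` is yes. -/
theorem stationary_muller_NCRSP_to_real_FO :
    ∃ (f : MullerInstance → RForm) (M : TM) (c : ℕ),
      M.ComputesOn encodeMullerInstance (fun I => encodeRForm (f I))
        (fun m => 2 ^ (m ^ c + c)) ∧
      ∀ I : MullerInstance, ((f I).valid ↔ I.AnswerStationary) := by
  obtain ⟨φ, hφ⟩ := exists_sentence
  obtain ⟨M, c, hM⟩ := exists_tm_sentence φ
  exact ⟨fun I => sentence φ I.code, M, c, hM, hφ⟩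

end NCRSPPaper
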